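/- Assume (H1) and (H2)*, and let ψ_t[h] denote, for each bounded measurable h : D×V → [0,∞), the unique solution of the mild NTE with initial datum h that is uniformly bounded on D×V×[0,T] for every T > 0. Then there exist λ* ∈ ℝ, a bounded measurable function φ : D×V → (0,∞), and a bounded measurable function φ̃ : D×V → [0,∞) with ∫_{D×V} φ̃ > 0, such that: (i) ψ_t[φ] = e^{λ* t}·φ on D×V for all t ≥ 0; (ii) ∫_{D×V} φ̃·ψ_t[g] dr dυ = e^{λ* t}·∫_{D×V} φ̃·g dr dυ for all t ≥ 0 and all bounded measurable g : D×V → [0,∞); (iii) φ is bounded away from 0 on every compact subset of D×V, and φ̃ is almost everywhere bounded away from 0 on every compact subset of D×V; (iv) there exist ε > 0, C > 0 and T > 0 such that for all t ≥ T and all measurable g with 0 ≤ g ≤ 1, sup_{(r,υ)∈D×V} |e^{−λ* t}·ψ_t[g](r,υ)/φ(r,υ) − ∫_{D×V} φ̃·g| ≤ C·e^{−ε t}. -/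

import Mathlib

open MeasureTheory Set
open scoped ENNReal

noncomputable section

/-- Points/velocities live in `ℝ³`. -/
abbrev Pt : Type := EuclideanSpace ℝ (Fin 3)

/-- The velocity space `V = {υ ∈ ℝ³ : vmin ≤ ‖υ‖ ≤ vmax}`. -/
def Vel (vmin vmax : ℝ) : Set Pt := {υ : Pt | vmin ≤ ‖υ‖ ∧ ‖υ‖ ≤ vmax}

/-- The exit time `κ_{r,υ} = inf {t > 0 : r + tυ ∉ D}`. -/
def exitTime (D : Set Pt) (r υ : Pt) : ℝ := sInf {t : ℝ | 0 < t ∧ r + t • υ ∉ D}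

/-- The advection semigroup `U_t[g](r,υ) = g(r+υt, υ)·1_{t < κ_{r,υ}}`. -/
def advect (D : Set Pt) (g : Pt → Pt → ℝ) (t : ℝ) (r υ : Pt) : ℝ :=
  if t < exitTime D r υ then g (r + t • υ) υ else 0

/-- The combined backwards scatter-plus-fission operator `(S + F) f`,
extended by zero outside `D × V`. -/
def scatFis (D V : Set Pt) (σs σf : Pt → Pt → ℝ) (πs πf : Pt → Pt → Pt → ℝ)
    (f : Pt → Pt → ℝ) (r υ : Pt) : ℝ :=
  (D ×ˢ V).indicator
    (fun p : Pt × Pt =>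
      σs p.1 p.2 * ((∫ υ' in V, f p.1 υ' * πs p.1 p.2 υ') - f p.1 p.2) +
      σf p.1 p.2 * ((∫ υ' in V, f p.1 υ' * πf p.1 p.2 υ') - f p.1 p.2))
    (r, υ)

/-- `g` is a nonnegative, bounded, measurable function on `Pt × Pt` (in curried form). -/
def BddMeasNN (g : Pt → Pt → ℝ) : Prop :=
  Measurable (Function.uncurry g) ∧ (∀ r υ, 0 ≤ g r υ) ∧ ∃ M : ℝ, ∀ r υ, g r υ ≤ M

/-- `ψ` is a family of nonnegative bounded measurable functions, vanishing off `D × V`,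
solving the mild neutron transport equation
`ψ_t[g] = U_t[g] + ∫₀ᵗ U_s[(S+F) ψ_{t-s}[g]] ds` pointwise on `D × V` for all `t ≥ 0`. -/
def IsMildSolution (D V : Set Pt) (σs σf : Pt → Pt → ℝ) (πs πf : Pt → Pt → Pt → ℝ)
    (g : Pt → Pt → ℝ) (ψ : ℝ → Pt → Pt → ℝ) : Prop :=
  (∀ t : ℝ, Measurable (Function.uncurry (ψ t))) ∧
  (∀ t r υ, 0 ≤ ψ t r υ) ∧
  (∀ t : ℝ, ∃ M : ℝ, ∀ r υ, ψ t r υ ≤ M) ∧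
  (∀ t r υ, (r, υ) ∉ D ×ˢ V → ψ t r υ = 0) ∧
  (∀ t : ℝ, 0 ≤ t → ∀ r υ : Pt, (r, υ) ∈ D ×ˢ V →
    ψ t r υ = advect D g t r υ +
      ∫ s in (0:ℝ)..t, advect D (scatFis D V σs σf πs πf (ψ (t - s))) s r υ)

/-- Uniform boundedness on `D × V × [0,T]` for every `T > 0`. -/
def TimeLocBounded (ψ : ℝ → Pt → Pt → ℝ) : Prop :=
  ∀ T : ℝ, 0 < T → ∃ M : ℝ, ∀ t ∈ Icc (0:ℝ) T, ∀ r υ : Pt, ψ t r υ ≤ M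

/-- The standing context of the paper: `D ⊆ ℝ³` nonempty, open, bounded, convex with
Lebesgue-null boundary; `0 < vmin < vmax`; measurable nonnegative cross-sections and
kernels, with `π_s(r,υ,·)` a probability density on `V`; and (H1): all cross-sections
and kernels uniformly bounded. -/
structure NTEContext (D : Set Pt) (vmin vmax : ℝ)
    (σs σf : Pt → Pt → ℝ) (πs πf : Pt → Pt → Pt → ℝ) : Prop where
  D_nonempty : D.Nonempty
  D_open : IsOpen D
  D_bounded : Bornology.IsBounded D
  D_convex : Convex ℝ D
  D_frontier_null : volume (frontier D) = 0
  vmin_pos : 0 < vmin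
  vmin_lt_vmax : vmin < vmax
  σs_meas : Measurable (Function.uncurry σs)
  σf_meas : Measurable (Function.uncurry σf)
  πs_meas : Measurable fun p : Pt × Pt × Pt => πs p.1 p.2.1 p.2.2
  πf_meas : Measurable fun p : Pt × Pt × Pt => πf p.1 p.2.1 p.2.2
  σs_nonneg : ∀ r υ, 0 ≤ σs r υ
  σf_nonneg : ∀ r υ, 0 ≤ σf r υ
  πs_nonneg : ∀ r υ υ', 0 ≤ πs r υ υ'
  πf_nonneg : ∀ r υ υ', 0 ≤ πf r υ υ'
  πs_prob : ∀ r ∈ D, ∀ υ ∈ Vel vmin vmax, (∫ υ' in Vel vmin vmax, πs r υ υ') = 1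
  H1 : ∃ M : ℝ, (∀ r υ, σs r υ ≤ M) ∧ (∀ r υ, σf r υ ≤ M) ∧
        (∀ r υ υ', πs r υ υ' ≤ M) ∧ (∀ r υ υ', πf r υ υ' ≤ M)

lemma lt_exitTime_iff {D : Set Pt} (hD : IsOpen D) (hc : Convex ℝ D)
    (hb : Bornology.IsBounded D) {r υ : Pt} (hr : r ∈ D) (hυ : υ ≠ 0) {t : ℝ} (ht : 0 ≤ t) :
    t < exitTime D r υ ↔ r + t • υ ∈ D := by
  have hbelow : BddBelow {t : ℝ | 0 < t ∧ r + t • υ ∉ D} := ⟨0, fun s hs => hs.1.le⟩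
  constructor
  · intro h
    by_contra hcon
    rcases ht.eq_or_lt with h0 | h0
    · apply hcon; simpa [← h0] using hr
    · exact absurd (csInf_le hbelow ⟨h0, hcon⟩) (not_le.2 h)
  · intro h
    have hne : {t : ℝ | 0 < t ∧ r + t • υ ∉ D}.Nonempty := by
      obtain ⟨R, hR0, hR⟩ := hb.exists_pos_norm_le
      refine ⟨(2 * R + 1) / ‖υ‖, by positivity, fun hmem => ?_⟩
      have h1 := hR _ hmem
      have h2 := hR _ hr
      have h3 : ‖((2 * R + 1) / ‖υ‖) • υ‖ = 2 * R + 1 := by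
        rw [norm_smul, Real.norm_eq_abs, abs_of_pos (by positivity)]
        have := norm_pos_iff.2 hυ
        field_simp
      have h4 : ‖((2 * R + 1) / ‖υ‖) • υ‖ ≤ ‖r + ((2 * R + 1) / ‖υ‖) • υ‖ + ‖r‖ := by
        have := norm_sub_le (r + ((2 * R + 1) / ‖υ‖) • υ) r
        simpa using this
      linarith
    have hcont : Continuous fun s : ℝ => r + s • υ := by fun_prop
    have hopen : IsOpen ((fun s : ℝ => r + s • υ) ⁻¹' D) := hD.preimage hcont
    obtain ⟨ε, hε, hball⟩ := Metric.isOpen_iff.1 hopen t h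
    have hmem : r + (t + ε / 2) • υ ∈ D := by
      apply hball
      simp [abs_of_pos hε, hε.lt]
    refine lt_of_lt_of_le (show t < t + ε / 2 by linarith) (le_csInf hne ?_)
    rintro s ⟨hs0, hs⟩
    by_contra hlt
    push Not at hlt
    apply hs
    have hpos : 0 < t + ε / 2 := by linarith
    have := hc hr hmem (show 0 ≤ 1 - s / (t + ε / 2) by
      rw [sub_nonneg, div_le_one hpos]; exact hlt.le) (show 0 ≤ s / (t + ε / 2) by positivity) (by ring)
    convert this using 1
    rw [smul_add, smul_smul, div_mul_cancel₀ _ hpos.ne', ← add_assoc, ← add_smul]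
    simp

lemma segment_mem {D : Set Pt} (hc : Convex ℝ D) {r υ : Pt} {s t : ℝ}
    (hr : r ∈ D) (ht : r + t • υ ∈ D) (h0 : 0 ≤ s) (hst : s ≤ t) : r + s • υ ∈ D := by
  rcases (h0.trans hst).eq_or_lt with h | h
  · obtain rfl : s = t := by linarith
    exact ht
  have := hc hr ht (show 0 ≤ 1 - s / t by
      rw [sub_nonneg, div_le_one h]; exact hst) (show 0 ≤ s / t by positivity) (by ring)
  convert this using 1
  rw [smul_add, smul_smul, div_mul_cancel₀ _ h.ne', ← add_assoc, ← add_smul]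
  simp

lemma isClosed_Vel (vmin vmax : ℝ) : IsClosed (Vel vmin vmax) :=
  (isClosed_le continuous_const continuous_norm).inter (isClosed_le continuous_norm continuous_const)

lemma measurableSet_Vel (vmin vmax : ℝ) : MeasurableSet (Vel vmin vmax) :=
  (isClosed_Vel vmin vmax).measurableSet

lemma isCompact_Vel (vmin vmax : ℝ) : IsCompact (Vel vmin vmax) := by
  refine Metric.isCompact_of_isClosed_isBounded (isClosed_Vel vmin vmax) ?_
  refine (Metric.isBounded_closedBall (x := (0 : Pt)) (r := vmax)).subset ?_
  intro υ hυ
  simpa using hυ.2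

lemma volume_Vel_lt_top (vmin vmax : ℝ) : volume (Vel vmin vmax) < ⊤ :=
  (isCompact_Vel vmin vmax).measure_lt_top

instance isFiniteMeasure_restrict_Vel (vmin vmax : ℝ) :
    IsFiniteMeasure (volume.restrict (Vel vmin vmax) : Measure Pt) :=
  ⟨by simpa using volume_Vel_lt_top vmin vmax⟩

/-- `f` is bounded and measurable on `Pt × Pt` (in curried form). -/
def BddMeas (f : Pt → Pt → ℝ) : Prop :=
  Measurable (Function.uncurry f) ∧ ∃ B : ℝ, ∀ r υ, |f r υ| ≤ B

/-- The combined collision kernel `σ_s π_s + σ_f π_f`. -/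
def collKernel (σs σf : Pt → Pt → ℝ) (πs πf : Pt → Pt → Pt → ℝ) (r υ υ' : Pt) : ℝ :=
  σs r υ * πs r υ υ' + σf r υ * πf r υ υ'

section Context

variable {D : Set Pt} {vmin vmax : ℝ} {σs σf : Pt → Pt → ℝ} {πs πf : Pt → Pt → Pt → ℝ}

lemma NTEContext.measurableSet_phase (ctx : NTEContext D vmin vmax σs σf πs πf) :
    MeasurableSet (D ×ˢ Vel vmin vmax) :=
  ctx.D_open.measurableSet.prod (measurableSet_Vel vmin vmax)

lemma NTEContext.ne_zero (ctx : NTEContext D vmin vmax σs σf πs πf) {υ : Pt}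
    (hυ : υ ∈ Vel vmin vmax) : υ ≠ 0 := by
  rintro rfl
  have := hυ.1
  simp at this
  linarith [ctx.vmin_pos]

lemma NTEContext.measurable_collKernel (ctx : NTEContext D vmin vmax σs σf πs πf) :
    Measurable fun p : Pt × Pt × Pt => collKernel σs σf πs πf p.1 p.2.1 p.2.2 := by
  have h : Measurable fun p : Pt × Pt × Pt => (p.1, p.2.1) := by fun_prop
  have h1 : Measurable fun p : Pt × Pt × Pt => σs p.1 p.2.1 := ctx.σs_meas.comp h
  have h2 : Measurable fun p : Pt × Pt × Pt => σf p.1 p.2.1 := ctx.σf_meas.comp h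
  exact (h1.mul ctx.πs_meas).add (h2.mul ctx.πf_meas)

lemma NTEContext.scatFis_eq (ctx : NTEContext D vmin vmax σs σf πs πf) {f : Pt → Pt → ℝ}
    (hf : BddMeas f) {r υ : Pt} (h : (r, υ) ∈ D ×ˢ Vel vmin vmax) :
    scatFis D (Vel vmin vmax) σs σf πs πf f r υ =
      (∫ υ' in Vel vmin vmax, f r υ' * collKernel σs σf πs πf r υ υ') -
        (σs r υ + σf r υ) * f r υ := by
  obtain ⟨M, hM1, hM2, hM3, hM4⟩ := ctx.H1
  obtain ⟨hfm, B, hB⟩ := hf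
  have hfr : Measurable fun υ' => f r υ' := hfm.comp measurable_prodMk_left
  have key : ∀ π : Pt → Pt → Pt → ℝ, (Measurable fun p : Pt × Pt × Pt => π p.1 p.2.1 p.2.2) →
      (∀ r υ υ', 0 ≤ π r υ υ') → (∀ r υ υ', π r υ υ' ≤ M) →
      Integrable (fun υ' => f r υ' * π r υ υ') (volume.restrict (Vel vmin vmax)) := by
    intro π hπ hπ0 hπM
    have hπm : Measurable fun υ' => π r υ υ' :=
      hπ.comp (measurable_const.prodMk (measurable_const.prodMk measurable_id))
    refine Integrable.of_bound (hfr.mul hπm).aestronglyMeasurable (B * M) (ae_of_all _ fun υ' => ?_)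
    rw [norm_mul, Real.norm_eq_abs, Real.norm_eq_abs, abs_of_nonneg (hπ0 _ _ _)]
    exact mul_le_mul (hB _ _) (hπM _ _ _) (hπ0 _ _ _) ((abs_nonneg _).trans (hB r υ))
  have hs := key πs ctx.πs_meas ctx.πs_nonneg hM3
  have hf' := key πf ctx.πf_meas ctx.πf_nonneg hM4
  have : (∫ υ' in Vel vmin vmax, f r υ' * collKernel σs σf πs πf r υ υ') =
      σs r υ * (∫ υ' in Vel vmin vmax, f r υ' * πs r υ υ') +
      σf r υ * (∫ υ' in Vel vmin vmax, f r υ' * πf r υ υ') := by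
    rw [← integral_const_mul, ← integral_const_mul, ← integral_add (hs.const_mul _) (hf'.const_mul _)]
    congr 1 with υ'
    simp only [collKernel]; ring
  rw [scatFis, indicator_of_mem h, this]
  ring

lemma scatFis_of_notMem {f : Pt → Pt → ℝ} {r υ : Pt} (h : (r, υ) ∉ D ×ˢ Vel vmin vmax) :
    scatFis D (Vel vmin vmax) σs σf πs πf f r υ = 0 := by
  rw [scatFis, indicator_of_notMem h]

/-- Uniform bounds on the collision data. -/
lemma NTEContext.exists_bounds (ctx : NTEContext D vmin vmax σs σf πs πf) :
    ∃ β K : ℝ, 0 < β ∧ 0 < K ∧ (∀ r υ, σs r υ + σf r υ ≤ β) ∧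
      (∀ r υ υ', 0 ≤ collKernel σs σf πs πf r υ υ') ∧
      (∀ r υ υ', collKernel σs σf πs πf r υ υ' ≤ K) := by
  obtain ⟨M, hM1, hM2, hM3, hM4⟩ := ctx.H1
  have hM : 0 ≤ M := (ctx.σs_nonneg 0 0).trans (hM1 0 0)
  refine ⟨M + M + 1, M * M + M * M + 1, by positivity, by positivity, fun r υ => by
    linarith [hM1 r υ, hM2 r υ], fun r υ υ' => ?_, fun r υ υ' => ?_⟩
  · exact add_nonneg (mul_nonneg (ctx.σs_nonneg _ _) (ctx.πs_nonneg _ _ _))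
      (mul_nonneg (ctx.σf_nonneg _ _) (ctx.πf_nonneg _ _ _))
  · have h1 := mul_le_mul (hM1 r υ) (hM3 r υ υ') (ctx.πs_nonneg _ _ _) hM
    have h2 := mul_le_mul (hM2 r υ) (hM4 r υ υ') (ctx.πf_nonneg _ _ _) hM
    simp only [collKernel]; linarith

lemma NTEContext.integrable_mul_collKernel (ctx : NTEContext D vmin vmax σs σf πs πf)
    {f : Pt → Pt → ℝ} (hf : BddMeas f) (r υ : Pt) :
    Integrable (fun υ' => f r υ' * collKernel σs σf πs πf r υ υ')
      (volume.restrict (Vel vmin vmax)) := by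
  obtain ⟨β, K, -, -, -, hK0, hK⟩ := ctx.exists_bounds
  obtain ⟨hfm, B, hB⟩ := hf
  have hfr : Measurable fun υ' => f r υ' := hfm.comp measurable_prodMk_left
  have hm : Measurable fun υ' => collKernel σs σf πs πf r υ υ' :=
    ctx.measurable_collKernel.comp (measurable_const.prodMk (measurable_const.prodMk measurable_id))
  refine Integrable.of_bound (hfr.mul hm).aestronglyMeasurable (B * K) (ae_of_all _ fun υ' => ?_)
  rw [norm_mul, Real.norm_eq_abs, Real.norm_eq_abs, abs_of_nonneg (hK0 _ _ _)]
  exact mul_le_mul (hB _ _) (hK _ _ _) (hK0 _ _ _) ((abs_nonneg _).trans (hB r υ))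

lemma NTEContext.scatFis_bound (ctx : NTEContext D vmin vmax σs σf πs πf) :
    ∃ L : ℝ, 0 < L ∧ ∀ f, BddMeas f → ∀ B, (∀ r υ, |f r υ| ≤ B) → ∀ r υ,
      |scatFis D (Vel vmin vmax) σs σf πs πf f r υ| ≤ L * B := by
  obtain ⟨β, K, hβ, hK, hσ, hK0, hKb⟩ := ctx.exists_bounds
  refine ⟨K * (volume.restrict (Vel vmin vmax)).real univ + β, by positivity, fun f hf B hB r υ => ?_⟩
  have hB0 : 0 ≤ B := (abs_nonneg _).trans (hB 0 0)
  by_cases h : (r, υ) ∈ D ×ˢ Vel vmin vmax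
  · rw [ctx.scatFis_eq hf h]
    have h1 : |∫ υ' in Vel vmin vmax, f r υ' * collKernel σs σf πs πf r υ υ'| ≤
        (B * K) * (volume.restrict (Vel vmin vmax)).real univ := by
      rw [← Real.norm_eq_abs]
      refine norm_integral_le_of_norm_le_const (μ := volume.restrict (Vel vmin vmax))
        (ae_of_all _ fun υ' => ?_)
      rw [norm_mul, Real.norm_eq_abs, Real.norm_eq_abs, abs_of_nonneg (hK0 _ _ _)]
      exact mul_le_mul (hB _ _) (hKb _ _ _) (hK0 _ _ _) hB0
    have h2 : |(σs r υ + σf r υ) * f r υ| ≤ β * B := by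
      rw [abs_mul, abs_of_nonneg (add_nonneg (ctx.σs_nonneg _ _) (ctx.σf_nonneg _ _))]
      exact mul_le_mul (hσ _ _) (hB _ _) (abs_nonneg _) hβ.le
    calc _ ≤ _ := abs_sub _ _
      _ ≤ _ := add_le_add h1 h2
      _ = _ := by ring
  · rw [scatFis_of_notMem h]; simp; positivity

lemma NTEContext.scatFis_add_mul (ctx : NTEContext D vmin vmax σs σf πs πf)
    {f₁ f₂ : Pt → Pt → ℝ} (h₁ : BddMeas f₁) (h₂ : BddMeas f₂) (c : ℝ) (r υ : Pt) :
    scatFis D (Vel vmin vmax) σs σf πs πf (fun r υ => f₁ r υ + c * f₂ r υ) r υ =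
      scatFis D (Vel vmin vmax) σs σf πs πf f₁ r υ +
      c * scatFis D (Vel vmin vmax) σs σf πs πf f₂ r υ := by
  by_cases h : (r, υ) ∈ D ×ˢ Vel vmin vmax
  · have h₃ : BddMeas (fun r υ => f₁ r υ + c * f₂ r υ) := by
      obtain ⟨m₁, B₁, hB₁⟩ := h₁
      obtain ⟨m₂, B₂, hB₂⟩ := h₂
      refine ⟨m₁.add (m₂.const_mul c), B₁ + |c| * B₂, fun r υ => ?_⟩
      refine (abs_add_le _ _).trans (add_le_add (hB₁ _ _) ?_)
      rw [abs_mul]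
      exact mul_le_mul_of_nonneg_left (hB₂ _ _) (abs_nonneg _)
    rw [ctx.scatFis_eq h₁ h, ctx.scatFis_eq h₂ h, ctx.scatFis_eq h₃ h]
    have : (∫ υ' in Vel vmin vmax, (f₁ r υ' + c * f₂ r υ') * collKernel σs σf πs πf r υ υ') =
       (∫ υ' in Vel vmin vmax, f₁ r υ' * collKernel σs σf πs πf r υ υ') +
       c * ∫ υ' in Vel vmin vmax, f₂ r υ' * collKernel σs σf πs πf r υ υ' := by
      rw [← integral_const_mul, ← integral_add (ctx.integrable_mul_collKernel h₁ r υ)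
        ((ctx.integrable_mul_collKernel h₂ r υ).const_mul c)]
      congr 1 with υ'; ring
    rw [this]; ring
  · simp [scatFis_of_notMem h]

/-- Joint measurability of the collision term along a jointly measurable family. -/
lemma NTEContext.measurable_scatFis (ctx : NTEContext D vmin vmax σs σf πs πf)
    {ψ : ℝ → Pt → Pt → ℝ} (hψ : Measurable fun q : ℝ × Pt × Pt => ψ q.1 q.2.1 q.2.2) :
    Measurable fun q : ℝ × Pt × Pt =>
      scatFis D (Vel vmin vmax) σs σf πs πf (ψ q.1) q.2.1 q.2.2 := by
  have key : ∀ π : Pt → Pt → Pt → ℝ, (Measurable fun p : Pt × Pt × Pt => π p.1 p.2.1 p.2.2) →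
      Measurable fun q : ℝ × Pt × Pt =>
        ∫ υ' in Vel vmin vmax, ψ q.1 q.2.1 υ' * π q.2.1 q.2.2 υ' := by
    intro π hπ
    have hm : Measurable fun z : (ℝ × Pt × Pt) × Pt =>
        ψ z.1.1 z.1.2.1 z.2 * π z.1.2.1 z.1.2.2 z.2 := by
      refine Measurable.mul (hψ.comp (g := fun q : ℝ × Pt × Pt => ψ q.1 q.2.1 q.2.2)
        (f := fun z : (ℝ × Pt × Pt) × Pt => (z.1.1, z.1.2.1, z.2)) (by fun_prop)) ?_
      exact hπ.comp (f := fun z : (ℝ × Pt × Pt) × Pt => (z.1.2.1, z.1.2.2, z.2)) (by fun_prop)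
    exact (hm.stronglyMeasurable.integral_prod_right' (ν := volume.restrict (Vel vmin vmax))).measurable
  have h1 : Measurable fun q : ℝ × Pt × Pt => σs q.2.1 q.2.2 := ctx.σs_meas.comp measurable_snd
  have h2 : Measurable fun q : ℝ × Pt × Pt => σf q.2.1 q.2.2 := ctx.σf_meas.comp measurable_snd
  have hE : MeasurableSet {q : ℝ × Pt × Pt | q.2 ∈ D ×ˢ Vel vmin vmax} :=
    measurable_snd ctx.measurableSet_phase
  have := ((h1.mul ((key πs ctx.πs_meas).sub hψ)).add (h2.mul ((key πf ctx.πf_meas).sub hψ))).indicator hE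
  exact this

end Context

open Filter Topology in
/-- The primitive of a bounded, possibly non-measurable function is left continuous: either the
function is integrable up to `u`, or the integral takes its default value just before `u`. -/
lemma tendsto_primitive_left {h : ℝ → ℝ} {u C : ℝ} (hu : 0 < u)
    (hC : ∀ v ∈ Icc 0 u, |h v| ≤ C) :
    Tendsto (fun x => ∫ v in (0:ℝ)..x, h v) (𝓝[<] u) (𝓝 (∫ v in (0:ℝ)..u, h v)) := by
  by_cases hi : IntervalIntegrable h volume 0 u
  · have h1 : IntegrableOn h (uIcc 0 u) := by
      rw [uIcc_of_le hu.le, integrableOn_Icc_iff_integrableOn_Ioc]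
      exact (intervalIntegrable_iff_integrableOn_Ioc_of_le hu.le).1 hi
    have h2 := intervalIntegral.continuousOn_primitive_interval h1
    have h3 := h2 u right_mem_uIcc
    rw [uIcc_of_le hu.le] at h3
    refine h3.mono_left ?_
    rw [nhdsWithin_le_iff]
    filter_upwards [Ioo_mem_nhdsLT hu] with x hx using ⟨hx.1.le, hx.2.le⟩
  · have hex : ∃ x ∈ Ioo 0 u, ¬ IntervalIntegrable h volume 0 x := by
      by_contra hcon
      push Not at hcon
      apply hi
      rw [intervalIntegrable_iff_integrableOn_Ioo_of_le hu.le]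
      have hmeas : AEStronglyMeasurable h (volume.restrict (Ioo 0 u)) := by
        have hU : Ioo 0 u = ⋃ n : ℕ, Ioc 0 (u - u / (n + 2)) := by
          ext x
          simp only [mem_Ioo, mem_iUnion, mem_Ioc]
          constructor
          · rintro ⟨hx0, hxu⟩
            obtain ⟨n, hn⟩ := exists_nat_gt (u / (u - x))
            refine ⟨n, hx0, ?_⟩
            have h1 : 0 < u - x := by linarith
            rw [div_lt_iff₀ h1] at hn
            have h2 : u / (n + 2) ≤ u - x := by
              rw [div_le_iff₀ (by positivity)]; nlinarith
            linarith
          · rintro ⟨n, hx0, hxn⟩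
            have : 0 < u / ((n : ℝ) + 2) := by positivity
            exact ⟨hx0, by linarith⟩
        rw [hU, aestronglyMeasurable_iUnion_iff]
        intro n
        have hlt : u / ((n : ℝ) + 2) < u := by
          rw [div_lt_iff₀ (by positivity)]; nlinarith [(Nat.cast_nonneg n : (0:ℝ) ≤ n)]
        have hp : 0 < u / ((n : ℝ) + 2) := by positivity
        have := hcon (u - u / (n + 2)) ⟨by linarith, by linarith⟩
        rw [intervalIntegrable_iff_integrableOn_Ioc_of_le (by linarith)] at this
        exact this.1
      refine IntegrableOn.of_bound (by simp) hmeas C ?_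
      rw [ae_restrict_iff' measurableSet_Ioo]
      exact ae_of_all _ fun v hv => hC v ⟨hv.1.le, hv.2.le⟩
    obtain ⟨x₀, hx₀, hnot⟩ := hex
    rw [intervalIntegral.integral_undef hi]
    refine tendsto_const_nhds.congr' ?_
    filter_upwards [Ioo_mem_nhdsLT hx₀.2] with x hx
    rw [intervalIntegral.integral_undef]
    intro hcon
    apply hnot
    refine hcon.mono_set ?_
    rw [uIcc_of_le hx₀.1.le, uIcc_of_le (hx₀.1.le.trans hx.1.le)]
    exact Icc_subset_Icc le_rfl hx.1.le

/-- The extension of a family `(ψ_t)_{t ≥ 0}` by zero to negative times. -/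
def posTime (ψ : ℝ → Pt → Pt → ℝ) (t : ℝ) (r υ : Pt) : ℝ := if 0 ≤ t then ψ t r υ else 0

/-- A jointly measurable, locally bounded, possibly signed solution of the mild equation written
along characteristics. -/
structure CharSol (D V : Set Pt) (σs σf : Pt → Pt → ℝ) (πs πf : Pt → Pt → Pt → ℝ)
    (g : Pt → Pt → ℝ) (ψ : ℝ → Pt → Pt → ℝ) : Prop where
  meas : Measurable fun q : ℝ × Pt × Pt => ψ q.1 q.2.1 q.2.2
  bdd : ∀ T : ℝ, ∃ B : ℝ, ∀ t ≤ T, ∀ r υ, |ψ t r υ| ≤ B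
  supp : ∀ t r υ, (r, υ) ∉ D ×ˢ V → ψ t r υ = 0
  neg : ∀ t < 0, ∀ r υ, ψ t r υ = 0
  eq : ∀ t : ℝ, 0 ≤ t → ∀ r υ : Pt, (r, υ) ∈ D ×ˢ V →
    ψ t r υ = (D ×ˢ V).indicator (Function.uncurry g) (r + t • υ, υ) +
      ∫ s in (0:ℝ)..t, scatFis D V σs σf πs πf (ψ (t - s)) (r + s • υ) υ

section Context

variable {D : Set Pt} {vmin vmax : ℝ} {σs σf : Pt → Pt → ℝ} {πs πf : Pt → Pt → Pt → ℝ}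
  {g : Pt → Pt → ℝ} {ψ : ℝ → Pt → Pt → ℝ}

lemma NTEContext.advect_eq (ctx : NTEContext D vmin vmax σs σf πs πf) (g : Pt → Pt → ℝ)
    {r υ : Pt} (h : (r, υ) ∈ D ×ˢ Vel vmin vmax) {t : ℝ} (ht : 0 ≤ t) :
    advect D g t r υ =
      (D ×ˢ Vel vmin vmax).indicator (Function.uncurry g) (r + t • υ, υ) := by
  have := lt_exitTime_iff ctx.D_open ctx.D_convex ctx.D_bounded h.1 (ctx.ne_zero h.2) ht
  rw [advect]
  by_cases hm : r + t • υ ∈ D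
  · rw [if_pos (this.2 hm), indicator_of_mem
      (show (r + t • υ, υ) ∈ D ×ˢ Vel vmin vmax from ⟨hm, h.2⟩)]; rfl
  · rw [if_neg (fun hcon => hm (this.1 hcon)), indicator_of_notMem (fun hcon => hm hcon.1)]

lemma NTEContext.mild_eq (ctx : NTEContext D vmin vmax σs σf πs πf)
    (hψ : IsMildSolution D (Vel vmin vmax) σs σf πs πf g ψ) {t : ℝ} (ht : 0 ≤ t) {r υ : Pt}
    (h : (r, υ) ∈ D ×ˢ Vel vmin vmax) :
    ψ t r υ = (D ×ˢ Vel vmin vmax).indicator (Function.uncurry g) (r + t • υ, υ) +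
      ∫ s in (0:ℝ)..t, scatFis D (Vel vmin vmax) σs σf πs πf (ψ (t - s)) (r + s • υ) υ := by
  rw [hψ.2.2.2.2 t ht r υ h, ctx.advect_eq g h ht]
  congr 1
  refine intervalIntegral.integral_congr fun s hs => ?_
  rw [uIcc_of_le ht] at hs
  beta_reduce
  rw [ctx.advect_eq _ h hs.1]
  by_cases hm : (r + s • υ, υ) ∈ D ×ˢ Vel vmin vmax
  · rw [indicator_of_mem hm]; rfl
  · rw [indicator_of_notMem hm, scatFis_of_notMem hm]

lemma IsMildSolution.exists_bound (hψ : IsMildSolution D (Vel vmin vmax) σs σf πs πf g ψ)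
    (hb : TimeLocBounded ψ) (T : ℝ) :
    ∃ B : ℝ, 0 ≤ B ∧ ∀ t ∈ Icc 0 T, ∀ r υ, |ψ t r υ| ≤ B := by
  obtain ⟨B, hB⟩ := hb (max T 1) (by positivity)
  refine ⟨B, (hψ.2.1 0 0 0).trans (hB 0 ⟨le_rfl, by positivity⟩ 0 0), fun t ht r υ => ?_⟩
  rw [abs_of_nonneg (hψ.2.1 _ _ _)]
  exact hB t ⟨ht.1, ht.2.trans (le_max_left _ _)⟩ r υ

open Filter Topology in
lemma NTEContext.tendsto_left (ctx : NTEContext D vmin vmax σs σf πs πf)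
    (hψ : IsMildSolution D (Vel vmin vmax) σs σf πs πf g ψ) (hb : TimeLocBounded ψ)
    {u : ℝ} (hu : 0 < u) {x υ : Pt} (h : (x - u • υ, υ) ∈ D ×ˢ Vel vmin vmax) :
    Tendsto (fun u' => ψ u' (x - u' • υ) υ) (𝓝[<] u) (𝓝 (ψ u (x - u • υ) υ)) := by
  have hchar : ∀ u', 0 ≤ u' → (x - u' • υ, υ) ∈ D ×ˢ Vel vmin vmax →
      ψ u' (x - u' • υ) υ = (D ×ˢ Vel vmin vmax).indicator (Function.uncurry g) (x, υ) +
        ∫ v in (0:ℝ)..u', scatFis D (Vel vmin vmax) σs σf πs πf (ψ v) (x - v • υ) υ := by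
    intro u' hu' hmem
    rw [ctx.mild_eq hψ hu' hmem]
    congr 1
    · simp
    · have := intervalIntegral.integral_comp_sub_left (a := 0) (b := u')
        (fun v => scatFis D (Vel vmin vmax) σs σf πs πf (ψ v) (x - v • υ) υ) u'
      simp only [sub_self, sub_zero] at this
      rw [← this]
      congr 1 with s
      congr 1
      module
  obtain ⟨L, hL, hLb⟩ := ctx.scatFis_bound
  obtain ⟨B, hB0, hB⟩ := hψ.exists_bound hb u
  rw [hchar u hu.le h]
  have hlim := (tendsto_primitive_left (C := L * B)
    (h := fun v => scatFis D (Vel vmin vmax) σs σf πs πf (ψ v) (x - v • υ) υ) hu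
    (fun v hv => hLb (ψ v) ⟨hψ.1 v, B, hB v hv⟩ B (hB v hv) _ _)).const_add
      ((D ×ˢ Vel vmin vmax).indicator (Function.uncurry g) (x, υ))
  refine hlim.congr' ?_
  have hopen : IsOpen ((fun s : ℝ => x - s • υ) ⁻¹' D) :=
    ctx.D_open.preimage (by fun_prop)
  have hev : ∀ᶠ u' in 𝓝[<] u, x - u' • υ ∈ D :=
    nhdsWithin_le_nhds (hopen.mem_nhds h.1)
  filter_upwards [hev, Ioo_mem_nhdsLT hu] with u' h1 h2
  exact (hchar u' h2.1.le ⟨h1, h.2⟩).symm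

open Filter Topology in
lemma NTEContext.measurable_posTime (ctx : NTEContext D vmin vmax σs σf πs πf)
    (hψ : IsMildSolution D (Vel vmin vmax) σs σf πs πf g ψ) (hb : TimeLocBounded ψ) :
    Measurable fun q : ℝ × Pt × Pt => posTime ψ q.1 q.2.1 q.2.2 := by
  set O : Set (ℝ × Pt × Pt) :=
    {q | 0 < q.1 ∧ (q.2.1 - q.1 • q.2.2, q.2.2) ∈ D ×ˢ Vel vmin vmax} with hO
  have hOm : MeasurableSet O := by
    refine (measurableSet_lt measurable_const measurable_fst).inter ?_
    exact (show Measurable fun q : ℝ × Pt × Pt => (q.2.1 - q.1 • q.2.2, q.2.2) by fun_prop)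
      ctx.measurableSet_phase
  let k : ℕ → ℝ → ℕ := fun n u => ⌈(n + 1 : ℝ) * u⌉₊ - 1
  let τ : ℕ → ℝ → ℝ := fun n u => (k n u : ℝ) / (n + 1)
  have hkm : ∀ n, Measurable (k n) := fun n => by
    have : Measurable fun u : ℝ => ⌈(n + 1 : ℝ) * u⌉₊ := by fun_prop
    exact (measurable_of_countable (fun m : ℕ => m - 1)).comp this
  have hGn : ∀ n, Measurable fun q : ℝ × Pt × Pt =>
      ψ (τ n q.1) (q.2.1 - τ n q.1 • q.2.2) q.2.2 := by
    intro n
    have h1 : Measurable fun z : ℕ × ℝ × Pt × Pt =>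
        ψ ((z.1 : ℝ) / (n + 1)) (z.2.2.1 - ((z.1 : ℝ) / (n + 1)) • z.2.2.2) z.2.2.2 := by
      refine measurable_from_prod_countable_right fun m => ?_
      exact (hψ.1 ((m : ℝ) / (n + 1))).comp
        (f := fun q : ℝ × Pt × Pt => (q.2.1 - ((m : ℝ) / (n + 1)) • q.2.2, q.2.2)) (by fun_prop)
    exact h1.comp (((hkm n).comp measurable_fst).prodMk measurable_id)
  have hτ : ∀ u : ℝ, 0 < u → Tendsto (fun n => τ n u) atTop (𝓝[<] u) := by
    intro u hu
    have hk : ∀ n : ℕ, (n + 1 : ℝ) * u - 1 ≤ k n u ∧ (k n u : ℝ) < (n + 1 : ℝ) * u := by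
      intro n
      have hpos : 0 < (n + 1 : ℝ) * u := by positivity
      have hc : 1 ≤ ⌈(n + 1 : ℝ) * u⌉₊ := Nat.one_le_ceil_iff.2 hpos
      have hcast : (k n u : ℝ) = (⌈(n + 1 : ℝ) * u⌉₊ : ℝ) - 1 := by
        simp only [k]; push_cast [Nat.cast_sub hc]; ring
      rw [hcast]
      have h1 := Nat.le_ceil ((n + 1 : ℝ) * u)
      have h2 := Nat.ceil_lt_add_one hpos.le
      constructor <;> linarith
    refine tendsto_nhdsWithin_iff.2 ⟨?_, Eventually.of_forall fun n => ?_⟩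
    · have hl : Tendsto (fun n : ℕ => u - 1 / ((n : ℝ) + 1)) atTop (𝓝 u) := by
        simpa using tendsto_one_div_add_atTop_nhds_zero_nat.const_sub u
      refine tendsto_of_tendsto_of_tendsto_of_le_of_le hl tendsto_const_nhds (fun n => ?_)
        (fun n => ?_)
      · simp only [τ]
        have hp : (0 : ℝ) < n + 1 := by positivity
        rw [le_div_iff₀ hp, sub_mul, one_div_mul_cancel hp.ne']
        linarith [(hk n).1]
      · simp only [τ]
        rw [div_le_iff₀ (by positivity)]; linarith [(hk n).2]
    · simp only [τ, mem_Iio]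
      rw [div_lt_iff₀ (by positivity)]; linarith [(hk n).2]
  have hG : Measurable (O.indicator fun q : ℝ × Pt × Pt => ψ q.1 (q.2.1 - q.1 • q.2.2) q.2.2) := by
    refine measurable_of_tendsto_metrizable (fun n => (hGn n).indicator hOm) ?_
    rw [tendsto_pi_nhds]
    intro q
    by_cases hq : q ∈ O
    · simp only [indicator_of_mem hq]
      exact (ctx.tendsto_left hψ hb hq.1 hq.2).comp (hτ _ hq.1)
    · simp only [indicator_of_notMem hq]
      exact tendsto_const_nhds
  have h0 : Measurable fun q : ℝ × Pt × Pt => ψ 0 q.2.1 q.2.2 := (hψ.1 0).comp measurable_snd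
  have hpos := hG.comp (show Measurable fun q : ℝ × Pt × Pt => (q.1, q.2.1 + q.1 • q.2.2, q.2.2) by
    fun_prop)
  have hz : MeasurableSet {q : ℝ × Pt × Pt | q.1 = 0} := measurable_fst (measurableSet_singleton 0)
  classical
  have : Measurable fun q : ℝ × Pt × Pt => if q.1 = 0 then ψ 0 q.2.1 q.2.2 else
      O.indicator (fun q : ℝ × Pt × Pt => ψ q.1 (q.2.1 - q.1 • q.2.2) q.2.2)
        (q.1, q.2.1 + q.1 • q.2.2, q.2.2) := Measurable.ite hz h0 hpos
  convert this using 2 with q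
  obtain ⟨t, r, υ⟩ := q
  simp only [posTime]
  rcases lt_trichotomy t 0 with h | h | h
  · rw [if_neg (not_le.2 h), if_neg h.ne, indicator_of_notMem]
    exact fun hcon => absurd hcon.1 (not_lt.2 h.le)
  · simp [h]
  · rw [if_pos h.le, if_neg h.ne']
    by_cases hE : (r, υ) ∈ D ×ˢ Vel vmin vmax
    · rw [indicator_of_mem]
      · simp
      · exact ⟨h, by simpa using hE⟩
    · rw [hψ.2.2.2.1 t r υ hE, indicator_of_notMem]
      intro hcon
      apply hE
      simpa using hcon.2

/-- Mild solutions are automatically jointly measurable, hence solve the equation along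
characteristics. -/
lemma NTEContext.charSol (ctx : NTEContext D vmin vmax σs σf πs πf)
    (hψ : IsMildSolution D (Vel vmin vmax) σs σf πs πf g ψ) (hb : TimeLocBounded ψ) :
    CharSol D (Vel vmin vmax) σs σf πs πf g (posTime ψ) where
  meas := ctx.measurable_posTime hψ hb
  bdd T := by
    obtain ⟨B, hB0, hB⟩ := hψ.exists_bound hb T
    refine ⟨B, fun t ht r υ => ?_⟩
    simp only [posTime]
    split_ifs with h
    · exact hB t ⟨h, ht⟩ r υ
    · simpa using hB0
  supp t r υ h := by
    simp only [posTime]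
    split_ifs
    · exact hψ.2.2.2.1 t r υ h
    · rfl
  neg t ht r υ := by simp [posTime, not_le.2 ht]
  eq t ht r υ h := by
    rw [posTime, if_pos ht, ctx.mild_eq hψ ht h]
    congr 1
    refine intervalIntegral.integral_congr fun s hs => ?_
    rw [uIcc_of_le ht] at hs
    have : posTime ψ (t - s) = ψ (t - s) := by
      ext r υ
      rw [posTime, if_pos (by linarith [hs.2])]
    simp only [this]

lemma CharSol.bddMeas (h : CharSol D (Vel vmin vmax) σs σf πs πf g ψ) (t : ℝ) :
    BddMeas (ψ t) :=
  ⟨h.meas.comp (measurable_const.prodMk measurable_id), (h.bdd t).imp fun _ hB => hB t le_rfl⟩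

/-- The collision term is integrable along characteristics. -/
lemma CharSol.intervalIntegrable (ctx : NTEContext D vmin vmax σs σf πs πf)
    (h : CharSol D (Vel vmin vmax) σs σf πs πf g ψ) (r υ : Pt) (t a b : ℝ) :
    IntervalIntegrable (fun s => scatFis D (Vel vmin vmax) σs σf πs πf (ψ (t - s)) (r + s • υ) υ)
      volume a b := by
  obtain ⟨L, hL, hLb⟩ := ctx.scatFis_bound
  obtain ⟨B, hB⟩ := h.bdd (t - min a b)
  have hm : Measurable fun s : ℝ =>
      scatFis D (Vel vmin vmax) σs σf πs πf (ψ (t - s)) (r + s • υ) υ :=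
    (ctx.measurable_scatFis h.meas).comp
      (show Measurable fun s : ℝ => (t - s, r + s • υ, υ) by fun_prop)
  rw [intervalIntegrable_iff]
  refine Measure.integrableOn_of_bounded (M := L * B) (by simp) hm.aestronglyMeasurable ?_
  rw [ae_restrict_iff' measurableSet_uIoc]
  refine ae_of_all _ fun s hs => ?_
  have hs' : t - s ≤ t - min a b := by
    have : min a b < s := hs.1
    linarith
  exact hLb _ (h.bddMeas _) B (hB _ hs') _ _

/-- Superposition of solutions. -/
lemma CharSol.add_mul (ctx : NTEContext D vmin vmax σs σf πs πf) {g₁ g₂ : Pt → Pt → ℝ}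
    {ψ₁ ψ₂ : ℝ → Pt → Pt → ℝ} (h₁ : CharSol D (Vel vmin vmax) σs σf πs πf g₁ ψ₁)
    (h₂ : CharSol D (Vel vmin vmax) σs σf πs πf g₂ ψ₂) (c : ℝ) :
    CharSol D (Vel vmin vmax) σs σf πs πf (fun r υ => g₁ r υ + c * g₂ r υ)
      (fun t r υ => ψ₁ t r υ + c * ψ₂ t r υ) where
  meas := h₁.meas.add (h₂.meas.const_mul c)
  bdd T := by
    obtain ⟨B₁, hB₁⟩ := h₁.bdd T
    obtain ⟨B₂, hB₂⟩ := h₂.bdd T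
    refine ⟨B₁ + |c| * B₂, fun t ht r υ => ?_⟩
    refine (abs_add_le _ _).trans (add_le_add (hB₁ t ht r υ) ?_)
    rw [abs_mul]
    exact mul_le_mul_of_nonneg_left (hB₂ t ht r υ) (abs_nonneg _)
  supp t r υ h := by simp [h₁.supp t r υ h, h₂.supp t r υ h]
  neg t ht r υ := by simp [h₁.neg t ht r υ, h₂.neg t ht r υ]
  eq t ht r υ h := by
    rw [h₁.eq t ht r υ h, h₂.eq t ht r υ h]
    have : (fun s : ℝ => scatFis D (Vel vmin vmax) σs σf πs πf
          (fun r υ => ψ₁ (t - s) r υ + c * ψ₂ (t - s) r υ) (r + s • υ) υ) =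
        fun s => scatFis D (Vel vmin vmax) σs σf πs πf (ψ₁ (t - s)) (r + s • υ) υ +
          c * scatFis D (Vel vmin vmax) σs σf πs πf (ψ₂ (t - s)) (r + s • υ) υ := by
      ext s
      exact ctx.scatFis_add_mul (h₁.bddMeas _) (h₂.bddMeas _) c _ _
    rw [this, intervalIntegral.integral_add (h₁.intervalIntegrable ctx r υ t 0 t)
      ((h₂.intervalIntegrable ctx r υ t 0 t).const_mul c), intervalIntegral.integral_const_mul]
    by_cases hm : (r + t • υ, υ) ∈ D ×ˢ Vel vmin vmax
    · simp only [indicator_of_mem hm, Function.uncurry]; ring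
    · simp only [indicator_of_notMem hm]; ring

lemma CharSol.eq_zero (ctx : NTEContext D vmin vmax σs σf πs πf)
    (h : CharSol D (Vel vmin vmax) σs σf πs πf (fun _ _ => 0) ψ) (t : ℝ) (r υ : Pt) :
    ψ t r υ = 0 := by
  obtain ⟨L, hL, hLb⟩ := ctx.scatFis_bound
  obtain ⟨B, hB⟩ := h.bdd t
  have hB0 : 0 ≤ B := (abs_nonneg _).trans (hB t le_rfl 0 0)
  have key : ∀ n : ℕ, ∀ u ≤ t, 0 ≤ u → ∀ r υ,
      |ψ u r υ| ≤ B * (1 / 2) ^ n * Real.exp (2 * L * u) := by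
    intro n
    induction n with
    | zero =>
      intro u hu hu0 r υ
      refine (hB u hu r υ).trans ?_
      rw [pow_zero, mul_one]
      exact le_mul_of_one_le_right hB0 (Real.one_le_exp (by positivity))
    | succ n ih =>
      intro u hu hu0 r υ
      by_cases hE : (r, υ) ∈ D ×ˢ Vel vmin vmax
      · have hz : (D ×ˢ Vel vmin vmax).indicator (Function.uncurry fun _ _ => (0 : ℝ))
            (r + u • υ, υ) = 0 := by
          by_cases hm : (r + u • υ, υ) ∈ D ×ˢ Vel vmin vmax
          · simp [indicator_of_mem hm, Function.uncurry]
          · simp [indicator_of_notMem hm]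
        rw [h.eq u hu0 r υ hE, hz, zero_add]
        have hder : ∀ s ∈ uIcc 0 u, HasDerivAt
            (fun s => -(B * (1 / 2) ^ (n + 1)) * Real.exp (2 * L * (u - s)))
            (L * (B * (1 / 2) ^ n * Real.exp (2 * L * (u - s)))) s := by
          intro s _
          have h1 : HasDerivAt (fun s => 2 * L * (u - s)) (-(2 * L)) s := by
            simpa using ((hasDerivAt_id s).const_sub u).const_mul (2 * L)
          refine (h1.exp.const_mul (-(B * (1 / 2) ^ (n + 1)))).congr_deriv ?_
          rw [pow_succ]; ring
        have hcont : IntervalIntegrable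
            (fun s => L * (B * (1 / 2) ^ n * Real.exp (2 * L * (u - s)))) volume 0 u :=
          Continuous.intervalIntegrable (by fun_prop) _ _
        have hintegral := intervalIntegral.integral_eq_sub_of_hasDerivAt hder hcont
        have hle : |∫ s in (0:ℝ)..u,
            scatFis D (Vel vmin vmax) σs σf πs πf (ψ (u - s)) (r + s • υ) υ| ≤
            ∫ s in (0:ℝ)..u, L * (B * (1 / 2) ^ n * Real.exp (2 * L * (u - s))) := by
          rw [← Real.norm_eq_abs]
          refine intervalIntegral.norm_integral_le_of_norm_le hu0 (ae_of_all _ fun s hs => ?_) hcont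
          exact hLb _ (h.bddMeas _) _ (fun r υ => ih (u - s) (by linarith [hs.1])
            (by linarith [hs.2]) r υ) _ _
        refine hle.trans ?_
        rw [hintegral]
        simp only [sub_self, mul_zero, Real.exp_zero, sub_zero]
        have : 0 ≤ B * (1 / 2 : ℝ) ^ (n + 1) := by positivity
        linarith
      · rw [h.supp u r υ hE, abs_zero]; positivity
  rcases lt_or_ge t 0 with ht | ht
  · exact h.neg t ht r υ
  have hlim : Filter.Tendsto (fun n : ℕ => B * (1 / 2 : ℝ) ^ n * Real.exp (2 * L * t))
      Filter.atTop (nhds 0) := by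
    have := ((tendsto_pow_atTop_nhds_zero_of_lt_one (r := (1 / 2 : ℝ)) (by norm_num)
      (by norm_num)).const_mul B).mul_const (Real.exp (2 * L * t))
    simpa using this
  have := ge_of_tendsto' hlim (fun n => key n t le_rfl ht r υ)
  exact abs_eq_zero.1 (le_antisymm this (abs_nonneg _))

lemma CharSol.congr_init {g' : Pt → Pt → ℝ} (h : CharSol D (Vel vmin vmax) σs σf πs πf g ψ)
    (hg : ∀ r υ, (r, υ) ∈ D ×ˢ Vel vmin vmax → g r υ = g' r υ) :
    CharSol D (Vel vmin vmax) σs σf πs πf g' ψ where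
  meas := h.meas
  bdd := h.bdd
  supp := h.supp
  neg := h.neg
  eq t ht r υ hE := by
    rw [h.eq t ht r υ hE]
    congr 1
    by_cases hm : (r + t • υ, υ) ∈ D ×ˢ Vel vmin vmax
    · simp only [indicator_of_mem hm, Function.uncurry]; exact hg _ _ hm
    · simp only [indicator_of_notMem hm]

lemma CharSol.unique (ctx : NTEContext D vmin vmax σs σf πs πf) {g₁ g₂ : Pt → Pt → ℝ}
    {ψ₁ ψ₂ : ℝ → Pt → Pt → ℝ} (h₁ : CharSol D (Vel vmin vmax) σs σf πs πf g₁ ψ₁)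
    (h₂ : CharSol D (Vel vmin vmax) σs σf πs πf g₂ ψ₂)
    (hg : ∀ r υ, (r, υ) ∈ D ×ˢ Vel vmin vmax → g₁ r υ = g₂ r υ) : ψ₁ = ψ₂ := by
  have h := (h₁.add_mul ctx h₂ (-1)).congr_init (g' := fun _ _ => 0)
    (fun r υ hE => by rw [hg r υ hE]; ring)
  ext t r υ
  have := h.eq_zero ctx t r υ
  linarith

/-- Restarting a solution at time `s`. -/
lemma CharSol.shift (ctx : NTEContext D vmin vmax σs σf πs πf)
    (h : CharSol D (Vel vmin vmax) σs σf πs πf g ψ) {s : ℝ} (hs : 0 ≤ s) :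
    CharSol D (Vel vmin vmax) σs σf πs πf (ψ s) (posTime fun t => ψ (t + s)) where
  meas := by
    refine Measurable.ite (measurableSet_le measurable_const measurable_fst) ?_ measurable_const
    exact h.meas.comp (show Measurable fun q : ℝ × Pt × Pt => (q.1 + s, q.2.1, q.2.2) by fun_prop)
  bdd T := by
    obtain ⟨B, hB⟩ := h.bdd (T + s)
    refine ⟨max B 0, fun t ht r υ => ?_⟩
    simp only [posTime]
    split_ifs
    · exact (hB _ (by linarith) r υ).trans (le_max_left _ _)
    · simp
  supp t r υ hE := by
    simp only [posTime]; split_ifs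
    · exact h.supp _ r υ hE
    · rfl
  neg t ht r υ := by simp [posTime, not_le.2 ht]
  eq t ht r υ hE := by
    have hI := fun a b => h.intervalIntegrable ctx r υ (t + s) a b
    rw [posTime, if_pos ht, h.eq (t + s) (by linarith) r υ hE,
      ← intervalIntegral.integral_add_adjacent_intervals (hI 0 t) (hI t (t + s))]
    have h1 : (∫ v in (0:ℝ)..t, scatFis D (Vel vmin vmax) σs σf πs πf
        (posTime (fun t => ψ (t + s)) (t - v)) (r + v • υ) υ) =
        ∫ v in (0:ℝ)..t, scatFis D (Vel vmin vmax) σs σf πs πf (ψ (t + s - v)) (r + v • υ) υ := by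
      refine intervalIntegral.integral_congr fun v hv => ?_
      rw [uIcc_of_le ht] at hv
      have : posTime (fun t => ψ (t + s)) (t - v) = ψ (t + s - v) := by
        ext r υ
        rw [posTime, if_pos (by linarith [hv.2])]
        congr 1; ring
      simp only [this]
    rw [h1]
    have h2 : (D ×ˢ Vel vmin vmax).indicator (Function.uncurry g) (r + (t + s) • υ, υ) +
        (∫ v in t..(t + s), scatFis D (Vel vmin vmax) σs σf πs πf (ψ (t + s - v)) (r + v • υ) υ) =
        (D ×ˢ Vel vmin vmax).indicator (Function.uncurry (ψ s)) (r + t • υ, υ) := by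
      have hsub : (∫ v in t..(t + s),
          scatFis D (Vel vmin vmax) σs σf πs πf (ψ (t + s - v)) (r + v • υ) υ) =
          ∫ v in (0:ℝ)..s, scatFis D (Vel vmin vmax) σs σf πs πf (ψ (s - v))
            (r + t • υ + v • υ) υ := by
        have := intervalIntegral.integral_comp_add_left (a := 0) (b := s)
          (fun v => scatFis D (Vel vmin vmax) σs σf πs πf (ψ (t + s - v)) (r + v • υ) υ) t
        rw [add_zero] at this
        rw [← this]
        congr 1 with v
        rw [show t + s - (t + v) = s - v by ring, add_smul, add_assoc]
      rw [hsub]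
      by_cases hm : (r + t • υ, υ) ∈ D ×ˢ Vel vmin vmax
      · rw [indicator_of_mem hm, Function.uncurry, h.eq s hs _ _ hm]
        simp only [add_smul, add_assoc]
      · have hout : ∀ v : ℝ, 0 ≤ v → r + t • υ + v • υ ∉ D := by
          intro v hv hcon
          rw [add_assoc, ← add_smul] at hcon
          exact hm ⟨segment_mem ctx.D_convex hE.1 hcon ht (by linarith), hE.2⟩
        rw [indicator_of_notMem hm, indicator_of_notMem, zero_add]
        · rw [intervalIntegral.integral_congr (g := fun _ => (0 : ℝ))]
          · simp
          · intro v hv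
            rw [uIcc_of_le hs] at hv
            exact scatFis_of_notMem fun hcon => hout v hv.1 hcon.1
        · intro hcon
          apply hout s hs
          rw [add_assoc, ← add_smul]
          exact hcon.1
    rw [← h2]; ring

end Context

/-- Duhamel lower bound for an absolutely continuous function with backward derivative at least
`p - β z`. -/
lemma duhamel_lower {H z p : ℝ → ℝ} {G t β : ℝ} (ht : 0 ≤ t)
    (hH : IntervalIntegrable H volume 0 t) (hp : IntervalIntegrable p volume 0 t)
    (hz : ∀ s ∈ Icc 0 t, z s = G + ∫ x in s..t, H x)
    (hle : ∀ s ∈ Icc 0 t, p s - β * z s ≤ H s) :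
    Real.exp (-(β * t)) * G + ∫ s in (0:ℝ)..t, Real.exp (-(β * s)) * p s ≤ z 0 := by
  set u : ℝ → ℝ := fun s => Real.exp (-(β * s)) with hu
  have hud : ∀ s, HasDerivAt u (-β * u s) s := by
    intro s
    have h1 : HasDerivAt (fun s : ℝ => -(β * s)) (-β) s := by
      simpa using (hasDerivAt_id s).const_mul (-β)
    simpa [hu, mul_comm] using h1.exp
  have huc : Continuous u := by simp only [hu]; fun_prop
  set v : ℝ → ℝ := fun s => ∫ x in t..s, H x with hv
  have hvac : AbsolutelyContinuousOnInterval v 0 t :=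
    hH.absolutelyContinuousOnInterval_intervalIntegral (by simp)
  have huac : AbsolutelyContinuousOnInterval u 0 t := by
    refine ContDiffOn.absolutelyContinuousOnInterval (ContDiff.contDiffOn ?_)
    simp only [hu]; fun_prop
  have hparts := huac.integral_deriv_mul_eq_sub hvac
  have hae : ∀ᵐ s, s ∈ uIcc 0 t → HasDerivAt v (H s) s := by
    filter_upwards [hH.ae_hasDerivAt_integral] with s hs hmem
    exact hs hmem t (by simp)
  have h1 : ∫ s in (0:ℝ)..t, (u s * H s - β * u s * v s) = -(u 0 * v 0) := by
    have : v t = 0 := by simp [hv]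
    rw [this, mul_zero, zero_sub] at hparts
    rw [← hparts]
    refine intervalIntegral.integral_congr_ae ?_
    filter_upwards [hae] with s hs hmem
    rw [(hs (uIoc_subset_uIcc hmem)).deriv, (hud s).deriv]
    ring
  have h2 : ∫ s in (0:ℝ)..t, β * u s = 1 - u t := by
    have := intervalIntegral.integral_eq_sub_of_hasDerivAt (fun x _ => hud x)
        ((huc.const_mul (-β)).intervalIntegrable 0 t)
    have h0 : u 0 = 1 := by simp [hu]
    rw [h0] at this
    have h3 : ∫ s in (0:ℝ)..t, β * u s = -∫ s in (0:ℝ)..t, -β * u s := by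
      rw [← intervalIntegral.integral_neg]; simp
    rw [h3, this]; ring
  have hvc : ContinuousOn v (uIcc 0 t) := hvac.continuousOn
  have i1 : IntervalIntegrable (fun s => u s * p s) volume 0 t := hp.continuousOn_mul huc.continuousOn
  have i2 : IntervalIntegrable (fun s => β * u s) volume 0 t :=
    (huc.const_mul β).intervalIntegrable 0 t
  have i3 : IntervalIntegrable (fun s => u s * H s - β * u s * v s) volume 0 t :=
    (hH.continuousOn_mul huc.continuousOn).sub
      (((huc.const_mul β).continuousOn.mul hvc).intervalIntegrable)
  have hmono : ∫ s in (0:ℝ)..t, (u s * p s - G * (β * u s)) ≤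
      ∫ s in (0:ℝ)..t, (u s * H s - β * u s * v s) := by
    refine intervalIntegral.integral_mono_on ht (i1.sub (i2.const_mul G)) i3 fun s hs => ?_
    have hvs : v s = G - z s := by
      rw [hz s hs, hv]; simp only
      rw [intervalIntegral.integral_symm]; ring
    have hup : 0 ≤ u s := (Real.exp_pos _).le
    have := mul_le_mul_of_nonneg_left (hle s hs) hup
    rw [hvs]; nlinarith
  rw [intervalIntegral.integral_sub i1 (i2.const_mul G), intervalIntegral.integral_const_mul, h2, h1]
    at hmono
  have hz0 : z 0 = G - v 0 := by
    rw [hz 0 ⟨le_rfl, ht⟩, hv]; simp only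
    rw [intervalIntegral.integral_symm]; ring
  have hu0 : u 0 = 1 := by simp [hu]
  rw [hz0]
  rw [hu0] at hmono
  have : Real.exp (-(β * t)) = u t := rfl
  rw [this]
  change u t * G + ∫ s in (0:ℝ)..t, u s * p s ≤ _
  nlinarith

/-- The angular average `∫_V p_t(r, υ) dυ`. -/
def flux (V : Set Pt) (p : ℝ → Pt → Pt → ℝ≥0∞) (t : ℝ) (r : Pt) : ℝ≥0∞ := ∫⁻ υ in V, p t r υ

/-- Two-sided bounds for a nonnegative solution of the transport equation, in which scattering
is compared with isotropic scattering. -/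
structure KinBounds (D V : Set Pt) (K c : ℝ≥0∞) (β : ℝ) (g : Pt → Pt → ℝ≥0∞)
    (p : ℝ → Pt → Pt → ℝ≥0∞) : Prop where
  meas_init : Measurable fun q : Pt × Pt => g q.1 q.2
  supp_init : ∀ r υ, (r, υ) ∉ D ×ˢ V → g r υ = 0
  meas : Measurable fun q : ℝ × Pt × Pt => p q.1 q.2.1 q.2.2
  bdd : ∀ T : ℝ, ∃ B : ℝ≥0∞, B ≠ ⊤ ∧ ∀ t ≤ T, ∀ r υ, p t r υ ≤ B
  supp : ∀ t r υ, (r, υ) ∉ D ×ˢ V → p t r υ = 0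
  neg : ∀ t < 0, ∀ r υ, p t r υ = 0
  upper : ∀ t : ℝ, 0 ≤ t → ∀ r υ, (r, υ) ∈ D ×ˢ V →
    p t r υ ≤ g (r + t • υ) υ + K * ∫⁻ s in Ioi (0 : ℝ), flux V p (t - s) (r + s • υ)
  lower : ∀ t : ℝ, 0 ≤ t → ∀ r υ, (r, υ) ∈ D ×ˢ V →
    ENNReal.ofReal (Real.exp (-(β * t))) *
      (g (r + t • υ) υ + c * ∫⁻ s in Ioi (0 : ℝ), flux V p (t - s) (r + s • υ)) ≤ p t r υ

section Context

variable {D : Set Pt} {vmin vmax : ℝ} {σs σf : Pt → Pt → ℝ} {πs πf : Pt → Pt → Pt → ℝ}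
  {g : Pt → Pt → ℝ} {ψ : ℝ → Pt → Pt → ℝ}

/-- The gain term of the collision operator along a characteristic. -/
def collGain (V : Set Pt) (σs σf : Pt → Pt → ℝ) (πs πf : Pt → Pt → Pt → ℝ)
    (ψ : ℝ → Pt → Pt → ℝ) (t : ℝ) (r υ : Pt) (s : ℝ) : ℝ :=
  ∫ υ' in V, ψ (t - s) (r + s • υ) υ' * collKernel σs σf πs πf (r + s • υ) υ υ'

lemma CharSol.measurable_gain (ctx : NTEContext D vmin vmax σs σf πs πf)
    (h : CharSol D (Vel vmin vmax) σs σf πs πf g ψ) (t : ℝ) (r υ : Pt) :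
    Measurable (collGain (Vel vmin vmax) σs σf πs πf ψ t r υ) := by
  have hm : Measurable fun z : ℝ × Pt => ψ (t - z.1) (r + z.1 • υ) z.2 *
      collKernel σs σf πs πf (r + z.1 • υ) υ z.2 :=
    (h.meas.comp (f := fun z : ℝ × Pt => (t - z.1, r + z.1 • υ, z.2)) (by fun_prop)).mul
      (ctx.measurable_collKernel.comp (f := fun z : ℝ × Pt => (r + z.1 • υ, υ, z.2)) (by fun_prop))
  exact (hm.stronglyMeasurable.integral_prod_right' (ν := volume.restrict (Vel vmin vmax))).measurable

lemma CharSol.gain_intervalIntegrable (ctx : NTEContext D vmin vmax σs σf πs πf)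
    (h : CharSol D (Vel vmin vmax) σs σf πs πf g ψ) (t : ℝ) (r υ : Pt) :
    IntervalIntegrable (collGain (Vel vmin vmax) σs σf πs πf ψ t r υ) volume 0 t := by
  obtain ⟨β, K, -, hK, -, hK0, hKb⟩ := ctx.exists_bounds
  obtain ⟨B, hB⟩ := h.bdd (t - min 0 t)
  rw [intervalIntegrable_iff]
  refine Measure.integrableOn_of_bounded
    (M := (B * K) * (volume.restrict (Vel vmin vmax)).real univ) (by simp)
    (h.measurable_gain ctx t r υ).aestronglyMeasurable ?_
  rw [ae_restrict_iff' measurableSet_uIoc]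
  refine ae_of_all _ fun s hs => ?_
  have hs' : t - s ≤ t - min 0 t := by
    have : min 0 t < s := hs.1
    linarith
  refine norm_integral_le_of_norm_le_const (μ := volume.restrict (Vel vmin vmax))
    (ae_of_all _ fun υ' => ?_)
  rw [norm_mul, Real.norm_eq_abs, Real.norm_eq_abs, abs_of_nonneg (hK0 _ _ _)]
  exact mul_le_mul (hB _ hs' _ _) (hKb _ _ _) (hK0 _ _ _)
    ((abs_nonneg _).trans (hB _ hs' (r + s • υ) υ'))

lemma CharSol.scatFis_eq_gain (ctx : NTEContext D vmin vmax σs σf πs πf)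
    (h : CharSol D (Vel vmin vmax) σs σf πs πf g ψ) (t : ℝ) (r : Pt) {υ : Pt}
    (hυ : υ ∈ Vel vmin vmax) (s : ℝ) :
    scatFis D (Vel vmin vmax) σs σf πs πf (ψ (t - s)) (r + s • υ) υ =
      collGain (Vel vmin vmax) σs σf πs πf ψ t r υ s -
        (σs (r + s • υ) υ + σf (r + s • υ) υ) * ψ (t - s) (r + s • υ) υ := by
  by_cases hm : r + s • υ ∈ D
  · exact ctx.scatFis_eq (h.bddMeas _) ⟨hm, hυ⟩
  · have hn : ∀ υ', (r + s • υ, υ') ∉ D ×ˢ Vel vmin vmax := fun υ' hcon => hm hcon.1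
    rw [scatFis_of_notMem (hn _), h.supp _ _ _ (hn υ), collGain]
    simp [h.supp _ _ _ (hn _)]

lemma CharSol.eq_along (ctx : NTEContext D vmin vmax σs σf πs πf)
    (h : CharSol D (Vel vmin vmax) σs σf πs πf g ψ) {t : ℝ} {r υ : Pt}
    (hE : (r, υ) ∈ D ×ˢ Vel vmin vmax) {s : ℝ} (hs : s ∈ Icc 0 t) :
    ψ (t - s) (r + s • υ) υ =
      (D ×ˢ Vel vmin vmax).indicator (Function.uncurry g) (r + t • υ, υ) +
        ∫ x in s..t, scatFis D (Vel vmin vmax) σs σf πs πf (ψ (t - x)) (r + x • υ) υ := by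
  by_cases hm : r + s • υ ∈ D
  · rw [h.eq (t - s) (by linarith [hs.2]) _ _ ⟨hm, hE.2⟩]
    congr 1
    · congr 2
      rw [add_assoc, ← add_smul]; simp
    · have := intervalIntegral.integral_comp_add_left (a := 0) (b := t - s)
        (fun x => scatFis D (Vel vmin vmax) σs σf πs πf (ψ (t - x)) (r + x • υ) υ) s
      rw [add_zero, add_sub_cancel] at this
      rw [← this]
      refine intervalIntegral.integral_congr fun x _ => ?_
      beta_reduce
      rw [add_assoc, ← add_smul, sub_sub]
  · have hout : ∀ x, s ≤ x → (r + x • υ, υ) ∉ D ×ˢ Vel vmin vmax := fun x hx hcon =>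
      hm (segment_mem ctx.D_convex hE.1 hcon.1 hs.1 hx)
    rw [h.supp _ _ _ (hout s le_rfl), indicator_of_notMem (hout t hs.2),
      intervalIntegral.integral_congr (g := fun _ => (0 : ℝ))]
    · simp
    · intro x hx
      rw [uIcc_of_le hs.2] at hx
      exact scatFis_of_notMem (hout x hx.1)

/-- The gain term, integrated over time, in terms of the flux. -/
lemma CharSol.gain_bounds (ctx : NTEContext D vmin vmax σs σf πs πf)
    (h : CharSol D (Vel vmin vmax) σs σf πs πf g ψ) (hψ : ∀ t r υ, 0 ≤ ψ t r υ)
    {t : ℝ} (ht : 0 ≤ t) {r υ : Pt} (hE : (r, υ) ∈ D ×ˢ Vel vmin vmax) {K c : ℝ}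
    (hK : ∀ r υ υ', collKernel σs σf πs πf r υ υ' ≤ K)
    (hc : ∀ r ∈ D, ∀ υ ∈ Vel vmin vmax, ∀ υ' ∈ Vel vmin vmax, c ≤ collKernel σs σf πs πf r υ υ') :
    ENNReal.ofReal (∫ s in (0:ℝ)..t, collGain (Vel vmin vmax) σs σf πs πf ψ t r υ s) ≤
      ENNReal.ofReal K * ∫⁻ s in Ioi (0 : ℝ),
        flux (Vel vmin vmax) (fun t r υ => ENNReal.ofReal (ψ t r υ)) (t - s) (r + s • υ) ∧
    ENNReal.ofReal c * ∫⁻ s in Ioi (0 : ℝ),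
        flux (Vel vmin vmax) (fun t r υ => ENNReal.ofReal (ψ t r υ)) (t - s) (r + s • υ) ≤
      ENNReal.ofReal (∫ s in (0:ℝ)..t, collGain (Vel vmin vmax) σs σf πs πf ψ t r υ s) := by
  obtain ⟨-, -, -, -, -, hk0, -⟩ := ctx.exists_bounds
  have hg0 : ∀ s, 0 ≤ collGain (Vel vmin vmax) σs σf πs πf ψ t r υ s := fun s =>
    integral_nonneg fun υ' => mul_nonneg (hψ _ _ _) (hk0 _ _ _)
  have h1 : ENNReal.ofReal (∫ s in (0:ℝ)..t, collGain (Vel vmin vmax) σs σf πs πf ψ t r υ s) =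
      ∫⁻ s in Ioc 0 t, ENNReal.ofReal (collGain (Vel vmin vmax) σs σf πs πf ψ t r υ s) := by
    have hi := h.gain_intervalIntegrable ctx t r υ
    rw [intervalIntegral.integral_of_le ht]
    rw [intervalIntegrable_iff_integrableOn_Ioc_of_le ht] at hi
    exact ofReal_integral_eq_lintegral_ofReal hi (ae_of_all _ hg0)
  have h2 : ∀ s, ENNReal.ofReal (collGain (Vel vmin vmax) σs σf πs πf ψ t r υ s) =
      ∫⁻ υ' in Vel vmin vmax, ENNReal.ofReal (ψ (t - s) (r + s • υ) υ') *
        ENNReal.ofReal (collKernel σs σf πs πf (r + s • υ) υ υ') := by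
    intro s
    rw [collGain, ofReal_integral_eq_lintegral_ofReal (ctx.integrable_mul_collKernel (h.bddMeas _) _ _)
      (ae_of_all _ fun υ' => mul_nonneg (hψ _ _ _) (hk0 _ _ _))]
    simp_rw [ENNReal.ofReal_mul (hψ _ _ _)]
  have h3 : ∫⁻ s in Ioi (0 : ℝ),
      flux (Vel vmin vmax) (fun t r υ => ENNReal.ofReal (ψ t r υ)) (t - s) (r + s • υ) =
      ∫⁻ s in Ioc 0 t,
      flux (Vel vmin vmax) (fun t r υ => ENNReal.ofReal (ψ t r υ)) (t - s) (r + s • υ) := by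
    have hsub : Ioc 0 t ⊆ Ioi 0 := fun s hs => hs.1
    rw [← lintegral_indicator measurableSet_Ioi, ← lintegral_indicator measurableSet_Ioc]
    congr 1 with s
    by_cases hs : s ∈ Ioc 0 t
    · rw [indicator_of_mem hs, indicator_of_mem (hsub hs)]
    · rw [indicator_of_notMem hs]
      refine indicator_apply_eq_zero.2 fun hs0 => ?_
      have hts : t - s < 0 := by
        have : t < s := lt_of_not_ge fun hcon => hs ⟨hs0, hcon⟩
        linarith
      simp [flux, h.neg _ hts]
  have hsec : ∀ s, Measurable fun υ' => ENNReal.ofReal (ψ (t - s) (r + s • υ) υ') := fun s =>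
    ENNReal.measurable_ofReal.comp (h.meas.comp
      (measurable_const.prodMk (measurable_const.prodMk measurable_id)))
  rw [h1, h3]
  simp_rw [h2]
  constructor
  · rw [← lintegral_const_mul' _ _ ENNReal.ofReal_ne_top]
    refine lintegral_mono fun s => ?_
    rw [flux, ← lintegral_const_mul' _ _ ENNReal.ofReal_ne_top]
    refine lintegral_mono fun υ' => ?_
    rw [mul_comm]
    exact mul_le_mul_left (ENNReal.ofReal_le_ofReal (hK _ _ _)) _
  · rw [← lintegral_const_mul' _ _ ENNReal.ofReal_ne_top]
    refine lintegral_mono fun s => ?_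
    rw [flux, ← lintegral_const_mul' _ _ ENNReal.ofReal_ne_top]
    refine setLIntegral_mono' (measurableSet_Vel _ _) fun υ' hυ' => ?_
    rw [mul_comm]
    by_cases hm : r + s • υ ∈ D
    · exact mul_le_mul_right (ENNReal.ofReal_le_ofReal (hc _ hm _ hE.2 _ hυ')) _
    · simp [h.supp _ _ _ (fun hcon : (r + s • υ, υ') ∈ _ => hm hcon.1)]

/-- Nonnegative solutions of the transport equation obey the kinetic bounds. -/
lemma CharSol.kinBounds (ctx : NTEContext D vmin vmax σs σf πs πf)
    (h : CharSol D (Vel vmin vmax) σs σf πs πf g ψ) (hψ : ∀ t r υ, 0 ≤ ψ t r υ)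
    (hg : BddMeasNN g) {K c β : ℝ}
    (hβ : ∀ r υ, σs r υ + σf r υ ≤ β) (hK : ∀ r υ υ', collKernel σs σf πs πf r υ υ' ≤ K)
    (hc : ∀ r ∈ D, ∀ υ ∈ Vel vmin vmax, ∀ υ' ∈ Vel vmin vmax, c ≤ collKernel σs σf πs πf r υ υ') :
    KinBounds D (Vel vmin vmax) (ENNReal.ofReal K) (ENNReal.ofReal c) β
      (fun r υ => (D ×ˢ Vel vmin vmax).indicator (fun q => ENNReal.ofReal (g q.1 q.2)) (r, υ))
      (fun t r υ => ENNReal.ofReal (ψ t r υ)) where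
  meas_init := (ENNReal.measurable_ofReal.comp hg.1).indicator ctx.measurableSet_phase
  supp_init r υ hn := indicator_of_notMem hn _
  meas := ENNReal.measurable_ofReal.comp h.meas
  bdd T := by
    obtain ⟨B, hB⟩ := h.bdd T
    exact ⟨ENNReal.ofReal B, ENNReal.ofReal_ne_top, fun t ht r υ =>
      ENNReal.ofReal_le_ofReal ((le_abs_self _).trans (hB t ht r υ))⟩
  supp t r υ hn := by simp [h.supp t r υ hn]
  neg t ht r υ := by simp [h.neg t ht r υ]
  upper t ht r υ hE := by
    have hind : ∀ x, (D ×ˢ Vel vmin vmax).indicator (fun q => ENNReal.ofReal (g q.1 q.2)) x =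
        ENNReal.ofReal ((D ×ˢ Vel vmin vmax).indicator (Function.uncurry g) x) := fun x => by
      by_cases hx : x ∈ D ×ˢ Vel vmin vmax
      · simp only [indicator_of_mem hx]; rfl
      · simp only [indicator_of_notMem hx, ENNReal.ofReal_zero]
    rw [hind]
    have hz := h.eq_along ctx hE (s := 0) ⟨le_rfl, ht⟩
    simp only [sub_zero, zero_smul, add_zero] at hz
    have hle : ψ t r υ ≤ (D ×ˢ Vel vmin vmax).indicator (Function.uncurry g) (r + t • υ, υ) +
        ∫ s in (0:ℝ)..t, collGain (Vel vmin vmax) σs σf πs πf ψ t r υ s := by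
      rw [hz]
      refine add_le_add le_rfl (intervalIntegral.integral_mono_on ht
        (h.intervalIntegrable ctx r υ t 0 t) (h.gain_intervalIntegrable ctx t r υ) fun s _ => ?_)
      rw [h.scatFis_eq_gain ctx t r hE.2 s]
      have := mul_nonneg (add_nonneg (ctx.σs_nonneg (r + s • υ) υ) (ctx.σf_nonneg (r + s • υ) υ))
        (hψ (t - s) (r + s • υ) υ)
      linarith
    refine (ENNReal.ofReal_le_ofReal hle).trans (ENNReal.ofReal_add_le.trans ?_)
    exact add_le_add le_rfl (h.gain_bounds ctx hψ ht hE hK hc).1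
  lower t ht r υ hE := by
    have hind : ∀ x, (D ×ˢ Vel vmin vmax).indicator (fun q => ENNReal.ofReal (g q.1 q.2)) x =
        ENNReal.ofReal ((D ×ˢ Vel vmin vmax).indicator (Function.uncurry g) x) := fun x => by
      by_cases hx : x ∈ D ×ˢ Vel vmin vmax
      · simp only [indicator_of_mem hx]; rfl
      · simp only [indicator_of_notMem hx, ENNReal.ofReal_zero]
    have hG : 0 ≤ (D ×ˢ Vel vmin vmax).indicator (Function.uncurry g) (r + t • υ, υ) :=
      indicator_nonneg (fun x _ => hg.2.1 x.1 x.2) _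
    obtain ⟨-, -, -, -, -, hk0, -⟩ := ctx.exists_bounds
    have hg0 : ∀ s, 0 ≤ collGain (Vel vmin vmax) σs σf πs πf ψ t r υ s := fun s =>
      integral_nonneg fun υ' => mul_nonneg (hψ _ _ _) (hk0 _ _ _)
    have hi := h.gain_intervalIntegrable ctx t r υ
    have hduh := duhamel_lower ht (h.intervalIntegrable ctx r υ t 0 t) hi
      (z := fun s => ψ (t - s) (r + s • υ) υ) (β := β)
      (fun s hs => h.eq_along ctx hE hs) (fun s _ => by
        rw [h.scatFis_eq_gain ctx t r hE.2 s]
        exact sub_le_sub_left (mul_le_mul_of_nonneg_right (hβ _ _) (hψ _ _ _)) _)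
    simp only [sub_zero, zero_smul, add_zero] at hduh
    have hβ0 : 0 ≤ β := (add_nonneg (ctx.σs_nonneg 0 0) (ctx.σf_nonneg 0 0)).trans (hβ 0 0)
    have hmono : Real.exp (-(β * t)) * ∫ s in (0:ℝ)..t, collGain (Vel vmin vmax) σs σf πs πf ψ t r υ s ≤
        ∫ s in (0:ℝ)..t, Real.exp (-(β * s)) * collGain (Vel vmin vmax) σs σf πs πf ψ t r υ s := by
      rw [← intervalIntegral.integral_const_mul]
      refine intervalIntegral.integral_mono_on ht (hi.const_mul _)
        (hi.continuousOn_mul (by fun_prop)) fun s hs => ?_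
      refine mul_le_mul_of_nonneg_right (Real.exp_le_exp.2 ?_) (hg0 s)
      exact neg_le_neg (mul_le_mul_of_nonneg_left hs.2 hβ0)
    rw [hind]
    have hint0 : 0 ≤ ∫ s in (0:ℝ)..t, collGain (Vel vmin vmax) σs σf πs πf ψ t r υ s :=
      intervalIntegral.integral_nonneg ht fun s _ => hg0 s
    calc _ ≤ ENNReal.ofReal (Real.exp (-(β * t))) *
        (ENNReal.ofReal ((D ×ˢ Vel vmin vmax).indicator (Function.uncurry g) (r + t • υ, υ)) +
        ENNReal.ofReal (∫ s in (0:ℝ)..t, collGain (Vel vmin vmax) σs σf πs πf ψ t r υ s)) := by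
          gcongr
          exact (h.gain_bounds ctx hψ ht hE hK hc).2
      _ = ENNReal.ofReal (Real.exp (-(β * t)) *
        ((D ×ˢ Vel vmin vmax).indicator (Function.uncurry g) (r + t • υ, υ) +
          ∫ s in (0:ℝ)..t, collGain (Vel vmin vmax) σs σf πs πf ψ t r υ s)) := by
          rw [← ENNReal.ofReal_add hG hint0, ENNReal.ofReal_mul (Real.exp_pos _).le]
      _ ≤ _ := ENNReal.ofReal_le_ofReal (by rw [mul_add]; linarith)

end Context

lemma ENNReal.le_two_mul_of_absorb {x A κ : ℝ≥0∞} (hx : x ≠ ⊤) (hκ : κ ≤ 1 / 2)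
    (h : x ≤ A + κ * x) : x ≤ 2 * A := by
  have h1 : x ≤ A + x / 2 := h.trans (by
    rw [div_eq_mul_inv, mul_comm x]
    gcongr
    simpa using hκ)
  have h2 : x / 2 + x / 2 ≤ A + x / 2 := by rwa [ENNReal.add_halves]
  have h3 : x / 2 ≤ A := (ENNReal.add_le_add_iff_right (ENNReal.div_ne_top hx (by simp))).1 h2
  calc x = 2 * (x / 2) := (ENNReal.mul_div_cancel (by simp) (by simp)).symm
    _ ≤ 2 * A := by gcongr

lemma lintegral_comp_smul_pt (w : Pt → ℝ≥0∞) {s : ℝ} (hs : 0 < s) (r : Pt) :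
    ∫⁻ υ, w (r + s • υ) = ENNReal.ofReal (s ^ 3)⁻¹ * ∫⁻ z, w z := by
  have h1 : ∫⁻ υ, w (r + s • υ) = ∫⁻ z, w (r + z) ∂(Measure.map (s • ·) (volume : Measure Pt)) :=
    ((Homeomorph.smulOfNeZero (α := Pt) s hs.ne').measurableEmbedding.lintegral_map
      (fun z => w (r + z))).symm
  have h3 : |(s ^ Module.finrank ℝ Pt)⁻¹| = (s ^ 3)⁻¹ := by
    rw [abs_of_pos (by positivity)]; simp
  rw [h1, Measure.map_addHaar_smul _ hs.ne', lintegral_smul_measure, h3, smul_eq_mul,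
    lintegral_add_left_eq_self]

lemma lintegral_exp_neg_mul_Ioi {α : ℝ} (hα : 0 < α) :
    ∫⁻ s in Ioi (0 : ℝ), ENNReal.ofReal (Real.exp (-(α * s))) = ENNReal.ofReal α⁻¹ := by
  have h := integral_exp_mul_Ioi (a := -α) (by linarith) 0
  have hi := integrableOn_exp_mul_Ioi (a := -α) (by linarith) 0
  simp only [neg_mul, mul_zero, Real.exp_zero] at h hi
  rw [← ofReal_integral_eq_lintegral_ofReal hi (ae_of_all _ fun s => (Real.exp_pos _).le), h]
  congr 1
  field_simp

/-- Length (in time) of the forward flight from `r` with velocity `υ` inside `D`. -/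
def fwdTime (D : Set Pt) (r υ : Pt) : ℝ≥0∞ := ∫⁻ s in Ioi (0 : ℝ), D.indicator 1 (r + s • υ)

/-- Length (in time) of the backward flight from `r` with velocity `υ` inside `D`. -/
def bwdTime (D : Set Pt) (r υ : Pt) : ℝ≥0∞ := ∫⁻ s in Ioi (0 : ℝ), D.indicator 1 (r - s • υ)

/-- The mass of an initial datum, weighted by the backward flight time. -/
def flightMass (D V : Set Pt) (g : Pt → Pt → ℝ≥0∞) : ℝ≥0∞ :=
  ∫⁻ r, ∫⁻ υ in V, g r υ * bwdTime D r υ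

/-- The flux of the freely transported initial datum. -/
def freeFlux (D V : Set Pt) (g : Pt → Pt → ℝ≥0∞) (t : ℝ) (r : Pt) : ℝ≥0∞ :=
  D.indicator 1 r * ∫⁻ υ in V, g (r + t • υ) υ

lemma measurable_fwdTime {D : Set Pt} (hD : MeasurableSet D) :
    Measurable fun q : Pt × Pt => fwdTime D q.1 q.2 := by
  refine Measurable.lintegral_prod_right'
    (f := fun z : (Pt × Pt) × ℝ => D.indicator (1 : Pt → ℝ≥0∞) (z.1.1 + z.2 • z.1.2)) ?_
  exact (measurable_one.indicator hD).comp (by fun_prop)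

lemma measurable_bwdTime {D : Set Pt} (hD : MeasurableSet D) :
    Measurable fun q : Pt × Pt => bwdTime D q.1 q.2 := by
  refine Measurable.lintegral_prod_right'
    (f := fun z : (Pt × Pt) × ℝ => D.indicator (1 : Pt → ℝ≥0∞) (z.1.1 - z.2 • z.1.2)) ?_
  exact (measurable_one.indicator hD).comp (by fun_prop)

lemma measurable_freeFlux {D V : Set Pt} (hD : MeasurableSet D) {g : Pt → Pt → ℝ≥0∞}
    (hg : Measurable fun q : Pt × Pt => g q.1 q.2) :
    Measurable fun q : ℝ × Pt => freeFlux D V g q.1 q.2 := by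
  refine Measurable.mul ((measurable_one.indicator hD).comp measurable_snd) ?_
  exact Measurable.lintegral_prod_right'
    (f := fun z : (ℝ × Pt) × Pt => g (z.1.2 + z.1.1 • z.2) z.2)
    (hg.comp (f := fun z : (ℝ × Pt) × Pt => (z.1.2 + z.1.1 • z.2, z.2)) (by fun_prop))

/-- The total free flux over all positive times is the flight mass. -/
lemma lintegral_freeFlux {D V : Set Pt} (hD : MeasurableSet D) {g : Pt → Pt → ℝ≥0∞}
    (hg : Measurable fun q : Pt × Pt => g q.1 q.2) :
    ∫⁻ t in Ioi (0 : ℝ), ∫⁻ r, freeFlux D V g t r = flightMass D V g := by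
  have h1D : Measurable (D.indicator (1 : Pt → ℝ≥0∞)) := measurable_one.indicator hD
  have h1 : ∀ t : ℝ, ∫⁻ r, freeFlux D V g t r =
      ∫⁻ υ in V, ∫⁻ r, g r υ * D.indicator 1 (r - t • υ) := by
    intro t
    have hm : Measurable fun z : Pt × Pt => D.indicator 1 z.1 * g (z.1 + t • z.2) z.2 :=
      (h1D.comp measurable_fst).mul
        (hg.comp (f := fun z : Pt × Pt => (z.1 + t • z.2, z.2)) (by fun_prop))
    have hsec : ∀ r, Measurable fun υ => g (r + t • υ) υ := fun r =>
      hg.comp (f := fun υ : Pt => (r + t • υ, υ)) (by fun_prop)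
    have : ∀ r, freeFlux D V g t r = ∫⁻ υ in V, D.indicator 1 r * g (r + t • υ) υ := fun r => by
      rw [freeFlux, lintegral_const_mul _ (hsec r)]
    simp_rw [this]
    rw [lintegral_lintegral_swap hm.aemeasurable]
    congr 1 with υ
    rw [← lintegral_add_right_eq_self (fun r => g r υ * D.indicator 1 (r - t • υ)) (t • υ)]
    congr 1 with r
    rw [add_sub_cancel_right, mul_comm]
  simp_rw [h1]
  have hm2 : Measurable fun z : (ℝ × Pt) × Pt => g z.2 z.1.2 * D.indicator 1 (z.2 - z.1.1 • z.1.2) :=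
    (hg.comp (f := fun z : (ℝ × Pt) × Pt => (z.2, z.1.2)) (by fun_prop)).mul
      (h1D.comp (f := fun z : (ℝ × Pt) × Pt => z.2 - z.1.1 • z.1.2) (by fun_prop))
  rw [lintegral_lintegral_swap (Measurable.aemeasurable (Measurable.lintegral_prod_right' hm2))]
  have h2 : ∀ υ, ∫⁻ t in Ioi (0 : ℝ), ∫⁻ r, g r υ * D.indicator 1 (r - t • υ) =
      ∫⁻ r, g r υ * bwdTime D r υ := by
    intro υ
    have hm : Measurable fun z : ℝ × Pt => g z.2 υ * D.indicator 1 (z.2 - z.1 • υ) :=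
      hm2.comp (f := fun z : ℝ × Pt => ((z.1, υ), z.2)) (by fun_prop)
    rw [lintegral_lintegral_swap hm.aemeasurable]
    congr 1 with r
    rw [bwdTime, lintegral_const_mul]
    exact h1D.comp (by fun_prop)
  simp_rw [h2]
  rw [flightMass, lintegral_lintegral_swap]
  refine Measurable.aemeasurable ?_
  exact (hg.comp measurable_swap).mul ((measurable_bwdTime hD).comp measurable_swap)

lemma bounded_flight {D : Set Pt} (hb : Bornology.IsBounded D) {vmin vmax : ℝ} (hv : 0 < vmin) :
    ∃ T : ℝ, 0 < T ∧ ∀ r ∈ D, ∀ υ ∈ Vel vmin vmax, ∀ s, T ≤ s → r + s • υ ∉ D := by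
  obtain ⟨R, hR0, hR⟩ := hb.exists_pos_norm_le
  refine ⟨(2 * R + 1) / vmin, by positivity, fun r hr υ hυ s hs hmem => ?_⟩
  have h1 := hR _ hr
  have h2 := hR _ hmem
  have h3 : ‖s • υ‖ ≤ ‖r + s • υ‖ + ‖r‖ := by simpa using norm_sub_le (r + s • υ) r
  have hs0 : 0 ≤ s := le_trans (by positivity) hs
  rw [norm_smul, Real.norm_eq_abs, abs_of_nonneg hs0] at h3
  rw [div_le_iff₀ hv] at hs
  have h4 : s * vmin ≤ s * ‖υ‖ := mul_le_mul_of_nonneg_left hυ.1 hs0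
  linarith

namespace KinBounds

variable {D : Set Pt} {vmin vmax : ℝ} {K c : ℝ≥0∞} {β : ℝ} {g : Pt → Pt → ℝ≥0∞}
  {p : ℝ → Pt → Pt → ℝ≥0∞}

lemma measurable_flux (h : KinBounds D (Vel vmin vmax) K c β g p) :
    Measurable fun q : ℝ × Pt => flux (Vel vmin vmax) p q.1 q.2 :=
  Measurable.lintegral_prod_right' (f := fun z : (ℝ × Pt) × Pt => p z.1.1 z.1.2 z.2)
    (h.meas.comp (f := fun z : (ℝ × Pt) × Pt => (z.1.1, z.1.2, z.2)) (by fun_prop))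

lemma flux_of_notMem (h : KinBounds D (Vel vmin vmax) K c β g p) (t : ℝ) {r : Pt} (hr : r ∉ D) :
    flux (Vel vmin vmax) p t r = 0 := by
  simp [flux, h.supp t r _ (fun hcon : (r, _) ∈ _ => hr hcon.1)]

lemma flux_of_neg (h : KinBounds D (Vel vmin vmax) K c β g p) {t : ℝ} (ht : t < 0) (r : Pt) :
    flux (Vel vmin vmax) p t r = 0 := by
  simp [flux, h.neg t ht]

lemma flux_bdd (h : KinBounds D (Vel vmin vmax) K c β g p) (T : ℝ) :
    ∃ B : ℝ≥0∞, B ≠ ⊤ ∧ ∀ t ≤ T, ∀ r, flux (Vel vmin vmax) p t r ≤ B := by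
  obtain ⟨B, hB, hle⟩ := h.bdd T
  refine ⟨B * volume (Vel vmin vmax), ENNReal.mul_ne_top hB (volume_Vel_lt_top _ _).ne,
    fun t ht r => ?_⟩
  calc flux (Vel vmin vmax) p t r ≤ ∫⁻ _ in Vel vmin vmax, B := lintegral_mono fun υ => hle t ht r υ
    _ = _ := by simp

/-- The flux is dominated by the free flux plus the scattered flux. -/
lemma flux_le (h : KinBounds D (Vel vmin vmax) K c β g p) (hK : K ≠ ⊤) (t : ℝ) (r : Pt) :
    flux (Vel vmin vmax) p t r ≤ freeFlux D (Vel vmin vmax) g t r +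
      K * ∫⁻ s in Ioi (0 : ℝ), ∫⁻ υ in Vel vmin vmax,
        flux (Vel vmin vmax) p (t - s) (r + s • υ) := by
  rcases lt_or_ge t 0 with ht | ht
  · rw [h.flux_of_neg ht]; exact zero_le
  by_cases hr : r ∈ D
  swap
  · rw [h.flux_of_notMem t hr]; exact zero_le
  have hm : Measurable fun z : Pt × ℝ => flux (Vel vmin vmax) p (t - z.2) (r + z.2 • z.1) :=
    h.measurable_flux.comp (f := fun z : Pt × ℝ => (t - z.2, r + z.2 • z.1)) (by fun_prop)
  have hgm : Measurable fun υ => g (r + t • υ) υ :=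
    h.meas_init.comp (f := fun υ : Pt => (r + t • υ, υ)) (by fun_prop)
  calc flux (Vel vmin vmax) p t r
      ≤ ∫⁻ υ in Vel vmin vmax, (g (r + t • υ) υ +
        K * ∫⁻ s in Ioi (0 : ℝ), flux (Vel vmin vmax) p (t - s) (r + s • υ)) :=
        setLIntegral_mono' (measurableSet_Vel _ _) fun υ hυ => h.upper t ht r υ ⟨hr, hυ⟩
    _ = _ := by
      rw [lintegral_add_left hgm, lintegral_const_mul' _ _ hK, freeFlux, indicator_of_mem hr,
        Pi.one_apply, one_mul, lintegral_lintegral_swap hm.aemeasurable]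

lemma freeFlux_eq_zero (h : KinBounds D (Vel vmin vmax) K c β g p) {T : ℝ}
    (hT : ∀ r ∈ D, ∀ υ ∈ Vel vmin vmax, ∀ s, T ≤ s → r + s • υ ∉ D) {t : ℝ} (ht : T ≤ t) (r : Pt) :
    freeFlux D (Vel vmin vmax) g t r = 0 := by
  rw [freeFlux]
  by_cases hr : r ∈ D
  · rw [setLIntegral_congr_fun (g := fun _ => 0) (measurableSet_Vel _ _)]
    · simp
    · intro υ hυ
      exact h.supp_init _ _ fun hcon => hT r hr υ hυ t ht hcon.1
  · simp [hr]

/-- `L¹` bound: the spatial integral of the flux is controlled by its history. -/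
lemma lintegral_flux_le (h : KinBounds D (Vel vmin vmax) K c β g p) (hK : K ≠ ⊤) (t : ℝ) :
    ∫⁻ r, flux (Vel vmin vmax) p t r ≤ (∫⁻ r, freeFlux D (Vel vmin vmax) g t r) +
      K * volume (Vel vmin vmax) * ∫⁻ s in Ioi (0 : ℝ), ∫⁻ r, flux (Vel vmin vmax) p (t - s) r := by
  have hm : Measurable fun z : (Pt × ℝ) × Pt =>
      flux (Vel vmin vmax) p (t - z.1.2) (z.1.1 + z.1.2 • z.2) :=
    h.measurable_flux.comp (f := fun z : (Pt × ℝ) × Pt => (t - z.1.2, z.1.1 + z.1.2 • z.2))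
      (by fun_prop)
  have hshift : ∀ s : ℝ, ∫⁻ r, ∫⁻ υ in Vel vmin vmax, flux (Vel vmin vmax) p (t - s) (r + s • υ) =
      volume (Vel vmin vmax) * ∫⁻ r, flux (Vel vmin vmax) p (t - s) r := by
    intro s
    have hm' : Measurable fun z : Pt × Pt => flux (Vel vmin vmax) p (t - s) (z.1 + s • z.2) :=
      hm.comp (f := fun z : Pt × Pt => ((z.1, s), z.2)) (by fun_prop)
    rw [lintegral_lintegral_swap hm'.aemeasurable]
    simp_rw [lintegral_add_right_eq_self (fun r => flux (Vel vmin vmax) p (t - s) r)]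
    simp [mul_comm]
  have hm2 : Measurable fun z : Pt × ℝ => ∫⁻ υ in Vel vmin vmax,
      flux (Vel vmin vmax) p (t - z.2) (z.1 + z.2 • υ) := Measurable.lintegral_prod_right' hm
  have hm3 : Measurable fun s : ℝ => ∫⁻ r, flux (Vel vmin vmax) p (t - s) r :=
    Measurable.lintegral_prod_right' (f := fun z : ℝ × Pt => flux (Vel vmin vmax) p (t - z.1) z.2)
      (h.measurable_flux.comp (f := fun z : ℝ × Pt => (t - z.1, z.2)) (by fun_prop))
  refine (lintegral_mono fun r => h.flux_le hK t r).trans ?_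
  rw [lintegral_add_right _ ((Measurable.lintegral_prod_right' hm2).const_mul K),
    lintegral_const_mul' _ _ hK, lintegral_lintegral_swap hm2.aemeasurable]
  simp_rw [hshift]
  rw [lintegral_const_mul _ hm3, mul_assoc]

/-- Time-integrated `L¹` bound by the flight mass. -/
lemma lintegral_lintegral_flux_le (h : KinBounds D (Vel vmin vmax) K c β g p) (hK : K ≠ ⊤)
    (hD : MeasurableSet D) (hDv : volume D ≠ ⊤) {α : ℝ} (hα : 0 < α)
    (hαK : K * volume (Vel vmin vmax) * ENNReal.ofReal α⁻¹ ≤ 1 / 2) (T : ℝ) :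
    ∫⁻ t in Ioc 0 T, ∫⁻ r, flux (Vel vmin vmax) p t r ≤
      ENNReal.ofReal (Real.exp (α * T)) * (2 * flightMass D (Vel vmin vmax) g) := by
  set I : ℝ → ℝ≥0∞ := fun t => ∫⁻ r, flux (Vel vmin vmax) p t r with hI
  set e : ℝ → ℝ≥0∞ := fun t => ENNReal.ofReal (Real.exp (-(α * t))) with he
  have hem : Measurable e := by fun_prop
  have hIm : Measurable I := Measurable.lintegral_prod_right' h.measurable_flux
  have hIneg : ∀ t < 0, I t = 0 := fun t ht => by simp [hI, h.flux_of_neg ht]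
  set A := ∫⁻ t in Ioc 0 T, e t * I t with hA
  have hAtop : A ≠ ⊤ := by
    obtain ⟨B, hB, hle⟩ := h.flux_bdd T
    have hIB : ∀ t ≤ T, I t ≤ B * volume D := by
      intro t ht
      calc I t ≤ ∫⁻ r, D.indicator (fun _ => B) r := by
            refine lintegral_mono fun r => ?_
            by_cases hr : r ∈ D
            · rw [indicator_of_mem hr]; exact hle t ht r
            · rw [h.flux_of_notMem t hr]; exact zero_le
        _ = B * volume D := by rw [lintegral_indicator hD]; simp
    have : A ≤ ∫⁻ t in Ioc 0 T, B * volume D := by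
      refine setLIntegral_mono' measurableSet_Ioc fun t ht => ?_
      have he1 : e t ≤ 1 := by
        simp only [he, ENNReal.ofReal_le_one, Real.exp_le_one_iff]
        have := mul_nonneg hα.le ht.1.le
        linarith
      calc e t * I t ≤ 1 * (B * volume D) := mul_le_mul' he1 (hIB t ht.2)
        _ = _ := one_mul _
    refine ne_top_of_le_ne_top ?_ this
    rw [lintegral_const]
    exact ENNReal.mul_ne_top (ENNReal.mul_ne_top hB hDv) (by simp)
  have hconv : ∫⁻ t in Ioc 0 T, e t * ∫⁻ s in Ioi (0 : ℝ), I (t - s) ≤ ENNReal.ofReal α⁻¹ * A := by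
    have hIs : ∀ t, Measurable fun s => I (t - s) := fun t => hIm.comp (by fun_prop)
    have heI : ∀ s, Measurable fun t => e (t - s) * I (t - s) := fun s =>
      (hem.mul hIm).comp (measurable_id.sub_const s)
    have hm : Measurable fun z : ℝ × ℝ => e z.1 * I (z.1 - z.2) :=
      (hem.comp measurable_fst).mul (hIm.comp (by fun_prop))
    calc ∫⁻ t in Ioc 0 T, e t * ∫⁻ s in Ioi (0 : ℝ), I (t - s)
        = ∫⁻ t in Ioc 0 T, ∫⁻ s in Ioi (0 : ℝ), e t * I (t - s) := by
          congr 1 with t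
          exact (lintegral_const_mul _ (hIs t)).symm
      _ = ∫⁻ s in Ioi (0 : ℝ), ∫⁻ t in Ioc 0 T, e t * I (t - s) :=
          lintegral_lintegral_swap hm.aemeasurable
      _ ≤ ∫⁻ s in Ioi (0 : ℝ), e s * A := by
          refine setLIntegral_mono' measurableSet_Ioi fun s hs => ?_
          have hes : ∀ t, e t = e s * e (t - s) := fun t => by
            simp only [he]
            rw [← ENNReal.ofReal_mul (Real.exp_pos _).le, ← Real.exp_add]
            congr 2; ring
          have h1 : ∫⁻ t in Ioc 0 T, e t * I (t - s) =
              e s * ∫⁻ t in Ioc 0 T, e (t - s) * I (t - s) := by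
            rw [← lintegral_const_mul _ (heI s)]
            congr 1 with t
            rw [hes t, mul_assoc]
          rw [h1]
          gcongr
          have h2 : ∫⁻ t in Ioc 0 T, e (t - s) * I (t - s) =
              ∫⁻ t, (Ioc 0 T).indicator (fun _ => (1 : ℝ≥0∞)) (t + s) * (e t * I t) := by
            rw [← lintegral_sub_right_eq_self (fun t =>
              (Ioc 0 T).indicator (fun _ => (1 : ℝ≥0∞)) (t + s) * (e t * I t)) s,
              ← lintegral_indicator measurableSet_Ioc]
            congr 1 with t
            by_cases ht : t ∈ Ioc 0 T <;> simp [ht]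
          rw [h2, hA, Measure.restrict_congr_set Ioc_ae_eq_Icc, ← lintegral_indicator measurableSet_Icc]
          refine lintegral_mono fun t => ?_
          rcases lt_or_ge t 0 with ht | ht
          · simp [hIneg t ht]
          by_cases hts : t + s ∈ Ioc 0 T
          · have ht' : t ∈ Icc 0 T := ⟨ht, by linarith [hts.2, mem_Ioi.1 hs]⟩
            rw [indicator_of_mem hts, indicator_of_mem ht', one_mul]
          · rw [indicator_of_notMem hts, zero_mul]; exact zero_le
      _ = ENNReal.ofReal α⁻¹ * A := by
          rw [lintegral_mul_const _ hem, lintegral_exp_neg_mul_Ioi hα]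
  have hmain : A ≤ flightMass D (Vel vmin vmax) g + (1 / 2) * A := by
    calc A ≤ ∫⁻ t in Ioc 0 T, ((∫⁻ r, freeFlux D (Vel vmin vmax) g t r) +
          K * volume (Vel vmin vmax) * (e t * ∫⁻ s in Ioi (0 : ℝ), I (t - s))) := by
          refine setLIntegral_mono' measurableSet_Ioc fun t ht => ?_
          have he1 : e t ≤ 1 := by
            simp only [he, ENNReal.ofReal_le_one, Real.exp_le_one_iff]
            have := mul_nonneg hα.le ht.1.le
            linarith
          calc e t * I t ≤ e t * _ := mul_le_mul_right (h.lintegral_flux_le hK t) _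
            _ = e t * (∫⁻ r, freeFlux D (Vel vmin vmax) g t r) +
                K * volume (Vel vmin vmax) * (e t * ∫⁻ s in Ioi (0 : ℝ), I (t - s)) := by
                rw [mul_add, mul_left_comm]
            _ ≤ _ := by
                gcongr
                exact (mul_le_mul_left he1 _).trans (one_mul _).le
      _ = (∫⁻ t in Ioc 0 T, ∫⁻ r, freeFlux D (Vel vmin vmax) g t r) + K * volume (Vel vmin vmax) *
          ∫⁻ t in Ioc 0 T, e t * ∫⁻ s in Ioi (0 : ℝ), I (t - s) := by
          have hFm : Measurable fun t => ∫⁻ r, freeFlux D (Vel vmin vmax) g t r :=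
            Measurable.lintegral_prod_right' (measurable_freeFlux hD h.meas_init)
          rw [lintegral_add_left hFm,
            lintegral_const_mul' _ _ (ENNReal.mul_ne_top hK (volume_Vel_lt_top _ _).ne)]
      _ ≤ flightMass D (Vel vmin vmax) g + K * volume (Vel vmin vmax) * (ENNReal.ofReal α⁻¹ * A) := by
          gcongr
          rw [← lintegral_freeFlux hD h.meas_init]
          exact lintegral_mono_set fun t ht => ht.1
      _ ≤ _ := by
          rw [← mul_assoc]; gcongr
  have hA2 := ENNReal.le_two_mul_of_absorb hAtop le_rfl hmain
  calc ∫⁻ t in Ioc 0 T, I t ≤ ∫⁻ t in Ioc 0 T, ENNReal.ofReal (Real.exp (α * T)) * (e t * I t) := by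
        refine setLIntegral_mono' measurableSet_Ioc fun t ht => ?_
        rw [← mul_assoc]
        simp only [he]
        rw [← ENNReal.ofReal_mul (Real.exp_pos _).le, ← Real.exp_add]
        refine le_mul_of_one_le_left zero_le ?_
        rw [ENNReal.one_le_ofReal, Real.one_le_exp_iff]
        nlinarith [ht.2]
    _ = ENNReal.ofReal (Real.exp (α * T)) * A := lintegral_const_mul _ (hem.mul hIm)
    _ ≤ _ := by gcongr

end KinBounds

lemma ENNReal.exists_pos_mul_ofReal_le_half {x : ℝ≥0∞} (hx : x ≠ ⊤) :
    ∃ η : ℝ, 0 < η ∧ η ≤ 1 / 2 ∧ x * ENNReal.ofReal η ≤ 1 / 2 := by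
  have hx0 : 0 ≤ x.toReal := ENNReal.toReal_nonneg
  refine ⟨1 / (2 * (x.toReal + 1)), by positivity, ?_, ?_⟩
  · rw [div_le_div_iff₀ (by positivity) (by norm_num)]
    linarith
  · calc x * ENNReal.ofReal (1 / (2 * (x.toReal + 1)))
        = ENNReal.ofReal (x.toReal * (1 / (2 * (x.toReal + 1)))) := by
          rw [ENNReal.ofReal_mul hx0, ENNReal.ofReal_toReal hx]
      _ ≤ ENNReal.ofReal (1 / 2) := by
          refine ENNReal.ofReal_le_ofReal ?_
          rw [mul_one_div, div_le_div_iff₀ (by positivity) (by norm_num)]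
          linarith
      _ = 1 / 2 := by
          rw [ENNReal.ofReal_div_of_pos (by norm_num)]; simp

/-- Integrating the past of a function supported on nonnegative times. -/
lemma lintegral_past_le {I : ℝ → ℝ≥0∞} (hI : ∀ t < 0, I t = 0) {t T : ℝ} (ht : t ≤ T) :
    ∫⁻ s in Ioi (0 : ℝ), I (t - s) ≤ ∫⁻ s in Ioc 0 T, I s := by
  have h1 : ∫⁻ s in Ioi (0 : ℝ), I (t - s) = ∫⁻ s, (Iio t).indicator I s := by
    rw [← lintegral_sub_left_eq_self ((Iio t).indicator I) t,
      ← lintegral_indicator measurableSet_Ioi]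
    congr 1 with s
    by_cases hs : 0 < s
    · rw [indicator_of_mem (mem_Ioi.2 hs), indicator_of_mem (mem_Iio.2 (sub_lt_self t hs))]
    · rw [indicator_of_notMem (by simpa using hs), indicator_of_notMem (by simpa using hs)]
  rw [h1, Measure.restrict_congr_set Ioc_ae_eq_Icc, ← lintegral_indicator measurableSet_Icc]
  refine lintegral_mono fun s => ?_
  rcases lt_or_ge s 0 with hs | hs
  · rw [indicator_apply_eq_zero.2 fun _ => hI s hs]; exact zero_le
  by_cases hst : s < t
  · rw [indicator_of_mem (mem_Iio.2 hst), indicator_of_mem (show s ∈ Icc 0 T from ⟨hs, hst.le.trans ht⟩)]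
  · rw [indicator_of_notMem (by simpa using hst)]; exact zero_le

namespace KinBounds

variable {D : Set Pt} {vmin vmax : ℝ} {K c : ℝ≥0∞} {β : ℝ}

/-- `L¹` bound on the flux, uniform for times in `[T₀, τ]`. -/
lemma exists_lintegral_flux_bound (hK : K ≠ ⊤) (hD : MeasurableSet D) (hDv : volume D ≠ ⊤)
    {T₀ : ℝ} (hT₀ : ∀ r ∈ D, ∀ υ ∈ Vel vmin vmax, ∀ s, T₀ ≤ s → r + s • υ ∉ D) (τ : ℝ) :
    ∃ L : ℝ≥0∞, L ≠ ⊤ ∧ ∀ g p, KinBounds D (Vel vmin vmax) K c β g p → ∀ t, T₀ ≤ t → t ≤ τ →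
      ∫⁻ r, flux (Vel vmin vmax) p t r ≤ L * flightMass D (Vel vmin vmax) g := by
  have hKV : K * volume (Vel vmin vmax) ≠ ⊤ := ENNReal.mul_ne_top hK (volume_Vel_lt_top _ _).ne
  obtain ⟨η, hη, -, hηK⟩ := ENNReal.exists_pos_mul_ofReal_le_half hKV
  refine ⟨K * volume (Vel vmin vmax) * (ENNReal.ofReal (Real.exp (η⁻¹ * τ)) * 2),
    ENNReal.mul_ne_top hKV (ENNReal.mul_ne_top ENNReal.ofReal_ne_top (by simp)), ?_⟩
  intro g p h t ht htτ
  have h1 := h.lintegral_lintegral_flux_le hK hD hDv (inv_pos.2 hη) (by simpa using hηK) τ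
  calc ∫⁻ r, flux (Vel vmin vmax) p t r
      ≤ (∫⁻ r, freeFlux D (Vel vmin vmax) g t r) + K * volume (Vel vmin vmax) *
        ∫⁻ s in Ioi (0 : ℝ), ∫⁻ r, flux (Vel vmin vmax) p (t - s) r := h.lintegral_flux_le hK t
    _ = K * volume (Vel vmin vmax) *
        ∫⁻ s in Ioi (0 : ℝ), ∫⁻ r, flux (Vel vmin vmax) p (t - s) r := by
        simp [h.freeFlux_eq_zero hT₀ ht]
    _ ≤ K * volume (Vel vmin vmax) * ∫⁻ s in Ioc 0 τ, ∫⁻ r, flux (Vel vmin vmax) p s r := by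
        gcongr K * volume (Vel vmin vmax) * ?_
        exact lintegral_past_le (I := fun t => ∫⁻ r, flux (Vel vmin vmax) p t r)
          (fun t ht => by simp [h.flux_of_neg ht]) htτ
    _ ≤ K * volume (Vel vmin vmax) * (ENNReal.ofReal (Real.exp (η⁻¹ * τ)) *
        (2 * flightMass D (Vel vmin vmax) g)) := by gcongr
    _ = _ := by ring

/-- Splitting of the scattered flux into short and long flights. -/
lemma ofReal_mul_scattered_le {p : ℝ → Pt → Pt → ℝ≥0∞} {T₀ τ : ℝ} {M Θ : ℝ≥0∞}
    (hM : ∀ t, T₀ ≤ t → t ≤ τ → ∫⁻ r, flux (Vel vmin vmax) p t r ≤ M)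
    (hΘ : ∀ t, 2 * T₀ < t → t ≤ τ → ∀ r,
      ENNReal.ofReal ((t - 2 * T₀) ^ 3) * flux (Vel vmin vmax) p t r ≤ Θ)
    {η : ℝ} (hη : 0 < η) (hη2 : η ≤ 1 / 2) {t : ℝ} (ht : 2 * T₀ < t) (htτ : t ≤ τ) (r : Pt)
    {s : ℝ} (hs : 0 < s) (hsT : s < T₀) :
    ENNReal.ofReal ((t - 2 * T₀) ^ 3) *
        ∫⁻ υ in Vel vmin vmax, flux (Vel vmin vmax) p (t - s) (r + s • υ) ≤
      (Iio (η * τ)).indicator (fun _ => 8 * volume (Vel vmin vmax) * Θ) s +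
        ENNReal.ofReal ((η⁻¹) ^ 3) * M := by
  set x := t - 2 * T₀ with hx
  have hx0 : 0 < x := by linarith
  by_cases hsx : s < η * x
  · have hsτ : s < η * τ := hsx.trans_le (mul_le_mul_of_nonneg_left (by linarith) hη.le)
    rw [indicator_of_mem (mem_Iio.2 hsτ)]
    refine le_add_right ?_
    have hsx2 : s ≤ x / 2 := by nlinarith
    have hpt : ∀ z, flux (Vel vmin vmax) p (t - s) z * ENNReal.ofReal (x ^ 3) ≤ 8 * Θ := by
      intro z
      have h8 : ENNReal.ofReal (x ^ 3) ≤ 8 * ENNReal.ofReal ((t - s - 2 * T₀) ^ 3) := by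
        rw [show (8 : ℝ≥0∞) = ENNReal.ofReal 8 by simp, ← ENNReal.ofReal_mul (by norm_num)]
        refine ENNReal.ofReal_le_ofReal ?_
        have h1 : x ≤ 2 * (t - s - 2 * T₀) := by linarith
        calc x ^ 3 ≤ (2 * (t - s - 2 * T₀)) ^ 3 := by gcongr
          _ = _ := by ring
      calc flux (Vel vmin vmax) p (t - s) z * ENNReal.ofReal (x ^ 3)
          ≤ flux (Vel vmin vmax) p (t - s) z * (8 * ENNReal.ofReal ((t - s - 2 * T₀) ^ 3)) := by
            gcongr
        _ = 8 * (ENNReal.ofReal ((t - s - 2 * T₀) ^ 3) * flux (Vel vmin vmax) p (t - s) z) := by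
            ring
        _ ≤ 8 * Θ := by
            gcongr
            exact hΘ (t - s) (by linarith) (by linarith) z
    calc ENNReal.ofReal (x ^ 3) *
          ∫⁻ υ in Vel vmin vmax, flux (Vel vmin vmax) p (t - s) (r + s • υ)
        = ∫⁻ υ in Vel vmin vmax,
            flux (Vel vmin vmax) p (t - s) (r + s • υ) * ENNReal.ofReal (x ^ 3) := by
          rw [mul_comm, lintegral_mul_const' _ _ ENNReal.ofReal_ne_top]
      _ ≤ ∫⁻ _ in Vel vmin vmax, 8 * Θ := lintegral_mono fun υ => hpt _
      _ = _ := by rw [lintegral_const, Measure.restrict_apply_univ]; ring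
  · refine le_add_left ?_
    push Not at hsx
    calc ENNReal.ofReal (x ^ 3) *
          ∫⁻ υ in Vel vmin vmax, flux (Vel vmin vmax) p (t - s) (r + s • υ)
        ≤ ENNReal.ofReal (x ^ 3) * ∫⁻ υ, flux (Vel vmin vmax) p (t - s) (r + s • υ) := by
          gcongr
          exact Measure.restrict_le_self
      _ = ENNReal.ofReal (x ^ 3) * (ENNReal.ofReal (s ^ 3)⁻¹ *
          ∫⁻ z, flux (Vel vmin vmax) p (t - s) z) := by rw [lintegral_comp_smul_pt _ hs]
      _ ≤ ENNReal.ofReal (x ^ 3) * (ENNReal.ofReal (s ^ 3)⁻¹ * M) := by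
          gcongr
          exact hM _ (by linarith) (by linarith)
      _ ≤ _ := by
          rw [← mul_assoc, ← ENNReal.ofReal_mul (by positivity)]
          gcongr
          rw [← div_eq_mul_inv, ← div_pow]
          gcongr
          rw [div_le_iff₀ hs, inv_mul_eq_div, le_div_iff₀ hη]
          linarith

/-- Pointwise bound on the flux by the flight mass, after several flight times. -/
lemma exists_flux_bound (hK : K ≠ ⊤) (hD : MeasurableSet D) (hDv : volume D ≠ ⊤)
    {T₀ : ℝ} (hT₀0 : 0 < T₀)
    (hT₀ : ∀ r ∈ D, ∀ υ ∈ Vel vmin vmax, ∀ s, T₀ ≤ s → r + s • υ ∉ D) (τ : ℝ) :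
    ∃ L : ℝ≥0∞, L ≠ ⊤ ∧ ∀ g p, KinBounds D (Vel vmin vmax) K c β g p →
      ∀ t, 3 * T₀ ≤ t → t ≤ τ → ∀ r,
        flux (Vel vmin vmax) p t r ≤ L * flightMass D (Vel vmin vmax) g := by
  obtain ⟨L, hL, hLb⟩ := exists_lintegral_flux_bound (c := c) (β := β) hK hD hDv hT₀ τ
  have hV := (volume_Vel_lt_top vmin vmax).ne
  have hKV : K * (8 * volume (Vel vmin vmax)) * ENNReal.ofReal τ ≠ ⊤ :=
    ENNReal.mul_ne_top (ENNReal.mul_ne_top hK (ENNReal.mul_ne_top (by simp) hV))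
      ENNReal.ofReal_ne_top
  obtain ⟨η, hη, hη2, hηK⟩ := ENNReal.exists_pos_mul_ofReal_le_half hKV
  set A : ℝ≥0∞ := K * (ENNReal.ofReal T₀ * (ENNReal.ofReal ((η⁻¹) ^ 3) * L)) with hA
  have hAtop : A ≠ ⊤ := ENNReal.mul_ne_top hK (ENNReal.mul_ne_top ENNReal.ofReal_ne_top
    (ENNReal.mul_ne_top ENNReal.ofReal_ne_top hL))
  have hT3 : ENNReal.ofReal (T₀ ^ 3) ≠ 0 := by
    rw [Ne, ENNReal.ofReal_eq_zero]; push Not; positivity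
  refine ⟨(ENNReal.ofReal (T₀ ^ 3))⁻¹ * (2 * A), ENNReal.mul_ne_top (ENNReal.inv_ne_top.2 hT3)
    (ENNReal.mul_ne_top (by simp) hAtop), ?_⟩
  intro g p h
  set m := flightMass D (Vel vmin vmax) g
  set Θ : ℝ≥0∞ := ⨆ t ∈ Ioc (2 * T₀) τ, ⨆ r,
    ENNReal.ofReal ((t - 2 * T₀) ^ 3) * flux (Vel vmin vmax) p t r with hΘ
  have hΘle : ∀ t, 2 * T₀ < t → t ≤ τ → ∀ r,
      ENNReal.ofReal ((t - 2 * T₀) ^ 3) * flux (Vel vmin vmax) p t r ≤ Θ := by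
    intro t ht htτ r
    refine le_trans ?_ (le_iSup₂ (f := fun (t : ℝ) (_ : t ∈ Ioc (2 * T₀) τ) => ⨆ r,
      ENNReal.ofReal ((t - 2 * T₀) ^ 3) * flux (Vel vmin vmax) p t r) t ⟨ht, htτ⟩)
    exact le_iSup (fun r => ENNReal.ofReal ((t - 2 * T₀) ^ 3) * flux (Vel vmin vmax) p t r) r
  have hΘtop : Θ ≠ ⊤ := by
    obtain ⟨B, hB, hBle⟩ := h.flux_bdd τ
    refine ne_top_of_le_ne_top (b := ENNReal.ofReal ((τ - 2 * T₀) ^ 3) * B)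
      (ENNReal.mul_ne_top ENNReal.ofReal_ne_top hB) (iSup₂_le fun t ht => iSup_le fun r => ?_)
    gcongr
    · linarith [ht.1]
    · exact ht.2
    · exact hBle t ht.2 r
  have habs : Θ ≤ A * m + (1 / 2) * Θ := by
    refine iSup₂_le fun t ht => iSup_le fun r => ?_
    by_cases hr : r ∈ D
    swap
    · rw [h.flux_of_notMem t hr, mul_zero]; exact zero_le
    have hvan : ∀ s, T₀ ≤ s →
        ∫⁻ υ in Vel vmin vmax, flux (Vel vmin vmax) p (t - s) (r + s • υ) = 0 := by
      intro s hs
      rw [setLIntegral_congr_fun (g := fun _ => 0) (measurableSet_Vel _ _)]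
      · simp
      · exact fun υ hυ => h.flux_of_notMem _ (hT₀ r hr υ hυ s hs)
    have hx := h.flux_le hK t r
    rw [h.freeFlux_eq_zero hT₀ (by linarith [ht.1]), zero_add] at hx
    calc ENNReal.ofReal ((t - 2 * T₀) ^ 3) * flux (Vel vmin vmax) p t r
        ≤ ENNReal.ofReal ((t - 2 * T₀) ^ 3) * (K * ∫⁻ s in Ioi (0 : ℝ),
          ∫⁻ υ in Vel vmin vmax, flux (Vel vmin vmax) p (t - s) (r + s • υ)) := by gcongr
      _ = K * ∫⁻ s in Ioi (0 : ℝ), ENNReal.ofReal ((t - 2 * T₀) ^ 3) *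
          ∫⁻ υ in Vel vmin vmax, flux (Vel vmin vmax) p (t - s) (r + s • υ) := by
          rw [lintegral_const_mul' _ _ ENNReal.ofReal_ne_top]; ring
      _ ≤ K * ∫⁻ s in Ioi (0 : ℝ),
          ((Iio (η * τ)).indicator (fun _ => 8 * volume (Vel vmin vmax) * Θ) s +
            (Iio T₀).indicator (fun _ => ENNReal.ofReal ((η⁻¹) ^ 3) * (L * m)) s) := by
          gcongr K * ?_
          refine setLIntegral_mono' measurableSet_Ioi fun s hs => ?_
          rcases lt_or_ge s T₀ with hsT | hsT
          · rw [indicator_of_mem (mem_Iio.2 hsT)]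
            exact ofReal_mul_scattered_le (hLb g p h) hΘle hη hη2 ht.1 ht.2 r hs hsT
          · rw [hvan s hsT, mul_zero]; exact zero_le
      _ = K * (8 * volume (Vel vmin vmax) * Θ * ENNReal.ofReal (η * τ) +
          ENNReal.ofReal ((η⁻¹) ^ 3) * (L * m) * ENNReal.ofReal T₀) := by
          rw [lintegral_add_left (measurable_const.indicator measurableSet_Iio),
            setLIntegral_indicator measurableSet_Iio, setLIntegral_indicator measurableSet_Iio,
            lintegral_const, lintegral_const, Measure.restrict_apply_univ,
            Measure.restrict_apply_univ, inter_comm, Ioi_inter_Iio, inter_comm, Ioi_inter_Iio,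
            Real.volume_Ioo, Real.volume_Ioo, sub_zero, sub_zero]
      _ = A * m + K * (8 * volume (Vel vmin vmax)) * ENNReal.ofReal τ * ENNReal.ofReal η * Θ := by
          rw [ENNReal.ofReal_mul hη.le, hA]; ring
      _ ≤ A * m + (1 / 2) * Θ := by gcongr
  have hΘ2 := ENNReal.le_two_mul_of_absorb hΘtop le_rfl habs
  intro t ht htτ r
  have h1 := hΘle t (by linarith) htτ r
  have h2 : ENNReal.ofReal (T₀ ^ 3) ≤ ENNReal.ofReal ((t - 2 * T₀) ^ 3) := by
    gcongr; linarith
  calc flux (Vel vmin vmax) p t r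
      = (ENNReal.ofReal (T₀ ^ 3))⁻¹ * (ENNReal.ofReal (T₀ ^ 3) * flux (Vel vmin vmax) p t r) := by
        rw [← mul_assoc, ENNReal.inv_mul_cancel hT3 ENNReal.ofReal_ne_top, one_mul]
    _ ≤ (ENNReal.ofReal (T₀ ^ 3))⁻¹ * (2 * (A * m)) := by
        gcongr (ENNReal.ofReal (T₀ ^ 3))⁻¹ * ?_
        exact (mul_le_mul_left h2 _).trans (h1.trans hΘ2)
    _ = _ := by ring

/-- Upper bound of the semigroup by the product of the flight times. -/
theorem exists_upper_bound (hK : K ≠ ⊤) (hD : MeasurableSet D) (hDv : volume D ≠ ⊤)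
    {T₀ : ℝ} (hT₀0 : 0 < T₀)
    (hT₀ : ∀ r ∈ D, ∀ υ ∈ Vel vmin vmax, ∀ s, T₀ ≤ s → r + s • υ ∉ D) {τ : ℝ}
    (hτ : 4 * T₀ ≤ τ) :
    ∃ L : ℝ≥0∞, L ≠ ⊤ ∧ ∀ g p, KinBounds D (Vel vmin vmax) K c β g p →
      ∀ r υ, (r, υ) ∈ D ×ˢ Vel vmin vmax →
        p τ r υ ≤ L * flightMass D (Vel vmin vmax) g * fwdTime D r υ := by
  obtain ⟨L, hL, hLb⟩ := exists_flux_bound (c := c) (β := β) hK hD hDv hT₀0 hT₀ τ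
  refine ⟨K * L, ENNReal.mul_ne_top hK hL, fun g p h r υ hq => ?_⟩
  have h0 : g (r + τ • υ) υ = 0 :=
    h.supp_init _ _ fun hcon => hT₀ r hq.1 υ hq.2 τ (by linarith) hcon.1
  set m := flightMass D (Vel vmin vmax) g
  have hind : Measurable fun s : ℝ => D.indicator (1 : Pt → ℝ≥0∞) (r + s • υ) :=
    (measurable_one.indicator hD).comp (by fun_prop)
  calc p τ r υ ≤ g (r + τ • υ) υ +
        K * ∫⁻ s in Ioi (0 : ℝ), flux (Vel vmin vmax) p (τ - s) (r + s • υ) :=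
        h.upper τ (by linarith) r υ hq
    _ = K * ∫⁻ s in Ioi (0 : ℝ), flux (Vel vmin vmax) p (τ - s) (r + s • υ) := by
        rw [h0, zero_add]
    _ ≤ K * ∫⁻ s in Ioi (0 : ℝ), L * m * D.indicator 1 (r + s • υ) := by
        gcongr K * ?_
        refine setLIntegral_mono' measurableSet_Ioi fun s hs => ?_
        by_cases hsD : r + s • υ ∈ D
        · have hsT : s < T₀ := by
            by_contra! hcon
            exact hT₀ r hq.1 υ hq.2 s hcon hsD
          rw [indicator_of_mem hsD, Pi.one_apply, mul_one]
          exact hLb g p h _ (by linarith) (by linarith [mem_Ioi.1 hs]) _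
        · rw [h.flux_of_notMem _ hsD]; exact zero_le
    _ = _ := by
        rw [lintegral_const_mul _ hind, fwdTime]; ring

end KinBounds

/-- Double time integrals over two windows dominate a single integral over the sum window. -/
lemma lintegral_window_add {f : ℝ → ℝ≥0∞} (hf : Measurable f) {a b a' b' A B δ : ℝ}
    (h1 : δ ≤ b - a) (h2 : δ ≤ b' - a') (hA : a + a' + δ ≤ A) (hB : B ≤ b + b' - δ) :
    ENNReal.ofReal δ * ∫⁻ h in Icc A B, f h ≤
      ∫⁻ s in Icc a b, ∫⁻ s' in Icc a' b', f (s + s') := by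
  have hin : ∀ s, ∫⁻ s' in Icc a' b', f (s + s') =
      ∫⁻ h, (Icc a' b').indicator 1 (h - s) * f h := by
    intro s
    rw [← lintegral_indicator measurableSet_Icc,
      ← lintegral_sub_right_eq_self _ s]
    congr 1 with h
    by_cases hh : h - s ∈ Icc a' b'
    · rw [indicator_of_mem hh, indicator_of_mem hh]; simp
    · rw [indicator_of_notMem hh, indicator_of_notMem hh]; simp
  simp_rw [hin]
  have hm : Measurable fun z : ℝ × ℝ => (Icc a' b').indicator (1 : ℝ → ℝ≥0∞) (z.2 - z.1) * f z.2 :=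
    ((measurable_one.indicator measurableSet_Icc).comp (by fun_prop)).mul (hf.comp measurable_snd)
  rw [lintegral_lintegral_swap hm.aemeasurable, ← lintegral_const_mul _ hf,
    ← lintegral_indicator measurableSet_Icc]
  refine lintegral_mono fun h => ?_
  by_cases hh : h ∈ Icc A B
  swap
  · rw [indicator_of_notMem hh]; exact zero_le
  have hms : Measurable fun s : ℝ => (Icc a' b').indicator (1 : ℝ → ℝ≥0∞) (h - s) :=
    (measurable_one.indicator measurableSet_Icc).comp (by fun_prop)
  rw [indicator_of_mem hh, lintegral_mul_const _ hms]
  gcongr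
  have hset : ∫⁻ s in Icc a b, (Icc a' b').indicator (1 : ℝ → ℝ≥0∞) (h - s) ≥
      ∫⁻ s in Icc (max a (h - b')) (min b (h - a')), 1 := by
    rw [← lintegral_indicator measurableSet_Icc, ← lintegral_indicator measurableSet_Icc]
    refine lintegral_mono fun s => ?_
    by_cases hs : s ∈ Icc (max a (h - b')) (min b (h - a'))
    · have hs1 := (max_le_iff.1 hs.1)
      have hs2 := (le_min_iff.1 hs.2)
      rw [indicator_of_mem hs, indicator_of_mem (show s ∈ Icc a b from ⟨hs1.1, hs2.1⟩),
        indicator_of_mem (show h - s ∈ Icc a' b' from ⟨by linarith, by linarith⟩), Pi.one_apply]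
    · rw [indicator_of_notMem hs]; exact zero_le
  refine le_trans ?_ hset
  rw [lintegral_const, one_mul, Measure.restrict_apply_univ, Real.volume_Icc]
  refine ENNReal.ofReal_le_ofReal ?_
  have : max a (h - b') + δ ≤ min b (h - a') := by
    rw [← max_add_add_right]
    refine max_le (le_min ?_ ?_) (le_min ?_ ?_) <;> linarith [hh.1, hh.2]
  linarith

/-- `X t` dominates a multiple of the integral of the past of `Y` over the delays `[a, b]`,
uniformly in the index. -/
def DelayDom {ι : Type*} (τ : ℝ) (X Y : ι → ℝ → ℝ≥0∞) (a b : ℝ) : Prop :=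
  ∃ κ : ℝ≥0∞, κ ≠ 0 ∧ ∀ i, ∀ t ≤ τ, κ * ∫⁻ s in Icc a b, Y i (t - s) ≤ X i t

namespace DelayDom

variable {ι : Type*} {τ : ℝ} {X Y Z : ι → ℝ → ℝ≥0∞} {a b a' b' : ℝ}

lemma mono (h : DelayDom τ X Y a b) (ha : a ≤ a') (hb : b' ≤ b) : DelayDom τ X Y a' b' := by
  obtain ⟨κ, hκ, hle⟩ := h
  refine ⟨κ, hκ, fun i t ht => le_trans ?_ (hle i t ht)⟩
  gcongr

lemma trans (h₁ : DelayDom τ X Y a b) (h₂ : DelayDom τ Y Z a' b') (hZ : ∀ i, Measurable (Z i))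
    (ha : 0 ≤ a) {A B δ : ℝ} (hδ : 0 < δ) (hab : δ ≤ b - a) (hab' : δ ≤ b' - a')
    (hA : a + a' + δ ≤ A) (hB : B ≤ b + b' - δ) : DelayDom τ X Z A B := by
  obtain ⟨κ, hκ, hle⟩ := h₁
  obtain ⟨κ', hκ', hle'⟩ := h₂
  refine ⟨κ * κ' * ENNReal.ofReal δ, ?_, fun i t ht => ?_⟩
  · simp [hκ, hκ', hδ]
  have hm : Measurable fun z : ℝ × ℝ => Z i (t - z.1 - z.2) := (hZ i).comp (by fun_prop)
  calc κ * κ' * ENNReal.ofReal δ * ∫⁻ h in Icc A B, Z i (t - h)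
      = κ * (κ' * (ENNReal.ofReal δ * ∫⁻ h in Icc A B, Z i (t - h))) := by ring
    _ ≤ κ * (κ' * ∫⁻ s in Icc a b, ∫⁻ s' in Icc a' b', Z i (t - (s + s'))) := by
        gcongr κ * (κ' * ?_)
        exact lintegral_window_add (f := fun h => Z i (t - h)) ((hZ i).comp (by fun_prop))
          hab hab' hA hB
    _ = κ * ∫⁻ s in Icc a b, κ' * ∫⁻ s' in Icc a' b', Z i (t - s - s') := by
        rw [lintegral_const_mul _ (Measurable.lintegral_prod_right' hm)]
        simp_rw [sub_sub]
    _ ≤ κ * ∫⁻ s in Icc a b, Y i (t - s) := by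
        gcongr κ * ?_
        exact setLIntegral_mono' measurableSet_Icc fun s hs => hle' i _ (by linarith [hs.1])
    _ ≤ X i t := hle i t ht

lemma add_right (h₁ : DelayDom τ X Y a b) (h₂ : DelayDom τ X Z a b)
    (hY : ∀ i, Measurable (Y i)) : DelayDom τ X (fun i t => Y i t + Z i t) a b := by
  obtain ⟨κ, hκ, hle⟩ := h₁
  obtain ⟨κ', hκ', hle'⟩ := h₂
  refine ⟨min κ κ' / 2, ?_, fun i t ht => ?_⟩
  · simp [hκ, hκ']
  have hm : Measurable fun s => Y i (t - s) := (hY i).comp (by fun_prop)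
  rw [lintegral_add_left hm, div_eq_mul_inv, mul_add]
  calc _ ≤ 2⁻¹ * (κ * ∫⁻ s in Icc a b, Y i (t - s)) + 2⁻¹ * (κ' * ∫⁻ s in Icc a b, Z i (t - s)) := by
        rw [mul_comm (min κ κ'), mul_assoc, mul_assoc]
        gcongr
        · exact min_le_left _ _
        · exact min_le_right _ _
    _ ≤ 2⁻¹ * X i t + 2⁻¹ * X i t := by
        gcongr
        · exact hle i t ht
        · exact hle' i t ht
    _ = X i t := by rw [← add_mul, ENNReal.inv_two_add_inv_two, one_mul]

lemma mono_right (h : DelayDom τ X Y a b) (hZY : ∀ i t, Z i t ≤ Y i t) : DelayDom τ X Z a b := by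
  obtain ⟨κ, hκ, hle⟩ := h
  refine ⟨κ, hκ, fun i t ht => le_trans ?_ (hle i t ht)⟩
  gcongr
  exact hZY _ _

end DelayDom

lemma le_and_le_of_window {vmin vmax θ δ ε d s : ℝ} (hv : 0 < vmin) (hvv : vmin < vmax)
    (hδ : 0 ≤ δ) (hd : |d - (vmin + vmax) / 2 * θ| ≤ 2 * ε)
    (hθ : 2 * ε + δ * vmax ≤ θ * ((vmax - vmin) / 2)) (hs : s ∈ Icc (θ - δ) (θ + δ)) :
    s * vmin ≤ d ∧ d ≤ s * vmax := by
  have h := abs_le.1 hd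
  constructor
  · nlinarith [mul_le_mul_of_nonneg_right hs.2 hv.le, mul_le_mul_of_nonneg_left hvv.le hδ]
  · nlinarith [mul_le_mul_of_nonneg_right hs.1 (hv.trans hvv).le]

/-- A family of fluxes on `D`, regenerated by scattering at least at a fixed positive rate
up to time `τ`. -/
structure ScatteringFluxes {ι : Type*} (D : Set Pt) (vmin vmax τ : ℝ)
    (w : ι → ℝ → Pt → ℝ≥0∞) : Prop where
  meas : ∀ i, Measurable fun q : ℝ × Pt => w i q.1 q.2
  neg : ∀ i, ∀ t < 0, ∀ r, w i t r = 0
  lower : ∃ κ : ℝ≥0∞, κ ≠ 0 ∧ ∀ i, ∀ t ≤ τ, ∀ r ∈ D,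
    κ * ∫⁻ s in Ioi (0 : ℝ), ∫⁻ υ in Vel vmin vmax, w i (t - s) (r + s • υ) ≤ w i t r

namespace ScatteringFluxes

variable {ι : Type*} {D : Set Pt} {vmin vmax τ : ℝ} {w : ι → ℝ → Pt → ℝ≥0∞}

lemma measurable_section (h : ScatteringFluxes D vmin vmax τ w) (i : ι) (Y : Set Pt) :
    Measurable fun t => ∫⁻ z in Y, w i t z :=
  Measurable.lintegral_prod_right' (f := fun q : ℝ × Pt => w i q.1 q.2) (h.meas i)

/-- One flight: the flux at `r` dominates the flux on `Y` over the windows of delays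
`[θ z - δ, θ z + δ]`, where `θ z` is the flight time from `r` to `z` at average speed. -/
lemma flight (h : ScatteringFluxes D vmin vmax τ w) (hv : 0 < vmin) (hvv : vmin < vmax)
    (hτ : 0 < τ) {δ ε θ₀ : ℝ} (hδ : 0 < δ) (hε : 0 ≤ ε)
    (hθ₀ : 2 * ε + δ * vmax ≤ θ₀ * ((vmax - vmin) / 2)) :
    ∃ κ : ℝ≥0∞, κ ≠ 0 ∧ ∀ i, ∀ t ≤ τ, ∀ r ∈ D, ∀ Y : Set Pt, MeasurableSet Y → ∀ θ : Pt → ℝ,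
      Measurable θ → (∀ z ∈ Y, θ₀ ≤ θ z) →
      (∀ z ∈ Y, |‖z - r‖ - (vmin + vmax) / 2 * θ z| ≤ 2 * ε) →
      κ * ∫⁻ z in Y, ∫⁻ s in Icc (θ z - δ) (θ z + δ), w i (t - s) z ≤ w i t r := by
  obtain ⟨κ, hκ, hle⟩ := h.lower
  refine ⟨κ * ENNReal.ofReal (τ ^ 3)⁻¹, by simp [hκ, hτ], ?_⟩
  intro i t ht r hr Y hY θ hθm hθ hdist
  refine le_trans ?_ (hle i t ht r hr)
  rw [mul_assoc]
  gcongr κ * ?_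
  set S : Set (ℝ × Pt) := {q | q.2 ∈ Y ∧ q.1 ∈ Icc (θ q.2 - δ) (θ q.2 + δ)} with hS
  have hSm : MeasurableSet S :=
    (measurable_snd hY).inter ((measurableSet_le (by fun_prop) measurable_fst).inter
      (measurableSet_le measurable_fst (by fun_prop)))
  have hwm : Measurable fun q : ℝ × Pt => w i (t - q.1) q.2 :=
    (h.meas i).comp (f := fun q : ℝ × Pt => (t - q.1, q.2)) (by fun_prop)
  have hFm : Measurable (S.indicator fun q : ℝ × Pt => w i (t - q.1) q.2) := hwm.indicator hSm
  have hlate : ∀ z ∈ Y, 0 < θ z - δ := by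
    intro z hz
    have hvx : 0 < vmax := hv.trans hvv
    have h1 : θ₀ * ((vmax - vmin) / 2) ≤ θ z * ((vmax - vmin) / 2) :=
      mul_le_mul_of_nonneg_right (hθ z hz) (by linarith)
    have h2 : 0 < θ z := by
      by_contra! hcon
      have h3 : 0 < δ * vmax := mul_pos hδ hvx
      nlinarith
    have h3 : θ z * ((vmax - vmin) / 2) < θ z * vmax := mul_lt_mul_of_pos_left (by linarith) h2
    have h4 : δ * vmax < θ z * vmax := by linarith
    linarith [lt_of_mul_lt_mul_right h4 hvx.le]
  calc ENNReal.ofReal (τ ^ 3)⁻¹ * ∫⁻ z in Y, ∫⁻ s in Icc (θ z - δ) (θ z + δ), w i (t - s) z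
      = ENNReal.ofReal (τ ^ 3)⁻¹ * ∫⁻ z, ∫⁻ s in Ioi (0 : ℝ),
          S.indicator (fun q : ℝ × Pt => w i (t - q.1) q.2) (s, z) := by
        rw [← lintegral_indicator hY]
        congr 2 with z
        by_cases hz : z ∈ Y
        · rw [indicator_of_mem hz, ← lintegral_indicator measurableSet_Icc,
            ← lintegral_indicator measurableSet_Ioi]
          congr 1 with s
          by_cases hs : s ∈ Icc (θ z - δ) (θ z + δ)
          · rw [indicator_of_mem hs, indicator_of_mem (mem_Ioi.2 ((hlate z hz).trans_le hs.1)),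
              indicator_of_mem (show (s, z) ∈ S from ⟨hz, hs⟩)]
          · have : (s, z) ∉ S := fun hc => hs hc.2
            rw [indicator_of_notMem hs]
            by_cases h0 : s ∈ Ioi (0 : ℝ)
            · rw [indicator_of_mem h0, indicator_of_notMem this]
            · rw [indicator_of_notMem h0]
        · rw [indicator_of_notMem hz]
          have : ∀ s, (s, z) ∉ S := fun s hc => hz hc.1
          simp [this]
    _ = ∫⁻ s in Ioi (0 : ℝ), ENNReal.ofReal (τ ^ 3)⁻¹ * ∫⁻ z,
          S.indicator (fun q : ℝ × Pt => w i (t - q.1) q.2) (s, z) := by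
        rw [lintegral_lintegral_swap (f := fun z s =>
          S.indicator (fun q : ℝ × Pt => w i (t - q.1) q.2) (s, z))
          (hFm.comp measurable_swap).aemeasurable,
          lintegral_const_mul _ (Measurable.lintegral_prod_right' (ν := volume) hFm)]
    _ ≤ ∫⁻ s in Ioi (0 : ℝ), ∫⁻ υ in Vel vmin vmax, w i (t - s) (r + s • υ) := by
        refine setLIntegral_mono' measurableSet_Ioi fun s hs => ?_
        rw [mem_Ioi] at hs
        rcases le_or_gt s τ with hsτ | hsτ
        swap
        · have h0 : ∀ z, S.indicator (fun q : ℝ × Pt => w i (t - q.1) q.2) (s, z) = 0 := fun z =>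
            indicator_apply_eq_zero.2 fun _ => h.neg i _ (by simpa using by linarith) z
          simp [h0]
        calc ENNReal.ofReal (τ ^ 3)⁻¹ *
              ∫⁻ z, S.indicator (fun q : ℝ × Pt => w i (t - q.1) q.2) (s, z)
            ≤ ENNReal.ofReal (s ^ 3)⁻¹ *
              ∫⁻ z, S.indicator (fun q : ℝ × Pt => w i (t - q.1) q.2) (s, z) := by gcongr
          _ = ∫⁻ υ, S.indicator (fun q : ℝ × Pt => w i (t - q.1) q.2) (s, r + s • υ) :=
              (lintegral_comp_smul_pt
                (fun z => S.indicator (fun q : ℝ × Pt => w i (t - q.1) q.2) (s, z)) hs r).symm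
          _ ≤ _ := by
              rw [← lintegral_indicator (measurableSet_Vel _ _)]
              refine lintegral_mono fun υ => ?_
              by_cases hm : (s, r + s • υ) ∈ S
              · rw [indicator_of_mem hm, indicator_of_mem]
                have h5 := le_and_le_of_window hv hvv hδ.le (hdist _ hm.1)
                  (hθ₀.trans (mul_le_mul_of_nonneg_right (hθ _ hm.1) (by linarith))) hm.2
                rw [add_sub_cancel_left, norm_smul, Real.norm_eq_abs, abs_of_pos hs] at h5
                exact ⟨le_of_mul_le_mul_left h5.1 hs, le_of_mul_le_mul_left h5.2 hs⟩
              · rw [indicator_of_notMem hm]; exact zero_le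

end ScatteringFluxes

lemma setLIntegral_Icc_center (f : ℝ → ℝ≥0∞) (θ δ : ℝ) :
    ∫⁻ s in Icc (θ - δ) (θ + δ), f s = ∫⁻ s in Icc (-δ) δ, f (θ + s) := by
  rw [← lintegral_indicator measurableSet_Icc, ← lintegral_indicator measurableSet_Icc,
    ← lintegral_add_left_eq_self _ θ]
  congr 1 with s
  by_cases hs : s ∈ Icc (-δ) δ
  · rw [indicator_of_mem hs, indicator_of_mem]
    exact ⟨by linarith [hs.1], by linarith [hs.2]⟩
  · rw [indicator_of_notMem hs, indicator_of_notMem]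
    exact fun hc => hs ⟨by linarith [hc.1], by linarith [hc.2]⟩

lemma abs_norm_sub_sub_le {x z p q : Pt} {ε d : ℝ} (hx : x ∈ Metric.ball p ε)
    (hz : dist z q < ε) (hd : d = dist q p) : |‖z - x‖ - d| ≤ 2 * ε := by
  rw [← dist_eq_norm, hd]
  have h1 := dist_dist_dist_le z x q p
  rw [Real.dist_eq] at h1
  linarith [Metric.mem_ball.1 hx]

namespace ScatteringFluxes

variable {ι : Type*} {D : Set Pt} {vmin vmax τ : ℝ} {w : ι → ℝ → Pt → ℝ≥0∞} {δ ε ℓ Θ : ℝ}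
  {p q : Pt}

lemma flight_ball (h : ScatteringFluxes D vmin vmax τ w) (hv : 0 < vmin) (hvv : vmin < vmax)
    (hτ : 0 < τ) (hδ : 0 < δ) (hε : 0 < ε)
    (hθ₀ : 2 * ε + δ * vmax ≤ ℓ / (vmin + vmax) * ((vmax - vmin) / 2))
    (hp : Metric.ball p ε ⊆ D) :
    ∃ κ : ℝ≥0∞, κ ≠ 0 ∧ ∀ i, ∀ t ≤ τ, ∀ Y : Set Pt, MeasurableSet Y → ∀ θ : Pt → ℝ,
      Measurable θ → (∀ z ∈ Y, ℓ / (vmin + vmax) ≤ θ z) →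
      (∀ x ∈ Metric.ball p ε, ∀ z ∈ Y, |‖z - x‖ - (vmin + vmax) / 2 * θ z| ≤ 2 * ε) →
      κ * ∫⁻ z in Y, ∫⁻ s in Icc (θ z - δ) (θ z + δ), w i (t - s) z ≤
        ∫⁻ x in Metric.ball p ε, w i t x := by
  obtain ⟨κ, hκ, hle⟩ := h.flight hv hvv hτ hδ hε.le hθ₀
  refine ⟨κ * volume (Metric.ball p ε),
    mul_ne_zero hκ (Metric.measure_ball_pos volume p hε).ne', ?_⟩
  intro i t ht Y hY θ hθm hθ hdist
  calc κ * volume (Metric.ball p ε) *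
        ∫⁻ z in Y, ∫⁻ s in Icc (θ z - δ) (θ z + δ), w i (t - s) z
      = ∫⁻ _ in Metric.ball p ε,
        κ * ∫⁻ z in Y, ∫⁻ s in Icc (θ z - δ) (θ z + δ), w i (t - s) z := by
        rw [lintegral_const, Measure.restrict_apply_univ]; ring
    _ ≤ _ := setLIntegral_mono' measurableSet_ball fun x hx =>
        hle i t ht x (hp hx) Y hY θ hθm hθ (hdist x hx)

lemma delayDom_bounce (h : ScatteringFluxes D vmin vmax τ w) (hv : 0 < vmin) (hvv : vmin < vmax)
    (hτ : 0 < τ) (hδ : 0 < δ) (hε : 0 < ε)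
    (hθ₀ : 2 * ε + δ * vmax ≤ ℓ / (vmin + vmax) * ((vmax - vmin) / 2))
    (hp : Metric.ball p ε ⊆ D) (hℓ : ℓ = dist q p) :
    DelayDom τ (fun i t => ∫⁻ x in Metric.ball p ε, w i t x)
      (fun i t => ∫⁻ x in Metric.ball q ε, w i t x)
      (2 * ℓ / (vmin + vmax) - δ) (2 * ℓ / (vmin + vmax) + δ) := by
  obtain ⟨κ, hκ, hle⟩ := h.flight_ball hv hvv hτ hδ hε hθ₀ hp
  refine ⟨κ, hκ, fun i t ht => ?_⟩
  have hS : 0 < vmin + vmax := by linarith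
  have hℓ0 : 0 ≤ ℓ := hℓ ▸ dist_nonneg
  have hm : Measurable fun z : ℝ × Pt => w i (t - z.1) z.2 :=
    (h.meas i).comp (f := fun z : ℝ × Pt => (t - z.1, z.2)) (by fun_prop)
  rw [lintegral_lintegral_swap hm.aemeasurable]
  refine hle i t ht _ measurableSet_ball (fun _ => 2 * ℓ / (vmin + vmax)) measurable_const ?_ ?_
  · intro z _
    gcongr
    linarith
  · intro x hx z hz
    exact abs_norm_sub_sub_le hx hz (by rw [← hℓ]; field_simp)

lemma delayDom_iterate (h : ScatteringFluxes D vmin vmax τ w) (hv : 0 < vmin) (hvv : vmin < vmax)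
    (hτ : 0 < τ) (hδ : 0 < δ) (hε : 0 < ε)
    (hθ₀ : 2 * ε + δ * vmax ≤ ℓ / (vmin + vmax) * ((vmax - vmin) / 2))
    (hδℓ : δ ≤ 2 * ℓ / (vmin + vmax))
    (hp : Metric.ball p ε ⊆ D) (hq : Metric.ball q ε ⊆ D) (hℓ : ℓ = dist q p) {n : ℕ}
    (hn : 1 ≤ n) :
    DelayDom τ (fun i t => ∫⁻ x in Metric.ball p ε, w i t x)
      (fun i t => ∫⁻ x in Metric.ball p ε, w i t x)
      (n * (2 * (2 * ℓ / (vmin + vmax)) - δ / 2)) (n * (2 * (2 * ℓ / (vmin + vmax)) + δ / 2)) := by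
  have h1 := h.delayDom_bounce hv hvv hτ hδ hε hθ₀ hp hℓ
  have h2 := h.delayDom_bounce hv hvv hτ hδ hε hθ₀ hq (hℓ.trans (dist_comm _ _))
  set T := 2 * ℓ / (vmin + vmax)
  have hmeas : ∀ i, Measurable fun t => ∫⁻ x in Metric.ball p ε, w i t x := fun i =>
    h.measurable_section i _
  have h12 := h1.trans (A := 2 * T - δ) (B := 2 * T + δ) h2 hmeas (by linarith) hδ
    (by linarith) (by linarith) (by linarith) (by linarith)
  induction n, hn using Nat.le_induction with
  | base => exact h12.mono (by push_cast; linarith) (by push_cast; linarith)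
  | succ n hn ih =>
    have hn' : (1 : ℝ) ≤ n := by exact_mod_cast hn
    refine ih.trans h12 hmeas ?_ (half_pos hδ) ?_ ?_ ?_ ?_
    · exact mul_nonneg (by linarith) (by linarith)
    · nlinarith
    · linarith
    · push_cast; linarith
    · push_cast; linarith

/-- Appending a flight from anywhere far from `p` to a window of delays. -/
lemma delayDom_far (h : ScatteringFluxes D vmin vmax τ w) (hv : 0 < vmin) (hvv : vmin < vmax)
    (hτ : 0 < τ) (hD : MeasurableSet D) (hδ : 0 < δ) (hε : 0 < ε)
    (hθ₀ : 2 * ε + δ * vmax ≤ ℓ / (vmin + vmax) * ((vmax - vmin) / 2))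
    (hp : Metric.ball p ε ⊆ D) (hΘ : ∀ z ∈ D, 2 * dist z p / (vmin + vmax) ≤ Θ)
    {X : ι → ℝ → ℝ≥0∞} {a b : ℝ}
    (hX : DelayDom τ X (fun i t => ∫⁻ x in Metric.ball p ε, w i t x) a b) (ha : 0 ≤ a)
    (hab : δ ≤ b - a) :
    DelayDom τ X (fun i t => ∫⁻ x in D ∩ {z | ℓ / 2 ≤ dist z p}, w i t x) (a + Θ) b := by
  obtain ⟨κ, hκ, hle⟩ := hX
  obtain ⟨κ', hκ', hle'⟩ := h.flight_ball hv hvv hτ hδ hε hθ₀ hp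
  refine ⟨κ * κ' * ENNReal.ofReal δ, by simp [hκ, hκ', hδ], fun i t ht => ?_⟩
  have hS : 0 < vmin + vmax := by linarith
  set Y := D ∩ {z | ℓ / 2 ≤ dist z p} with hYdef
  have hY : MeasurableSet Y := hD.inter (measurableSet_le measurable_const (by fun_prop))
  set θ : Pt → ℝ := fun z => 2 * dist z p / (vmin + vmax) with hθdef
  have hθm : Measurable θ := by fun_prop
  have hm : Measurable fun z : ℝ × Pt => w i (t - z.1) z.2 :=
    (h.meas i).comp (f := fun z : ℝ × Pt => (t - z.1, z.2)) (by fun_prop)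
  have hm3 : Measurable fun z : (ℝ × Pt) × ℝ => w i (t - z.1.1 - (θ z.1.2 + z.2)) z.1.2 :=
    (h.meas i).comp (f := fun z : (ℝ × Pt) × ℝ => (t - z.1.1 - (θ z.1.2 + z.2), z.1.2))
      (by fun_prop)
  have hm2 : Measurable fun z : ℝ × Pt =>
      ∫⁻ s' in Icc (θ z.2 - δ) (θ z.2 + δ), w i (t - z.1 - s') z.2 := by
    have : ∀ z : ℝ × Pt, ∫⁻ s' in Icc (θ z.2 - δ) (θ z.2 + δ), w i (t - z.1 - s') z.2 =
        ∫⁻ s' in Icc (-δ) δ, w i (t - z.1 - (θ z.2 + s')) z.2 := fun z =>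
      setLIntegral_Icc_center (fun s' => w i (t - z.1 - s') z.2) _ _
    simp_rw [this]
    exact Measurable.lintegral_prod_right' hm3
  calc κ * κ' * ENNReal.ofReal δ * ∫⁻ s in Icc (a + Θ) b, ∫⁻ x in Y, w i (t - s) x
      = κ * (κ' * ∫⁻ z in Y, ENNReal.ofReal δ * ∫⁻ s in Icc (a + Θ) b, w i (t - s) z) := by
        rw [lintegral_lintegral_swap hm.aemeasurable,
          lintegral_const_mul' _ _ ENNReal.ofReal_ne_top]
        ring
    _ ≤ κ * (κ' * ∫⁻ z in Y, ∫⁻ s in Icc a b, ∫⁻ s' in Icc (θ z - δ) (θ z + δ),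
          w i (t - (s + s')) z) := by
        gcongr κ * (κ' * ?_)
        refine setLIntegral_mono' hY fun z hz => ?_
        have hθΘ : θ z ≤ Θ := hΘ z hz.1
        have hθ0 : 0 ≤ θ z := by positivity
        exact lintegral_window_add (f := fun s => w i (t - s) z)
          (hm.comp (f := fun s : ℝ => (s, z)) (by fun_prop)) hab (by linarith) (by linarith)
          (by linarith)
    _ = κ * ∫⁻ s in Icc a b, κ' * ∫⁻ z in Y, ∫⁻ s' in Icc (θ z - δ) (θ z + δ),
          w i (t - s - s') z := by
        simp_rw [← sub_sub]
        rw [lintegral_lintegral_swap (f := fun z s => ∫⁻ s' in Icc (θ z - δ) (θ z + δ),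
          w i (t - s - s') z) (hm2.comp measurable_swap).aemeasurable,
          lintegral_const_mul _ (Measurable.lintegral_prod_right' (ν := volume.restrict Y) hm2)]
    _ ≤ κ * ∫⁻ s in Icc a b, ∫⁻ x in Metric.ball p ε, w i (t - s) x := by
        gcongr κ * ?_
        refine setLIntegral_mono' measurableSet_Icc fun s hs =>
          hle' i (t - s) (by linarith [hs.1]) Y hY θ hθm (fun z hz => ?_) fun x hx z hz => ?_
        · rw [hθdef]
          dsimp only
          gcongr
          linarith [hz.2.out]
        · refine abs_norm_sub_sub_le (q := z) hx (by simpa using hε) ?_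
          simp only [hθdef]
          field_simp
    _ ≤ X i t := hle i t ht

/-- Prepending a flight from anywhere far from `p` to a window of delays. -/
lemma exists_le_of_far (h : ScatteringFluxes D vmin vmax τ w) (hv : 0 < vmin) (hvv : vmin < vmax)
    (hτ : 0 < τ) (hδ : 0 < δ) (hε : 0 < ε)
    (hθ₀ : 2 * ε + δ * vmax ≤ ℓ / (vmin + vmax) * ((vmax - vmin) / 2))
    (hδℓ : δ ≤ ℓ / (vmin + vmax)) (hΘ : ∀ z ∈ D, 2 * dist z p / (vmin + vmax) ≤ Θ)
    {Z : ι → ℝ → ℝ≥0∞} (hZ : ∀ i, Measurable (Z i)) {a b : ℝ}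
    (hX : DelayDom τ (fun i t => ∫⁻ x in Metric.ball p ε, w i t x) Z a b)
    (hab : δ ≤ b - a) :
    ∃ κ : ℝ≥0∞, κ ≠ 0 ∧ ∀ i, ∀ t ≤ τ, ∀ r ∈ D, ℓ / 2 ≤ dist r p →
      κ * ∫⁻ s in Icc (a + Θ) b, Z i (t - s) ≤ w i t r := by
  obtain ⟨κ, hκ, hle⟩ := h.flight hv hvv hτ hδ hε.le hθ₀
  have hS : 0 < vmin + vmax := by linarith
  obtain ⟨κ', hκ', hle'⟩ := hX
  refine ⟨κ * κ' * ENNReal.ofReal δ, by simp [hκ, hκ', hδ], fun i t ht r hr hrp => ?_⟩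
  set θ := 2 * dist r p / (vmin + vmax) with hθ
  have hθΘ : θ ≤ Θ := hΘ r hr
  have hθℓ : ℓ / (vmin + vmax) ≤ θ := by
    rw [hθ]
    gcongr
    linarith
  have hm : Measurable fun z : ℝ × Pt => w i (t - z.1) z.2 :=
    (h.meas i).comp (f := fun z : ℝ × Pt => (t - z.1, z.2)) (by fun_prop)
  have hmZ : Measurable fun z : ℝ × ℝ => Z i (t - z.1 - z.2) := (hZ i).comp (by fun_prop)
  calc κ * κ' * ENNReal.ofReal δ * ∫⁻ s in Icc (a + Θ) b, Z i (t - s)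
      = κ * (κ' * (ENNReal.ofReal δ * ∫⁻ s in Icc (a + Θ) b, Z i (t - s))) := by ring
    _ ≤ κ * (κ' * ∫⁻ s in Icc (θ - δ) (θ + δ), ∫⁻ s' in Icc a b, Z i (t - (s + s'))) := by
        gcongr κ * (κ' * ?_)
        exact lintegral_window_add (f := fun s => Z i (t - s)) ((hZ i).comp (by fun_prop))
          (by linarith) hab (by linarith) (by linarith)
    _ = κ * ∫⁻ s in Icc (θ - δ) (θ + δ), κ' * ∫⁻ s' in Icc a b, Z i (t - s - s') := by
        simp_rw [← sub_sub]
        rw [lintegral_const_mul _ (Measurable.lintegral_prod_right' hmZ)]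
    _ ≤ κ * ∫⁻ s in Icc (θ - δ) (θ + δ), ∫⁻ x in Metric.ball p ε, w i (t - s) x := by
        gcongr κ * ?_
        exact setLIntegral_mono' measurableSet_Icc fun s hs =>
          hle' i (t - s) (by linarith [hs.1])
    _ = κ * ∫⁻ x in Metric.ball p ε, ∫⁻ s in Icc (θ - δ) (θ + δ), w i (t - s) x := by
        rw [lintegral_lintegral_swap hm.aemeasurable]
    _ ≤ w i t r := by
        refine hle i t ht r hr _ measurableSet_ball (fun _ => θ) measurable_const
          (fun _ _ => hθℓ) fun z hz => ?_
        refine abs_norm_sub_sub_le (p := r) (q := p) (Metric.mem_ball_self hε) hz ?_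
        rw [hθ, dist_comm]
        field_simp

lemma delayDom_ball (h : ScatteringFluxes D vmin vmax τ w) (hv : 0 < vmin) (hvv : vmin < vmax)
    (hτ : 0 < τ) (hD : MeasurableSet D) (hδ : 0 < δ) (hε : 0 < ε)
    (hθ₀ : 2 * ε + δ * vmax ≤ ℓ / (vmin + vmax) * ((vmax - vmin) / 2))
    (hδℓ : δ ≤ ℓ / (vmin + vmax)) (hℓ0 : 0 ≤ ℓ)
    (hp : Metric.ball p ε ⊆ D) (hq : Metric.ball q ε ⊆ D) (hℓ : ℓ = dist q p)
    (hΘ : ∀ x ∈ D, ∀ z ∈ D, 2 * dist z x / (vmin + vmax) ≤ Θ) {n : ℕ} (hn : 1 ≤ n)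
    (hnΘ : δ + Θ ≤ n * δ) :
    DelayDom τ (fun i t => ∫⁻ x in Metric.ball p ε, w i t x) (fun i t => ∫⁻ x in D, w i t x)
      (n * (2 * (2 * ℓ / (vmin + vmax)) - δ / 2) + Θ + 2 * ℓ / (vmin + vmax))
      (n * (2 * (2 * ℓ / (vmin + vmax)) + δ / 2)) := by
  have hS : 0 < vmin + vmax := by linarith
  have hT : δ ≤ 2 * ℓ / (vmin + vmax) := hδℓ.trans (by gcongr; linarith)
  have hpD : p ∈ D := hp (Metric.mem_ball_self hε)
  have hqD : q ∈ D := hq (Metric.mem_ball_self hε)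
  have hpp := h.delayDom_iterate hv hvv hτ hδ hε hθ₀ hT hp hq hℓ hn
  have hqq := h.delayDom_iterate hv hvv hτ hδ hε hθ₀ hT hq hp (hℓ.trans (dist_comm _ _)) hn
  have hpq := h.delayDom_bounce hv hvv hτ hδ hε hθ₀ hp hℓ
  have hn' : (1 : ℝ) ≤ n := by exact_mod_cast hn
  set T := 2 * ℓ / (vmin + vmax)
  have hΘ0 : 0 ≤ Θ := le_trans (by positivity) (hΘ p hpD p hpD)
  have ha : 0 ≤ n * (2 * T - δ / 2) := mul_nonneg (by linarith) (by linarith)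
  have hab : δ ≤ n * (2 * T + δ / 2) - n * (2 * T - δ / 2) := by linarith
  have h1 := h.delayDom_far hv hvv hτ hD hδ hε hθ₀ hp (hΘ p hpD) hpp ha hab
  have h2 := h.delayDom_far hv hvv hτ hD hδ hε hθ₀ hq (hΘ q hqD) hqq ha hab
  have h3 := hpq.trans (A := n * (2 * T - δ / 2) + Θ + T) (B := n * (2 * T + δ / 2)) h2
    (fun i => h.measurable_section i _) (by linarith) hδ (by linarith) (by linarith)
    (by linarith) (by linarith)
  refine ((h1.mono (by linarith) le_rfl).add_right h3
    (fun i => h.measurable_section i _)).mono_right fun i t => ?_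
  refine le_trans (lintegral_mono_set fun z hz => ?_) (lintegral_union_le _ _ _)
  by_contra hcon
  simp only [mem_union, mem_inter_iff, hz, true_and, not_or, mem_ofPred_eq, not_le] at hcon
  have := dist_triangle q z p
  rw [dist_comm q z] at this
  linarith

end ScatteringFluxes

/-- After enough flights, the flux at every point of `D` dominates the total flux over an
arbitrarily long window of the past. -/
theorem exists_window_scatteringFluxes {D : Set Pt} (hDo : IsOpen D) (hDne : D.Nonempty)
    (hDb : Bornology.IsBounded D) {vmin vmax : ℝ} (hv : 0 < vmin) (hvv : vmin < vmax) (L : ℝ) :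
    ∃ a b : ℝ, a + L ≤ b ∧ L ≤ b ∧ ∀ {ι : Type} {τ : ℝ} {w : ι → ℝ → Pt → ℝ≥0∞}, 0 < τ →
      ScatteringFluxes D vmin vmax τ w → ∃ κ : ℝ≥0∞, κ ≠ 0 ∧ ∀ i, ∀ t ≤ τ, ∀ r ∈ D,
        κ * ∫⁻ s in Icc a b, ∫⁻ z in D, w i (t - s) z ≤ w i t r := by
  have hS : 0 < vmin + vmax := by linarith
  have hvx : 0 < vmax := hv.trans hvv
  obtain ⟨p, hpD⟩ := hDne
  obtain ⟨ρ, hρ, hball⟩ := Metric.isOpen_iff.1 hDo p hpD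
  obtain ⟨e, he⟩ : ∃ e : Pt, ‖e‖ = 1 := exists_norm_eq Pt zero_le_one
  set ℓ := ρ / 2 with hℓdef
  have hℓ0 : 0 < ℓ := half_pos hρ
  set q : Pt := p + ℓ • e with hqdef
  have hqp : ℓ = dist q p := by
    rw [hqdef, dist_eq_norm, add_sub_cancel_left, norm_smul, he, mul_one, Real.norm_eq_abs,
      abs_of_pos hℓ0]
  set M := ℓ / (vmin + vmax) * ((vmax - vmin) / 2) with hM
  have hM0 : 0 < M := mul_pos (by positivity) (by linarith)
  set ε := min (M / 4) ℓ with hε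
  have hε0 : 0 < ε := lt_min (by positivity) hℓ0
  set δ := M / (2 * vmax) with hδ
  have hδ0 : 0 < δ := by positivity
  have hδv : δ * vmax = M / 2 := by rw [hδ]; field_simp
  have hθ₀ : 2 * ε + δ * vmax ≤ M := by
    have : ε ≤ M / 4 := min_le_left _ _
    linarith
  have hδℓ : δ ≤ ℓ / (vmin + vmax) := by
    rw [hδ, div_le_iff₀ (by positivity), hM]
    gcongr
    linarith
  have hp : Metric.ball p ε ⊆ D :=
    (Metric.ball_subset_ball ((min_le_right _ _).trans (by linarith))).trans hball
  have hq : Metric.ball q ε ⊆ D := by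
    refine (Metric.ball_subset_ball' ?_).trans hball
    rw [← hqp]
    have : ε ≤ ℓ := min_le_right _ _
    linarith
  have hqD : q ∈ D := hq (Metric.mem_ball_self hε0)
  set Θ := 2 * Metric.diam D / (vmin + vmax) with hΘdef
  have hΘ : ∀ x ∈ D, ∀ z ∈ D, 2 * dist z x / (vmin + vmax) ≤ Θ := fun x hx z hz => by
    rw [hΘdef]
    gcongr
    exact Metric.dist_le_diam_of_mem hDb hz hx
  have hΘ0 : 0 ≤ Θ := by positivity
  set T := 2 * ℓ / (vmin + vmax) with hT
  have hT0 : 0 ≤ T := by positivity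
  have hδT : δ ≤ T := hδℓ.trans (by rw [hT]; gcongr; linarith)
  obtain ⟨n, hn⟩ := exists_nat_ge ((2 * δ + 2 * Θ + T + |L|) / δ)
  rw [div_le_iff₀ hδ0] at hn
  have hn1 : 1 ≤ n := by
    by_contra! hcon
    have : n = 0 := by omega
    subst this
    simp only [Nat.cast_zero, zero_mul] at hn
    linarith [abs_nonneg L]
  have hn1' : (1 : ℝ) ≤ n := by exact_mod_cast hn1
  have hL := le_abs_self L
  have hL0 := abs_nonneg L
  refine ⟨n * (2 * T - δ / 2) + Θ + T + Θ, n * (2 * T + δ / 2), by linarith, ?_, ?_⟩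
  · have : n * δ ≤ n * (2 * T + δ / 2) := by gcongr; linarith
    linarith
  intro ι τ w hτ h
  have hlen : δ ≤ n * (2 * T + δ / 2) - (n * (2 * T - δ / 2) + Θ + T) := by linarith
  have hmeas : ∀ i, Measurable fun t => ∫⁻ x in D, w i t x := fun i => h.measurable_section i _
  have hnΘ : δ + Θ ≤ n * δ := by linarith
  obtain ⟨κ₁, hκ₁, hle₁⟩ := h.exists_le_of_far hv hvv hτ hδ0 hε0 hθ₀ hδℓ (hΘ p hpD) hmeas
    (h.delayDom_ball hv hvv hτ hDo.measurableSet hδ0 hε0 hθ₀ hδℓ hℓ0.le hp hq hqp hΘ hn1 hnΘ) hlen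
  obtain ⟨κ₂, hκ₂, hle₂⟩ := h.exists_le_of_far hv hvv hτ hδ0 hε0 hθ₀ hδℓ (hΘ q hqD) hmeas
    (h.delayDom_ball hv hvv hτ hDo.measurableSet hδ0 hε0 hθ₀ hδℓ hℓ0.le hq hp
      (hqp.trans (dist_comm _ _)) hΘ hn1 hnΘ) hlen
  refine ⟨min κ₁ κ₂, (lt_min (pos_iff_ne_zero.2 hκ₁) (pos_iff_ne_zero.2 hκ₂)).ne', ?_⟩
  intro i t ht r hr
  by_cases hrp : ℓ / 2 ≤ dist r p
  · exact le_trans (mul_le_mul_left (min_le_left _ _) _) (hle₁ i t ht r hr hrp)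
  · refine le_trans (mul_le_mul_left (min_le_right _ _) _) (hle₂ i t ht r hr ?_)
    have := dist_triangle q r p
    rw [dist_comm q r] at this
    push Not at hrp
    linarith

namespace KinBounds

variable {D : Set Pt} {vmin vmax : ℝ} {K c : ℝ≥0∞} {β : ℝ} {g : Pt → Pt → ℝ≥0∞}
  {p : ℝ → Pt → Pt → ℝ≥0∞}

lemma le_flux (h : KinBounds D (Vel vmin vmax) K c β g p) (hβ : 0 ≤ β) {t τ : ℝ} (ht0 : 0 ≤ t)
    (ht : t ≤ τ) {r : Pt} (hr : r ∈ D) :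
    ENNReal.ofReal (Real.exp (-(β * τ))) * (freeFlux D (Vel vmin vmax) g t r +
      c * ∫⁻ s in Ioi (0 : ℝ), ∫⁻ υ in Vel vmin vmax,
        flux (Vel vmin vmax) p (t - s) (r + s • υ)) ≤ flux (Vel vmin vmax) p t r := by
  have hm : Measurable fun z : Pt × ℝ => flux (Vel vmin vmax) p (t - z.2) (r + z.2 • z.1) :=
    h.measurable_flux.comp (f := fun z : Pt × ℝ => (t - z.2, r + z.2 • z.1)) (by fun_prop)
  have hgm : Measurable fun υ => g (r + t • υ) υ :=
    h.meas_init.comp (f := fun υ : Pt => (r + t • υ, υ)) (by fun_prop)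
  calc _ = ∫⁻ υ in Vel vmin vmax, ENNReal.ofReal (Real.exp (-(β * τ))) * (g (r + t • υ) υ +
        c * ∫⁻ s in Ioi (0 : ℝ), flux (Vel vmin vmax) p (t - s) (r + s • υ)) := by
        rw [lintegral_const_mul' _ _ ENNReal.ofReal_ne_top, lintegral_add_left hgm,
          lintegral_const_mul _ (Measurable.lintegral_prod_right' hm), freeFlux,
          indicator_of_mem hr, Pi.one_apply, one_mul,
          lintegral_lintegral_swap (f := fun υ s => flux (Vel vmin vmax) p (t - s) (r + s • υ))
            hm.aemeasurable]
    _ ≤ _ := by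
        refine setLIntegral_mono' (measurableSet_Vel _ _) fun υ hυ =>
          le_trans ?_ (h.lower t ht0 r υ ⟨hr, hυ⟩)
        gcongr

lemma scatteringFluxes (hc : c ≠ 0) (hβ : 0 ≤ β) (τ : ℝ) :
    ScatteringFluxes D vmin vmax τ (fun i : {q : (Pt → Pt → ℝ≥0∞) × (ℝ → Pt → Pt → ℝ≥0∞) //
      KinBounds D (Vel vmin vmax) K c β q.1 q.2} => flux (Vel vmin vmax) i.1.2) where
  meas i := i.2.measurable_flux
  neg i t ht r := i.2.flux_of_neg ht r
  lower := by
    refine ⟨ENNReal.ofReal (Real.exp (-(β * τ))) * c, ?_, fun i t ht r hr => ?_⟩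
    · simp [hc, Real.exp_pos]
    rcases lt_or_ge t 0 with ht0 | ht0
    · rw [setLIntegral_congr_fun (g := fun _ => 0) measurableSet_Ioi]
      · simp
      · intro s hs
        have : t - s < 0 := by linarith [mem_Ioi.1 hs]
        simp [i.2.flux_of_neg this]
    refine le_trans ?_ (i.2.le_flux hβ ht0 ht hr)
    rw [mul_assoc]
    gcongr
    exact le_add_self

/-- Two-sided bounds of the semigroup by the product of the flight times. -/
theorem exists_two_sided_bound (hDo : IsOpen D) (hDne : D.Nonempty)
    (hDb : Bornology.IsBounded D) (hv : 0 < vmin) (hvv : vmin < vmax)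
    (hK : K ≠ ⊤) (hc : c ≠ 0) (hβ : 0 ≤ β) :
    ∃ τ : ℝ, 0 < τ ∧ ∃ κ L : ℝ≥0∞, κ ≠ 0 ∧ L ≠ ⊤ ∧ ∀ g p,
      KinBounds D (Vel vmin vmax) K c β g p → ∀ r υ, (r, υ) ∈ D ×ˢ Vel vmin vmax →
        κ * flightMass D (Vel vmin vmax) g * fwdTime D r υ ≤ p τ r υ ∧
        p τ r υ ≤ L * flightMass D (Vel vmin vmax) g * fwdTime D r υ := by
  have hD := hDo.measurableSet
  obtain ⟨T₀, hT₀0, hT₀⟩ := bounded_flight (vmax := vmax) hDb hv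
  obtain ⟨a, τ, hab, hτ, hwin⟩ := exists_window_scatteringFluxes hDo hDne hDb hv hvv (4 * T₀)
  have hτ0 : 0 < τ := by linarith
  obtain ⟨L, hL, hup⟩ := exists_upper_bound (c := c) (β := β) hK hD
    hDb.measure_lt_top.ne hT₀0 hT₀ hτ
  obtain ⟨κ, hκ, hlow⟩ := hwin hτ0 (scatteringFluxes (D := D) (K := K) hc hβ τ)
  set e := ENNReal.ofReal (Real.exp (-(β * τ))) with he
  have he0 : e ≠ 0 := by simp [he, Real.exp_pos]
  refine ⟨τ, hτ0, e * c * (κ * e), L, by simp [he0, hc, hκ], hL, fun g p h r υ hq =>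
    ⟨?_, hup g p h r υ hq⟩⟩
  have hflux : ∀ s, 0 < s → s < T₀ → ∀ z ∈ D,
      κ * e * flightMass D (Vel vmin vmax) g ≤ flux (Vel vmin vmax) p (τ - s) z := by
    intro s hs hsT z hz
    refine le_trans ?_ (hlow ⟨(g, p), h⟩ (τ - s) (by linarith) z hz)
    rw [mul_assoc]
    gcongr κ * ?_
    have hFm : Measurable fun t => ∫⁻ r, freeFlux D (Vel vmin vmax) g t r :=
      Measurable.lintegral_prod_right' (measurable_freeFlux hD h.meas_init)
    calc e * flightMass D (Vel vmin vmax) g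
        = ∫⁻ u in Ioi (0 : ℝ), e * ∫⁻ r, freeFlux D (Vel vmin vmax) g u r := by
          rw [← lintegral_freeFlux hD h.meas_init, lintegral_const_mul _ hFm]
      _ = ∫⁻ u, (Ioi (0 : ℝ)).indicator
            (fun u => e * ∫⁻ r, freeFlux D (Vel vmin vmax) g u r) (τ - s - u) := by
          rw [lintegral_sub_left_eq_self _ (τ - s), lintegral_indicator measurableSet_Ioi]
      _ ≤ ∫⁻ u in Icc a τ, ∫⁻ z in D, flux (Vel vmin vmax) p (τ - s - u) z := by
          rw [← lintegral_indicator measurableSet_Icc]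
          refine lintegral_mono fun u => ?_
          by_cases hu : 0 < τ - s - u
          swap
          · rw [indicator_of_notMem (by simpa using hu)]; exact zero_le
          rw [indicator_of_mem (mem_Ioi.2 hu)]
          by_cases huT : T₀ ≤ τ - s - u
          · simp [h.freeFlux_eq_zero hT₀ huT]
          push Not at huT
          rw [indicator_of_mem (show u ∈ Icc a τ from ⟨by linarith, by linarith⟩),
            ← lintegral_const_mul' _ _ ENNReal.ofReal_ne_top, ← lintegral_indicator hD]
          refine lintegral_mono fun z => ?_
          by_cases hz : z ∈ D
          · rw [indicator_of_mem hz]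
            refine le_trans ?_ (h.le_flux hβ hu.le (by linarith : τ - s - u ≤ τ) hz)
            gcongr
            exact le_self_add
          · rw [indicator_of_notMem hz, freeFlux, indicator_of_notMem hz]; simp
  have hind : Measurable fun s : ℝ => D.indicator (1 : Pt → ℝ≥0∞) (r + s • υ) :=
    (measurable_one.indicator hD).comp (by fun_prop)
  refine le_trans ?_ (h.lower τ hτ0.le r υ hq)
  calc e * c * (κ * e) * flightMass D (Vel vmin vmax) g * fwdTime D r υ
      = e * (c * ∫⁻ s in Ioi (0 : ℝ),
          κ * e * flightMass D (Vel vmin vmax) g * D.indicator 1 (r + s • υ)) := by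
        rw [lintegral_const_mul _ hind, fwdTime]; ring
    _ ≤ e * (c * ∫⁻ s in Ioi (0 : ℝ), flux (Vel vmin vmax) p (τ - s) (r + s • υ)) := by
        gcongr e * (c * ?_)
        refine setLIntegral_mono' measurableSet_Ioi fun s hs => ?_
        by_cases hsD : r + s • υ ∈ D
        · have hsT : s < T₀ := by
            by_contra! hcon
            exact hT₀ r hq.1 υ hq.2 s hcon hsD
          rw [indicator_of_mem hsD, Pi.one_apply, mul_one]
          exact hflux s hs hsT _ hsD
        · rw [indicator_of_notMem hsD, mul_zero]; exact zero_le
    _ ≤ _ := by gcongr; exact le_add_self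

end KinBounds

/-- Nonnegative bounded measurable functions on a measurable space. -/
structure BddNN {X : Type*} [MeasurableSpace X] (f : X → ℝ) : Prop where
  meas : Measurable f
  nonneg : ∀ x, 0 ≤ f x
  bdd : ∃ M : ℝ, ∀ x, f x ≤ M

namespace BddNN

variable {X : Type*} [MeasurableSpace X] {f g : X → ℝ}

lemma exists_pos_bound (hf : BddNN f) : ∃ M : ℝ, 0 < M ∧ ∀ x, f x ≤ M := by
  obtain ⟨M, hM⟩ := hf.bdd
  exact ⟨max M 1, by positivity, fun x => (hM x).trans (le_max_left _ _)⟩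

lemma add (hf : BddNN f) (hg : BddNN g) : BddNN (f + g) := by
  obtain ⟨M, hM⟩ := hf.bdd
  obtain ⟨N, hN⟩ := hg.bdd
  exact ⟨hf.meas.add hg.meas, fun x => add_nonneg (hf.nonneg x) (hg.nonneg x), M + N,
    fun x => add_le_add (hM x) (hN x)⟩

lemma smul (hf : BddNN f) {k : ℝ} (hk : 0 ≤ k) : BddNN (k • f) := by
  obtain ⟨M, hM⟩ := hf.bdd
  exact ⟨hf.meas.const_smul k, fun x => mul_nonneg hk (hf.nonneg x), k * M,
    fun x => mul_le_mul_of_nonneg_left (hM x) hk⟩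

lemma mul (hf : BddNN f) (hg : BddNN g) : BddNN fun x => f x * g x := by
  obtain ⟨M, hM⟩ := hf.bdd
  obtain ⟨N, hN⟩ := hg.bdd
  exact ⟨hf.meas.mul hg.meas, fun x => mul_nonneg (hf.nonneg x) (hg.nonneg x), M * N, fun x =>
    mul_le_mul (hM x) (hN x) (hg.nonneg x) ((hf.nonneg x).trans (hM x))⟩

lemma sub (hf : BddNN f) (hg : BddNN g) (h : ∀ x, g x ≤ f x) : BddNN (f - g) := by
  obtain ⟨M, hM⟩ := hf.bdd
  exact ⟨hf.meas.sub hg.meas, fun x => sub_nonneg.2 (h x), M,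
    fun x => (sub_le_self _ (hg.nonneg x)).trans (hM x)⟩

lemma const {k : ℝ} (hk : 0 ≤ k) : BddNN fun _ : X => k :=
  ⟨measurable_const, fun _ => hk, k, fun _ => le_rfl⟩

lemma one : BddNN (1 : X → ℝ) := const zero_le_one

lemma indicator {A : Set X} (hA : MeasurableSet A) : BddNN (A.indicator (1 : X → ℝ)) :=
  ⟨measurable_one.indicator hA, indicator_nonneg fun _ _ => zero_le_one, 1,
    indicator_le_self' fun _ _ => zero_le_one⟩

lemma integrable (hf : BddNN f) (μ : Measure X) [IsFiniteMeasure μ] : Integrable f μ := by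
  obtain ⟨M, hM⟩ := hf.bdd
  refine Integrable.of_bound hf.meas.aestronglyMeasurable M (ae_of_all _ fun x => ?_)
  rw [Real.norm_eq_abs, abs_of_nonneg (hf.nonneg x)]
  exact hM x

end BddNN

/-- A positive linear functional on bounded measurable functions, comparable to integration
against a density `b`. -/
structure DominatedFunctional {X : Type*} [MeasurableSpace X] (μ : Measure X) (b : X → ℝ)
    (c C : ℝ) (ℓ : (X → ℝ) → ℝ) : Prop where
  add : ∀ f g, BddNN f → BddNN g → ℓ (f + g) = ℓ f + ℓ g
  smul : ∀ (k : ℝ) f, 0 ≤ k → BddNN f → ℓ (k • f) = k * ℓ f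
  lower : ∀ f, BddNN f → c * ∫ x, f x * b x ∂μ ≤ ℓ f
  upper : ∀ f, BddNN f → ℓ f ≤ C * ∫ x, f x * b x ∂μ

namespace DominatedFunctional

variable {X : Type*} [MeasurableSpace X] {μ : Measure X} {b : X → ℝ} {c C : ℝ}
  {ℓ : (X → ℝ) → ℝ}

lemma nonneg (h : DominatedFunctional μ b c C ℓ) (hc : 0 ≤ c) (hb : BddNN b) {f : X → ℝ}
    (hf : BddNN f) : 0 ≤ ℓ f :=
  (mul_nonneg hc (integral_nonneg (hf.mul hb).nonneg)).trans (h.lower f hf)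

lemma mono (h : DominatedFunctional μ b c C ℓ) (hc : 0 ≤ c) (hb : BddNN b) {f g : X → ℝ}
    (hf : BddNN f) (hg : BddNN g) (hfg : ∀ x, f x ≤ g x) : ℓ f ≤ ℓ g := by
  have h1 := h.add f (g - f) hf (hg.sub hf hfg)
  rw [add_sub_cancel] at h1
  linarith [h.nonneg hc hb (hg.sub hf hfg)]

lemma zero (h : DominatedFunctional μ b c C ℓ) : ℓ 0 = 0 := by
  have := h.smul 0 0 le_rfl (BddNN.const le_rfl)
  simpa using this

lemma sum_indicator (h : DominatedFunctional μ b c C ℓ) {A : ℕ → Set X}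
    (hA : ∀ i, MeasurableSet (A i)) (hd : Pairwise (Function.onFun Disjoint A)) (s : Finset ℕ) :
    ℓ ((⋃ i ∈ s, A i).indicator 1) = ∑ i ∈ s, ℓ ((A i).indicator 1) := by
  induction s using Finset.induction_on with
  | empty =>
    have h0 : (⋃ i ∈ (∅ : Finset ℕ), A i).indicator (1 : X → ℝ) = 0 := by
      ext x
      simp
    rw [h0, h.zero, Finset.sum_empty]
  | insert i s hi ih =>
    rw [Finset.sum_insert hi, ← ih, Finset.set_biUnion_insert, indicator_union_of_disjoint,
      ← h.add _ _ (BddNN.indicator (hA i)) (BddNN.indicator (s.measurableSet_biUnion fun j _ => hA j))]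
    · rfl
    · rw [disjoint_iUnion₂_right]
      exact fun j hj => hd fun hij => hi (hij ▸ hj)

lemma hasSum_indicator [IsFiniteMeasure μ] (h : DominatedFunctional μ b c C ℓ) (hc : 0 ≤ c)
    (hb : BddNN b) {A : ℕ → Set X} (hA : ∀ i, MeasurableSet (A i))
    (hd : Pairwise (Function.onFun Disjoint A)) :
    HasSum (fun i => ℓ ((A i).indicator 1)) (ℓ ((⋃ i, A i).indicator 1)) := by
  have hU := MeasurableSet.iUnion hA
  have hintegral : ∀ B : Set X, MeasurableSet B → ∫ x, B.indicator (1 : X → ℝ) x * b x ∂μ =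
      ∫ x in B, b x ∂μ := fun B hB => by
    rw [← integral_indicator hB]
    congr 1 with x
    by_cases hx : x ∈ B <;> simp [hx]
  have hsum := hasSum_integral_iUnion hA hd (hb.integrable μ).integrableOn
  have hdiff : ∀ s : Finset ℕ, ℓ ((⋃ i, A i).indicator 1) - ∑ i ∈ s, ℓ ((A i).indicator 1) =
      ℓ (((⋃ i, A i) \ ⋃ i ∈ s, A i).indicator 1) := fun s => by
    have hs := s.measurableSet_biUnion fun j _ => hA j
    rw [← h.sum_indicator hA hd s, sub_eq_iff_eq_add,
      ← h.add _ _ (BddNN.indicator (hU.diff hs)) (BddNN.indicator hs)]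
    congr 1
    ext x
    have hsub : x ∈ ⋃ i ∈ s, A i → x ∈ ⋃ i, A i :=
      fun hx => iUnion₂_subset (fun i _ => subset_iUnion A i) hx
    by_cases h1 : x ∈ ⋃ i ∈ s, A i
    · rw [Pi.add_apply, indicator_of_mem (hsub h1), indicator_of_mem h1,
        indicator_of_notMem fun h2 => h2.2 h1, zero_add]
    · by_cases h2 : x ∈ ⋃ i, A i
      · rw [Pi.add_apply, indicator_of_mem h2, indicator_of_notMem h1,
          indicator_of_mem ((mem_sdiff x).2 ⟨h2, h1⟩), add_zero]
      · rw [Pi.add_apply, indicator_of_notMem h2, indicator_of_notMem h1,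
          indicator_of_notMem fun h3 => h2 h3.1, add_zero]
  have hdiff' : ∀ s : Finset ℕ, ∫ x, ((⋃ i, A i) \ ⋃ i ∈ s, A i).indicator (1 : X → ℝ) x * b x ∂μ =
      (∫ x in ⋃ i, A i, b x ∂μ) - ∑ i ∈ s, ∫ x in A i, b x ∂μ := fun s => by
    have hs := s.measurableSet_biUnion fun j _ => hA j
    rw [hintegral _ (hU.diff hs), setIntegral_sdiff hs (hb.integrable μ).integrableOn
      (iUnion₂_subset fun i _ => subset_iUnion A i),
      integral_biUnion_finset _ (fun i _ => hA i) (fun i _ j _ hij => hd hij)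
        (fun i _ => (hb.integrable μ).integrableOn)]
  have hlim : Filter.Tendsto (fun s : Finset ℕ =>
      C * ((∫ x in ⋃ i, A i, b x ∂μ) - ∑ i ∈ s, ∫ x in A i, b x ∂μ)) Filter.atTop (nhds 0) := by
    have := (tendsto_const_nhds (x := ∫ x in ⋃ i, A i, b x ∂μ)).sub hsum
    simpa using this.const_mul C
  have h0 : Filter.Tendsto (fun s : Finset ℕ =>
      ℓ ((⋃ i, A i).indicator 1) - ∑ i ∈ s, ℓ ((A i).indicator 1)) Filter.atTop (nhds 0) := by
    refine squeeze_zero (fun s => ?_) (fun s => ?_) hlim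
    · rw [hdiff]
      exact h.nonneg hc hb (BddNN.indicator (hU.diff (s.measurableSet_biUnion fun j _ => hA j)))
    · rw [hdiff, ← hdiff']
      exact h.upper _ (BddNN.indicator (hU.diff (s.measurableSet_biUnion fun j _ => hA j)))
  have := (tendsto_const_nhds (x := ℓ ((⋃ i, A i).indicator 1))).sub h0
  simpa [HasSum] using this

/-- A dominated positive functional is given by a finite measure on measurable sets. -/
lemma exists_measure [IsFiniteMeasure μ] (h : DominatedFunctional μ b c C ℓ) (hc : 0 ≤ c)
    (hb : BddNN b) :
    ∃ ν : Measure X, ∀ A, MeasurableSet A → ν A = ENNReal.ofReal (ℓ (A.indicator 1)) := by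
  refine ⟨Measure.ofMeasurable (fun A _ => ENNReal.ofReal (ℓ (A.indicator 1))) ?_ ?_, ?_⟩
  · rw [indicator_empty]
    exact (congrArg ENNReal.ofReal h.zero).trans ENNReal.ofReal_zero
  · intro A hA hd
    have hs := h.hasSum_indicator hc hb hA hd
    rw [← hs.tsum_eq, ENNReal.ofReal_tsum_of_nonneg
      (fun i => h.nonneg hc hb (BddNN.indicator (hA i))) hs.summable]
  · intro A hA
    exact Measure.ofMeasurable_apply A hA

/-- The measure representing the functional integrates simple functions correctly. -/
lemma lintegral_simpleFunc (h : DominatedFunctional μ b c C ℓ) (hc : 0 ≤ c)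
    (hb : BddNN b) {ν : Measure X}
    (hν : ∀ A, MeasurableSet A → ν A = ENNReal.ofReal (ℓ (A.indicator 1)))
    (s : SimpleFunc X NNReal) :
    BddNN (fun x => (s x : ℝ)) ∧ ∫⁻ x, s x ∂ν = ENNReal.ofReal (ℓ fun x => (s x : ℝ)) := by
  induction s using SimpleFunc.induction with
  | const k hA =>
    rename_i A
    have hfun : (fun x => ((SimpleFunc.piecewise A hA (SimpleFunc.const X k)
        (SimpleFunc.const X 0)) x : ℝ)) = (k : ℝ) • A.indicator 1 := by
      ext x
      by_cases hx : x ∈ A <;> simp [hx]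
    rw [hfun]
    refine ⟨(BddNN.indicator hA).smul k.coe_nonneg, ?_⟩
    rw [h.smul (k : ℝ) _ k.coe_nonneg (BddNN.indicator hA), ENNReal.ofReal_mul k.coe_nonneg, ← hν A hA,
      ENNReal.ofReal_coe_nnreal, ← lintegral_indicator_const hA]
    congr 1 with x
    by_cases hx : x ∈ A <;> simp [hx]
  | add _ hf hg =>
    rename_i f g _
    have hfun : (fun x => ((f + g) x : ℝ)) = (fun x => (f x : ℝ)) + fun x => (g x : ℝ) := by
      ext x; simp
    rw [hfun]
    refine ⟨hf.1.add hg.1, ?_⟩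
    rw [h.add _ _ hf.1 hg.1, ENNReal.ofReal_add (h.nonneg hc hb hf.1) (h.nonneg hc hb hg.1),
      ← hf.2, ← hg.2, ← lintegral_add_left f.measurable.coe_nnreal_ennreal]
    simp

lemma lintegral_le (h : DominatedFunctional μ b c C ℓ) (hc : 0 ≤ c)
    (hb : BddNN b) {ν : Measure X}
    (hν : ∀ A, MeasurableSet A → ν A = ENNReal.ofReal (ℓ (A.indicator 1)))
    {f : X → ℝ} (hf : BddNN f) : ∫⁻ x, ENNReal.ofReal (f x) ∂ν ≤ ENNReal.ofReal (ℓ f) := by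
  rw [lintegral_eq_nnreal]
  refine iSup₂_le fun s hs => ?_
  obtain ⟨hs1, hs2⟩ := h.lintegral_simpleFunc hc hb hν s
  rw [← SimpleFunc.lintegral_eq_lintegral]
  simp only [SimpleFunc.map_apply]
  rw [hs2]
  refine ENNReal.ofReal_le_ofReal (h.mono hc hb hs1 hf fun x => ?_)
  have := hs x
  rw [← ENNReal.ofReal_coe_nnreal] at this
  exact (ENNReal.ofReal_le_ofReal_iff (hf.nonneg x)).1 this

lemma lintegral_eq (h : DominatedFunctional μ b c C ℓ) (hc : 0 ≤ c)
    (hb : BddNN b) {ν : Measure X}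
    (hν : ∀ A, MeasurableSet A → ν A = ENNReal.ofReal (ℓ (A.indicator 1)))
    {f : X → ℝ} (hf : BddNN f) : ∫⁻ x, ENNReal.ofReal (f x) ∂ν = ENNReal.ofReal (ℓ f) := by
  obtain ⟨M, hM0, hM⟩ := hf.exists_pos_bound
  have hMf : BddNN ((M • (1 : X → ℝ)) - f) :=
    (BddNN.one.smul hM0.le).sub hf fun x => by simpa using hM x
  refine le_antisymm (h.lintegral_le hc hb hν hf) ?_
  have h1 := h.lintegral_le hc hb hν hMf
  have h2 : (∫⁻ x, ENNReal.ofReal (f x) ∂ν) + ∫⁻ x, ENNReal.ofReal ((M • (1 : X → ℝ) - f) x) ∂ν =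
      ENNReal.ofReal (ℓ f) + ENNReal.ofReal (ℓ (M • (1 : X → ℝ) - f)) := by
    rw [← lintegral_add_left hf.meas.ennreal_ofReal,
      ← ENNReal.ofReal_add (h.nonneg hc hb hf) (h.nonneg hc hb hMf), ← h.add _ _ hf hMf,
      add_sub_cancel, h.smul _ _ hM0.le BddNN.one, ENNReal.ofReal_mul hM0.le]
    have h3 : ∀ x, ENNReal.ofReal (f x) + ENNReal.ofReal ((M • (1 : X → ℝ) - f) x) =
        ENNReal.ofReal M := fun x => by
      rw [← ENNReal.ofReal_add (hf.nonneg x) (hMf.nonneg x)]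
      simp
    simp_rw [h3]
    rw [lintegral_const, hν univ MeasurableSet.univ, indicator_univ]
  by_contra! hcon
  have h4 := ENNReal.add_lt_add_of_lt_of_le
    (ne_top_of_le_ne_top ENNReal.ofReal_ne_top h1) hcon h1
  exact h4.ne h2

/-- A dominated positive functional has a density, comparable to `b`. -/
theorem exists_density [IsFiniteMeasure μ] (h : DominatedFunctional μ b c C ℓ) (hc : 0 ≤ c)
    (hC : 0 ≤ C) (hb : BddNN b) :
    ∃ d : X → ℝ, BddNN d ∧ (∀ᵐ x ∂μ, c * b x ≤ d x) ∧
      ∀ f, BddNN f → ∫ x, d x * f x ∂μ = ℓ f := by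
  obtain ⟨ν, hν⟩ := h.exists_measure hc hb
  have hνfin : IsFiniteMeasure ν := ⟨by rw [hν _ MeasurableSet.univ]; exact ENNReal.ofReal_lt_top⟩
  have hintegral : ∀ A : Set X, MeasurableSet A → ∀ k : ℝ, 0 ≤ k →
      ENNReal.ofReal (k * ∫ x, A.indicator (1 : X → ℝ) x * b x ∂μ) =
      ∫⁻ x in A, ENNReal.ofReal (k * b x) ∂μ := fun A hA k hk => by
    rw [← integral_const_mul, ofReal_integral_eq_lintegral_ofReal, ← lintegral_indicator hA]
    · congr 1 with x
      by_cases hx : x ∈ A <;> simp [hx]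
    · exact (((BddNN.indicator hA).mul hb).integrable μ).const_mul k
    · exact ae_of_all _ fun x => mul_nonneg hk (((BddNN.indicator hA).mul hb).nonneg x)
  have hac : ν ≪ μ := by
    refine Measure.AbsolutelyContinuous.mk fun A hA h0 => ?_
    rw [hν A hA]
    refine le_antisymm ((ENNReal.ofReal_le_ofReal
      (h.upper _ (BddNN.indicator hA))).trans ?_) zero_le
    rw [hintegral A hA C hC, setLIntegral_measure_zero _ _ h0]
  set d₀ := ν.rnDeriv μ with hd₀
  have hd₀m : Measurable d₀ := Measure.measurable_rnDeriv _ _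
  have hd₀int : ∀ A, MeasurableSet A → ∫⁻ x in A, d₀ x ∂μ = ENNReal.ofReal (ℓ (A.indicator 1)) :=
    fun A hA => by rw [hd₀, Measure.setLIntegral_rnDeriv hac, hν A hA]
  have hup : d₀ ≤ᵐ[μ] fun x => ENNReal.ofReal (C * b x) := by
    refine ae_le_of_forall_setLIntegral_le_of_sigmaFinite hd₀m fun A hA _ => ?_
    rw [hd₀int A hA, ← hintegral A hA C hC]
    exact ENNReal.ofReal_le_ofReal (h.upper _ (BddNN.indicator hA))
  have hlo : (fun x => ENNReal.ofReal (c * b x)) ≤ᵐ[μ] d₀ := by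
    refine ae_le_of_forall_setLIntegral_le_of_sigmaFinite
      (hb.meas.const_mul c).ennreal_ofReal fun A hA _ => ?_
    rw [hd₀int A hA, ← hintegral A hA c hc]
    exact ENNReal.ofReal_le_ofReal (h.lower _ (BddNN.indicator hA))
  refine ⟨fun x => min (d₀ x).toReal (C * b x), ⟨hd₀m.ennreal_toReal.min (hb.meas.const_mul C),
    fun x => le_min ENNReal.toReal_nonneg (mul_nonneg hC (hb.nonneg x)), ?_⟩, ?_, fun f hf => ?_⟩
  · obtain ⟨M, hM⟩ := hb.bdd
    exact ⟨C * M, fun x => (min_le_right _ _).trans (mul_le_mul_of_nonneg_left (hM x) hC)⟩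
  · filter_upwards [hup, hlo] with x h1 h2
    have hfin : d₀ x ≠ ⊤ := ne_top_of_le_ne_top ENNReal.ofReal_ne_top h1
    have h3 : c * b x ≤ (d₀ x).toReal := (ENNReal.ofReal_le_iff_le_toReal hfin).1 h2
    have h4 : (d₀ x).toReal ≤ C * b x :=
      ENNReal.toReal_le_of_le_ofReal (mul_nonneg hC (hb.nonneg x)) h1
    exact le_min h3 (h3.trans h4)
  · have heq : (fun x => min (d₀ x).toReal (C * b x) * f x) =ᵐ[μ] fun x => (d₀ x).toReal * f x := by
      filter_upwards [hup] with x h1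
      rw [min_eq_left (ENNReal.toReal_le_of_le_ofReal (mul_nonneg hC (hb.nonneg x)) h1)]
    rw [integral_congr_ae heq]
    have h5 : ∫ x, (d₀ x).toReal * f x ∂μ = ∫ x, f x ∂ν := by
      simpa [hd₀] using integral_rnDeriv_smul (f := f) hac
    rw [h5, integral_eq_lintegral_of_nonneg_ae (ae_of_all _ hf.nonneg)
      hf.meas.aestronglyMeasurable, h.lintegral_eq hc hb hν hf,
      ENNReal.toReal_ofReal (h.nonneg hc hb hf)]

end DominatedFunctional

/-- A nonnegative bounded multiplicative function on the half-line is an exponential. -/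
lemma exists_eq_exp_of_mul {ρ : ℝ → ℝ} {τ K : ℝ} (hτ : 0 < τ) (h0 : ∀ s, 0 ≤ s → 0 ≤ ρ s)
    (hmul : ∀ s t, 0 ≤ s → 0 ≤ t → ρ (s + t) = ρ s * ρ t) (hρτ : 0 < ρ τ)
    (hK : ∀ s ∈ Icc 0 τ, ρ s ≤ K) : ∃ lam : ℝ, ∀ s, 0 ≤ s → ρ s = Real.exp (lam * s) := by
  set lam := Real.log (ρ τ) / τ with hlam
  refine ⟨lam, ?_⟩
  set G : ℝ → ℝ := fun s => ρ s * Real.exp (-(lam * s)) with hG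
  have hG0 : ∀ s, 0 ≤ s → 0 ≤ G s := fun s hs => mul_nonneg (h0 s hs) (Real.exp_pos _).le
  have hGmul : ∀ s t, 0 ≤ s → 0 ≤ t → G (s + t) = G s * G t := fun s t hs ht => by
    have : -(lam * (s + t)) = -(lam * s) + -(lam * t) := by ring
    simp only [hG]
    rw [hmul s t hs ht, this, Real.exp_add]
    ring
  have hGτ : G τ = 1 := by
    have : lam * τ = Real.log (ρ τ) := by rw [hlam]; field_simp
    simp only [hG]
    rw [this, Real.exp_neg, Real.exp_log hρτ, mul_inv_cancel₀ hρτ.ne']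
  have hper : ∀ (n : ℕ) s, 0 ≤ s → G (s + n * τ) = G s := by
    intro n s hs
    induction n with
    | zero => simp
    | succ n ih =>
      have : s + ((n + 1 : ℕ) : ℝ) * τ = (s + n * τ) + τ := by push_cast; ring
      rw [this, hGmul _ _ (by positivity) hτ.le, hGτ, ih, mul_one]
  have hpow : ∀ (n : ℕ) s, 0 ≤ s → G (((n + 1 : ℕ) : ℝ) * s) = G s ^ (n + 1) := by
    intro n s hs
    induction n with
    | zero => simp
    | succ n ih =>
      have : ((n + 1 + 1 : ℕ) : ℝ) * s = ((n + 1 : ℕ) : ℝ) * s + s := by push_cast; ring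
      rw [this, hGmul _ _ (by positivity) hs, ih, pow_succ _ (n + 1)]
  set K' := max 0 K * Real.exp (|lam| * τ) with hK'
  have hbd : ∀ s, 0 ≤ s → G s ≤ K' := by
    intro s hs
    have hfl : (⌊s / τ⌋₊ : ℝ) * τ ≤ s := by
      rw [← le_div_iff₀ hτ]; exact Nat.floor_le (by positivity)
    have hfl2 : s < ((⌊s / τ⌋₊ : ℝ) + 1) * τ := by
      rw [← div_lt_iff₀ hτ]; exact Nat.lt_floor_add_one _
    have h1 := hper ⌊s / τ⌋₊ (s - ⌊s / τ⌋₊ * τ) (by linarith)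
    rw [sub_add_cancel] at h1
    rw [h1]
    have hmem : s - ⌊s / τ⌋₊ * τ ∈ Icc 0 τ := ⟨by linarith, by linarith⟩
    refine mul_le_mul ((hK _ hmem).trans (le_max_right _ _)) (Real.exp_le_exp.2 ?_)
      (Real.exp_pos _).le (le_max_left _ _)
    rw [← neg_mul]
    exact mul_le_mul (neg_le_abs lam) hmem.2 hmem.1 (abs_nonneg _)
  have hle : ∀ s, 0 ≤ s → G s ≤ 1 := by
    intro s hs
    by_contra! hcon
    obtain ⟨n, hn⟩ := pow_unbounded_of_one_lt K' hcon
    have h1 := hbd (((n + 1 : ℕ) : ℝ) * s) (by positivity)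
    rw [hpow n s hs] at h1
    have h2 : G s ^ n ≤ G s ^ (n + 1) := pow_le_pow_right₀ hcon.le (Nat.le_succ n)
    linarith
  intro s hs
  have h1 : G s = 1 := by
    refine le_antisymm (hle s hs) ?_
    obtain ⟨n, hn⟩ := exists_nat_ge (s / τ)
    rw [div_le_iff₀ hτ] at hn
    have h2 : G s * G (n * τ - s) = G τ := by
      rw [← hGmul _ _ hs (by linarith), add_sub_cancel]
      have h3 := hper n τ hτ.le
      rw [← h3, add_comm τ, hGmul _ _ (by positivity) hτ.le, hGτ, mul_one]
    rw [hGτ] at h2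
    nlinarith [hle (n * τ - s) (by linarith), hG0 s hs]
  have h2 : ρ s = G s * Real.exp (lam * s) := by
    simp only [hG]
    rw [mul_assoc, ← Real.exp_add, neg_add_cancel, Real.exp_zero, mul_one]
  rw [h2, h1, one_mul]

/-- A positive linear semigroup on bounded measurable functions which at some time `τ` is
comparable, from above and below, to the rank-one operator `f ↦ a · ∫ f b`. -/
structure PFSystem {X : Type*} [MeasurableSpace X] (μ : Measure X) (P : ℝ → (X → ℝ) → X → ℝ)
    (a b : X → ℝ) (τ c C : ℝ) : Prop where
  bddNN : ∀ t f, 0 ≤ t → BddNN f → BddNN (P t f)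
  add : ∀ t f g, 0 ≤ t → BddNN f → BddNN g → P t (f + g) = P t f + P t g
  smul : ∀ t (k : ℝ) f, 0 ≤ t → 0 ≤ k → BddNN f → P t (k • f) = k • P t f
  semi : ∀ s t f, 0 ≤ s → 0 ≤ t → BddNN f → P (s + t) f = P s (P t f)
  locbdd : ∀ T, ∃ M, ∀ t ∈ Icc 0 T, ∀ x, P t 1 x ≤ M
  left_bdd : BddNN a
  left_pos : ∀ x, 0 < a x
  right_bdd : BddNN b
  pairing_pos : 0 < ∫ x, a x * b x ∂μ
  time_pos : 0 < τ
  lower_pos : 0 < c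
  two_mul_le : 2 * c ≤ C
  lower : ∀ f, BddNN f → ∀ x, c * a x * ∫ y, f y * b y ∂μ ≤ P τ f x
  upper : ∀ f, BddNN f → ∀ x, P τ f x ≤ C * a x * ∫ y, f y * b y ∂μ

/-- `P t f / P t 1` converges to `l` uniformly as `t → ∞`. -/
def RatioLim {X : Type*} (P : ℝ → (X → ℝ) → X → ℝ) (f : X → ℝ) (l : ℝ) : Prop :=
  ∀ ε > 0, ∃ T, ∀ t ≥ T, ∀ x, |P t f x - l * P t 1 x| ≤ ε * P t 1 x

namespace PFSystem

variable {X : Type*} [MeasurableSpace X] {μ : Measure X} {P : ℝ → (X → ℝ) → X → ℝ}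
  {a b : X → ℝ} {τ c C : ℝ} {f g : X → ℝ}

lemma mono (h : PFSystem μ P a b τ c C) {t : ℝ} (ht : 0 ≤ t) (hf : BddNN f) (hg : BddNN g)
    (hfg : ∀ x, f x ≤ g x) (x : X) : P t f x ≤ P t g x := by
  have h1 := h.add t f (g - f) ht hf (hg.sub hf hfg)
  rw [add_sub_cancel] at h1
  rw [h1, Pi.add_apply]
  linarith [(h.bddNN t _ ht (hg.sub hf hfg)).nonneg x]

lemma one_nonneg (h : PFSystem μ P a b τ c C) {t : ℝ} (ht : 0 ≤ t) (x : X) : 0 ≤ P t 1 x :=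
  (h.bddNN t 1 ht BddNN.one).nonneg x

lemma upper_pos (h : PFSystem μ P a b τ c C) : 0 < C := by
  linarith [h.lower_pos, h.two_mul_le]

lemma integral_add [IsFiniteMeasure μ] (h : PFSystem μ P a b τ c C) (hf : BddNN f)
    (hg : BddNN g) :
    ∫ x, (f + g) x * b x ∂μ = (∫ x, f x * b x ∂μ) + ∫ x, g x * b x ∂μ := by
  rw [← MeasureTheory.integral_add ((hf.mul h.right_bdd).integrable μ)
    ((hg.mul h.right_bdd).integrable μ)]
  simp only [Pi.add_apply, add_mul]

lemma integral_smul (k : ℝ) :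
    ∫ x, (k • f) x * b x ∂μ = k * ∫ x, f x * b x ∂μ := by
  rw [← integral_const_mul]
  simp only [Pi.smul_apply, smul_eq_mul, mul_assoc]

lemma integral_nonneg (h : PFSystem μ P a b τ c C) (hf : BddNN f) : 0 ≤ ∫ x, f x * b x ∂μ :=
  MeasureTheory.integral_nonneg (hf.mul h.right_bdd).nonneg

lemma integral_mono [IsFiniteMeasure μ] (h : PFSystem μ P a b τ c C) (hf : BddNN f)
    (hg : BddNN g) (hfg : ∀ x, f x ≤ g x) : ∫ x, f x * b x ∂μ ≤ ∫ x, g x * b x ∂μ :=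
  MeasureTheory.integral_mono ((hf.mul h.right_bdd).integrable μ)
    ((hg.mul h.right_bdd).integrable μ)
    fun x => mul_le_mul_of_nonneg_right (hfg x) (h.right_bdd.nonneg x)

lemma integral_one_pos [IsFiniteMeasure μ] (h : PFSystem μ P a b τ c C) :
    0 < ∫ x, (1 : X → ℝ) x * b x ∂μ := by
  obtain ⟨M, hM0, hM⟩ := h.left_bdd.exists_pos_bound
  have h1 := h.integral_mono h.left_bdd (BddNN.one.smul hM0.le) fun x => by simpa using hM x
  rw [integral_smul] at h1
  exact pos_of_mul_pos_right (h.pairing_pos.trans_le h1) hM0.le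

lemma integral_step_pos [IsFiniteMeasure μ] (h : PFSystem μ P a b τ c C) (hf : BddNN f)
    (hpos : 0 < ∫ x, f x * b x ∂μ) : 0 < ∫ x, P τ f x * b x ∂μ := by
  have hk : 0 ≤ c * ∫ x, f x * b x ∂μ := mul_nonneg h.lower_pos.le hpos.le
  have h1 := h.integral_mono (h.left_bdd.smul hk) (h.bddNN τ f h.time_pos.le hf) fun x => by
    have := h.lower f hf x
    simp only [Pi.smul_apply, smul_eq_mul]
    linarith
  rw [integral_smul] at h1
  exact (mul_pos (mul_pos h.lower_pos hpos) h.pairing_pos).trans_le h1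

lemma iterate_succ (h : PFSystem μ P a b τ c C) (hf : BddNN f) (n : ℕ) :
    P (((n + 1 : ℕ) : ℝ) * τ) f = P τ (P (n * τ) f) := by
  have : ((n + 1 : ℕ) : ℝ) * τ = τ + n * τ := by push_cast; ring
  rw [this, h.semi _ _ _ h.time_pos.le (mul_nonneg n.cast_nonneg h.time_pos.le) hf]

lemma iterate_nonneg (h : PFSystem μ P a b τ c C) (n : ℕ) : 0 ≤ (n : ℝ) * τ :=
  mul_nonneg n.cast_nonneg h.time_pos.le

/-- The pairing of `P (n * τ) 1` with `b` is positive, also for `n = 0`, although `P 0` is not assumed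
to be the identity. -/
lemma integral_iterate_pos [IsFiniteMeasure μ] (h : PFSystem μ P a b τ c C) (n : ℕ) :
    0 < ∫ x, P (n * τ) 1 x * b x ∂μ := by
  induction n with
  | zero =>
    by_contra! hcon
    have h0 : (0:ℝ) ≤ ((0 : ℕ) : ℝ) * τ := h.iterate_nonneg 0
    have h1 := h.iterate_succ BddNN.one 0
    have h2 := h.integral_step_pos BddNN.one h.integral_one_pos
    have h3 : P τ (1 : X → ℝ) = P τ (P (((0 : ℕ) : ℝ) * τ) 1) := by
      rw [← h1]; simp
    have h4 : ∀ x, P τ (1 : X → ℝ) x ≤ 0 := fun x => by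
      rw [h3]
      refine (h.upper _ (h.bddNN _ _ h0 BddNN.one) x).trans ?_
      exact mul_nonpos_of_nonneg_of_nonpos (mul_nonneg h.upper_pos.le (h.left_pos x).le) hcon
    have h5 := h.integral_mono (h.bddNN τ 1 h.time_pos.le BddNN.one) (BddNN.const le_rfl) h4
    simp only [zero_mul, integral_zero] at h5
    linarith
  | succ n ih =>
    rw [h.iterate_succ BddNN.one]
    exact h.integral_step_pos (h.bddNN _ _ (h.iterate_nonneg n) BddNN.one) ih

lemma exists_one_pos [IsFiniteMeasure μ] (h : PFSystem μ P a b τ c C) (n : ℕ) :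
    ∃ x, 0 < P (n * τ) 1 x := by
  by_contra! hcon
  have h5 := h.integral_mono (h.bddNN _ 1 (h.iterate_nonneg n) BddNN.one) (BddNN.const le_rfl) hcon
  simp only [zero_mul, integral_zero] at h5
  linarith [h.integral_iterate_pos n]

/-- One step of the contraction of the oscillation of the ratio `f / g`. -/
lemma oscillation_step [IsFiniteMeasure μ] (h : PFSystem μ P a b τ c C) (hf : BddNN f)
    (hg : BddNN g) (hpos : 0 < ∫ x, g x * b x ∂μ) {A B : ℝ} (hA : 0 ≤ A) (hAB : A ≤ B)
    (h1 : ∀ x, A * g x ≤ f x) (h2 : ∀ x, f x ≤ B * g x) :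
    ∃ A' B', 0 ≤ A' ∧ A' ≤ B' ∧ B' - A' = (1 - c / C) * (B - A) ∧
      (∀ x, A' * P τ g x ≤ P τ f x) ∧ ∀ x, P τ f x ≤ B' * P τ g x := by
  have hC := h.upper_pos
  have hc := h.lower_pos
  have hτ := h.time_pos.le
  set m := ∫ x, g x * b x ∂μ with hm
  set k := ∫ x, f x * b x ∂μ with hk
  set δ := c / C with hδ
  have hδ0 : 0 ≤ δ := by positivity
  have hδ1 : δ ≤ 1 := by
    rw [hδ, div_le_one hC]; linarith [h.two_mul_le]
  have hk0 : 0 ≤ k := h.integral_nonneg hf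
  have hq : 0 ≤ k / m := by positivity
  have hB : 0 ≤ B := hA.trans hAB
  have key : ∀ u : X → ℝ, BddNN u → ∀ x,
      δ * ((∫ y, u y * b y ∂μ) / m) * P τ g x ≤ P τ u x := by
    intro u hu x
    have hu0 := h.integral_nonneg hu
    refine le_trans ?_ (h.lower u hu x)
    have h3 := mul_le_mul_of_nonneg_left (h.upper g hg x)
      (show 0 ≤ δ * ((∫ y, u y * b y ∂μ) / m) by positivity)
    refine h3.trans (le_of_eq ?_)
    rw [← hm, hδ]
    field_simp
  refine ⟨A + δ * (k / m - A), B - δ * (B - k / m), by nlinarith, by nlinarith, by ring, ?_, ?_⟩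
  · intro x
    have hAg := hg.smul hA
    have hle : ∀ x, (A • g) x ≤ f x := fun x => by simpa using h1 x
    have hu := hf.sub hAg hle
    have h4 := h.add τ _ _ hτ hAg hu
    have h5 := h.integral_add hAg hu
    rw [add_sub_cancel] at h4 h5
    rw [integral_smul, ← hm, ← hk] at h5
    rw [h.smul τ A g hτ hA hg] at h4
    have h6 := key _ hu x
    have h7 : (∫ y, (f - A • g) y * b y ∂μ) / m = k / m - A := by
      rw [h5]; field_simp; ring
    rw [h7] at h6
    rw [h4]
    simp only [Pi.add_apply, Pi.smul_apply, smul_eq_mul]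
    linarith
  · intro x
    have hBg := hg.smul hB
    have hle : ∀ x, f x ≤ (B • g) x := fun x => by simpa using h2 x
    have hu := hBg.sub hf hle
    have h4 := h.add τ _ _ hτ hf hu
    have h5 := h.integral_add hf hu
    rw [add_sub_cancel] at h4 h5
    rw [integral_smul, ← hm, ← hk] at h5
    rw [h.smul τ B g hτ hB hg] at h4
    have h6 := key _ hu x
    have h7 : (∫ y, (B • g - f) y * b y ∂μ) / m = B - k / m := by
      field_simp; linarith
    rw [h7] at h6
    have h8 := congrFun h4 x
    simp only [Pi.add_apply, Pi.smul_apply, smul_eq_mul] at h8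
    linarith

lemma oscillation_iterate [IsFiniteMeasure μ] (h : PFSystem μ P a b τ c C) (hf : BddNN f)
    {M : ℝ} (hM0 : 0 ≤ M) (hM : ∀ x, f x ≤ M) (n : ℕ) :
    ∃ A B, 0 ≤ A ∧ A ≤ B ∧ B - A = M * (1 - c / C) ^ n ∧ ∀ t, n * τ ≤ t → ∀ x,
      A * P t 1 x ≤ P t f x ∧ P t f x ≤ B * P t 1 x := by
  have base : ∃ A B, 0 ≤ A ∧ A ≤ B ∧ B - A = M * (1 - c / C) ^ n ∧ ∀ x,
      A * P (n * τ) 1 x ≤ P (n * τ) f x ∧ P (n * τ) f x ≤ B * P (n * τ) 1 x := by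
    induction n with
    | zero =>
      refine ⟨0, M, le_rfl, hM0, by simp, fun x => ⟨?_, ?_⟩⟩
      · rw [zero_mul]
        exact (h.bddNN _ _ (h.iterate_nonneg 0) hf).nonneg x
      · have h1 := h.mono (h.iterate_nonneg 0) hf (BddNN.one.smul hM0)
          (fun x => by simpa using hM x) x
        rwa [h.smul _ _ _ (h.iterate_nonneg 0) hM0 BddNN.one] at h1
    | succ n ih =>
      obtain ⟨A, B, hA, hAB, hd, hle⟩ := ih
      obtain ⟨A', B', hA', hAB', hd', h1, h2⟩ := h.oscillation_step
        (h.bddNN _ _ (h.iterate_nonneg n) hf) (h.bddNN _ _ (h.iterate_nonneg n) BddNN.one)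
        (h.integral_iterate_pos n) hA hAB (fun x => (hle x).1) fun x => (hle x).2
      refine ⟨A', B', hA', hAB', by rw [hd', hd]; ring, fun x => ?_⟩
      rw [h.iterate_succ hf, h.iterate_succ BddNN.one]
      exact ⟨h1 x, h2 x⟩
  obtain ⟨A, B, hA, hAB, hd, hle⟩ := base
  refine ⟨A, B, hA, hAB, hd, fun t ht x => ?_⟩
  have hs : 0 ≤ t - n * τ := by linarith
  have hn := h.iterate_nonneg n
  have h1 : ∀ u : X → ℝ, BddNN u → P t u = P (t - n * τ) (P (n * τ) u) := fun u hu => by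
    rw [← h.semi _ _ _ hs hn hu, sub_add_cancel]
  have hf' := h.bddNN _ _ hn hf
  have h1' := h.bddNN _ _ hn BddNN.one
  rw [h1 f hf, h1 1 BddNN.one]
  constructor
  · have h2 := h.mono hs (h1'.smul hA) hf' (fun x => by simpa using (hle x).1) x
    rwa [h.smul _ _ _ hs hA h1'] at h2
  · have h2 := h.mono hs hf' (h1'.smul (hA.trans hAB)) (fun x => by simpa using (hle x).2) x
    rwa [h.smul _ _ _ hs (hA.trans hAB) h1'] at h2

/-- The ratio `P t f / P t 1` converges uniformly at a geometric rate. -/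
lemma exists_geometric_limit [IsFiniteMeasure μ] (h : PFSystem μ P a b τ c C) (hf : BddNN f)
    {M : ℝ} (hM0 : 0 ≤ M) (hM : ∀ x, f x ≤ M) :
    ∃ l, ∀ (n : ℕ) t, n * τ ≤ t → ∀ x,
      |P t f x - l * P t 1 x| ≤ M * (1 - c / C) ^ n * P t 1 x := by
  choose A B hA hAB hd hle using h.oscillation_iterate hf hM0 hM
  have hcross : ∀ n k, A n ≤ B k := by
    intro n k
    obtain ⟨x, hx⟩ := h.exists_one_pos (max n k)
    have h1 := (hle n ((max n k : ℕ) * τ) (mul_le_mul_of_nonneg_right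
      (by exact_mod_cast le_max_left n k) h.time_pos.le) x).1
    have h2 := (hle k ((max n k : ℕ) * τ) (mul_le_mul_of_nonneg_right
      (by exact_mod_cast le_max_right n k) h.time_pos.le) x).2
    exact le_of_mul_le_mul_right (h1.trans h2) hx
  refine ⟨⨆ n, A n, fun n t ht x => ?_⟩
  have h1 : A n ≤ ⨆ n, A n := le_ciSup ⟨B 0, by rintro _ ⟨k, rfl⟩; exact hcross k 0⟩ n
  have h2 : (⨆ n, A n) ≤ B n := ciSup_le fun k => hcross k n
  have h0 := h.one_nonneg ((h.iterate_nonneg n).trans ht) x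
  obtain ⟨h3, h4⟩ := hle n t ht x
  have h5 := mul_le_mul_of_nonneg_right h1 h0
  have h6 := mul_le_mul_of_nonneg_right h2 h0
  rw [← hd n, sub_mul, abs_le]
  constructor <;> linarith

lemma ratio_mem (h : PFSystem μ P a b τ c C) : 1 / 2 ≤ 1 - c / C ∧ 1 - c / C < 1 := by
  have h1 : c / C ≤ 1 / 2 := by
    rw [div_le_iff₀ h.upper_pos]; linarith [h.two_mul_le]
  have h2 : 0 < c / C := div_pos h.lower_pos h.upper_pos
  constructor <;> linarith

lemma tendsto_ratio_pow (h : PFSystem μ P a b τ c C) :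
    Filter.Tendsto (fun n : ℕ => (1 - c / C) ^ n) Filter.atTop (nhds 0) :=
  tendsto_pow_atTop_nhds_zero_of_lt_one (by linarith [h.ratio_mem.1]) h.ratio_mem.2

lemma ratioLim_of_geometric (h : PFSystem μ P a b τ c C) {M l : ℝ}
    (hl : ∀ (n : ℕ) t, n * τ ≤ t → ∀ x, |P t f x - l * P t 1 x| ≤ M * (1 - c / C) ^ n * P t 1 x) :
    RatioLim P f l := by
  intro ε hε
  have h1 : Filter.Tendsto (fun n : ℕ => M * (1 - c / C) ^ n) Filter.atTop (nhds 0) := by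
    simpa using h.tendsto_ratio_pow.const_mul M
  obtain ⟨n, hn⟩ := (h1.eventually_le_const hε).exists
  exact ⟨n * τ, fun t ht x => (hl n t ht x).trans
    (mul_le_mul_of_nonneg_right hn (h.one_nonneg ((h.iterate_nonneg n).trans ht) x))⟩

lemma exists_time_pos [IsFiniteMeasure μ] (h : PFSystem μ P a b τ c C) (T : ℝ) :
    ∃ t ≥ T, 0 ≤ t ∧ ∃ x, 0 < P t 1 x := by
  obtain ⟨n, hn⟩ := exists_nat_ge (T / τ)
  rw [div_le_iff₀ h.time_pos] at hn
  exact ⟨n * τ, hn, h.iterate_nonneg n, h.exists_one_pos n⟩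

lemma le_of_ratioLim [IsFiniteMeasure μ] (h : PFSystem μ P a b τ c C) {l k s : ℝ}
    (hl : RatioLim P f l) (hk : ∀ t ≥ s, ∀ x, P t f x ≤ k * P t 1 x) : l ≤ k := by
  refine le_of_forall_pos_le_add fun ε hε => ?_
  obtain ⟨T, hT⟩ := hl ε hε
  obtain ⟨t, ht, -, x, hx⟩ := h.exists_time_pos (max T s)
  have h1 := (abs_le.1 (hT t ((le_max_left _ _).trans ht) x)).1
  have h2 := hk t ((le_max_right _ _).trans ht) x
  refine le_of_mul_le_mul_right ?_ hx
  linarith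

lemma ge_of_ratioLim [IsFiniteMeasure μ] (h : PFSystem μ P a b τ c C) {l k s : ℝ}
    (hl : RatioLim P f l) (hk : ∀ t ≥ s, ∀ x, k * P t 1 x ≤ P t f x) : k ≤ l := by
  refine le_of_forall_pos_le_add fun ε hε => ?_
  obtain ⟨T, hT⟩ := hl ε hε
  obtain ⟨t, ht, -, x, hx⟩ := h.exists_time_pos (max T s)
  have h1 := (abs_le.1 (hT t ((le_max_left _ _).trans ht) x)).2
  have h2 := hk t ((le_max_right _ _).trans ht) x
  refine le_of_mul_le_mul_right ?_ hx
  linarith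

lemma ratioLim_unique [IsFiniteMeasure μ] (h : PFSystem μ P a b τ c C) {l k : ℝ}
    (hl : RatioLim P f l) (hk : RatioLim P f k) : l = k := by
  have key : ∀ l k : ℝ, RatioLim P f l → RatioLim P f k → l ≤ k := fun l k hl hk =>
    le_of_forall_pos_le_add fun ε hε => by
      obtain ⟨T, hT⟩ := hk ε hε
      refine h.le_of_ratioLim (s := T) hl fun t ht x => ?_
      have := (abs_le.1 (hT t ht x)).2
      linarith
  exact le_antisymm (key l k hl hk) (key k l hk hl)

end PFSystem

namespace PFSystem

variable {X : Type*} [MeasurableSpace X] {μ : Measure X} {P : ℝ → (X → ℝ) → X → ℝ}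
  {a b : X → ℝ} {τ c C : ℝ} {f g : X → ℝ}

lemma exists_ratioLim [IsFiniteMeasure μ] (h : PFSystem μ P a b τ c C) (hf : BddNN f) :
    ∃ l, RatioLim P f l := by
  obtain ⟨M, hM0, hM⟩ := hf.exists_pos_bound
  obtain ⟨l, hl⟩ := h.exists_geometric_limit hf hM0.le hM
  exact ⟨l, h.ratioLim_of_geometric hl⟩

lemma geometric_of_ratioLim [IsFiniteMeasure μ] (h : PFSystem μ P a b τ c C) (hf : BddNN f)
    {l M : ℝ} (hl : RatioLim P f l) (hM0 : 0 ≤ M) (hM : ∀ x, f x ≤ M) (n : ℕ) {t : ℝ}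
    (ht : n * τ ≤ t) (x : X) : |P t f x - l * P t 1 x| ≤ M * (1 - c / C) ^ n * P t 1 x := by
  obtain ⟨k, hk⟩ := h.exists_geometric_limit hf hM0 hM
  rw [h.ratioLim_unique hl (h.ratioLim_of_geometric hk)]
  exact hk n t ht x

lemma ratioLim_add (h : PFSystem μ P a b τ c C) (hf : BddNN f) (hg : BddNN g) {l k : ℝ}
    (hl : RatioLim P f l) (hk : RatioLim P g k) : RatioLim P (f + g) (l + k) := by
  intro ε hε
  obtain ⟨T, hT⟩ := hl (ε / 2) (half_pos hε)
  obtain ⟨S, hS⟩ := hk (ε / 2) (half_pos hε)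
  refine ⟨max 0 (max T S), fun t ht x => ?_⟩
  have h0 : 0 ≤ t := (le_max_left _ _).trans ht
  have h1 := abs_le.1 (hT t ((le_max_left _ _).trans ((le_max_right _ _).trans ht)) x)
  have h2 := abs_le.1 (hS t ((le_max_right _ _).trans ((le_max_right _ _).trans ht)) x)
  rw [h.add t f g h0 hf hg, Pi.add_apply, abs_le]
  constructor <;> linarith [h1.1, h1.2, h2.1, h2.2]

lemma ratioLim_smul (h : PFSystem μ P a b τ c C) (hf : BddNN f) {l k : ℝ} (hk : 0 ≤ k)
    (hl : RatioLim P f l) : RatioLim P (k • f) (k * l) := by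
  intro ε hε
  obtain ⟨T, hT⟩ := hl (ε / (k + 1)) (by positivity)
  refine ⟨max 0 T, fun t ht x => ?_⟩
  have h0 : 0 ≤ t := (le_max_left _ _).trans ht
  have h1 := hT t ((le_max_right _ _).trans ht) x
  rw [h.smul t k f h0 hk hf, Pi.smul_apply, smul_eq_mul, mul_assoc, ← mul_sub, abs_mul,
    abs_of_nonneg hk]
  refine (mul_le_mul_of_nonneg_left h1 hk).trans ?_
  rw [← mul_assoc]
  refine mul_le_mul_of_nonneg_right ?_ (h.one_nonneg h0 x)
  rw [mul_div_assoc', div_le_iff₀ (by positivity)]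
  nlinarith

lemma ratioLim_apply (h : PFSystem μ P a b τ c C) (hf : BddNN f) {l k s : ℝ} (hs : 0 ≤ s)
    (hl : RatioLim P f l) (hk : RatioLim P (P s 1) k) : RatioLim P (P s f) (l * k) := by
  intro ε hε
  set η := ε / (1 + |k| + 1 + |l|) with hη
  have hη0 : 0 < η := by positivity
  obtain ⟨T, hT⟩ := hl (min η 1) (by positivity)
  obtain ⟨S, hS⟩ := hk (min η 1) (by positivity)
  refine ⟨max 0 (max T S), fun t ht x => ?_⟩
  have h0 : 0 ≤ t := (le_max_left _ _).trans ht
  have h1 := hT (t + s) (by linarith [(le_max_left T S).trans ((le_max_right 0 _).trans ht)]) x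
  have h2 := hS t ((le_max_right _ _).trans ((le_max_right _ _).trans ht)) x
  have h3 := h.one_nonneg h0 x
  have h4 := h.one_nonneg (add_nonneg h0 hs) x
  rw [h.semi t s f h0 hs hf] at h1
  rw [← h.semi t s 1 h0 hs BddNN.one] at h2
  have h5 : P (t + s) 1 x ≤ (|k| + 1) * P t 1 x := by
    have h6 := (abs_le.1 h2).2
    have h7 := mul_le_mul_of_nonneg_right (le_abs_self k) h3
    have h8 := mul_le_mul_of_nonneg_right (min_le_right η 1) h3
    linarith
  have h9 : P t (P s f) x - l * k * P t 1 x =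
      (P t (P s f) x - l * P (t + s) 1 x) + l * (P (t + s) 1 x - k * P t 1 x) := by ring
  rw [h9]
  refine (abs_add_le _ _).trans ?_
  rw [abs_mul]
  have h10 : min η 1 * P (t + s) 1 x ≤ η * ((|k| + 1) * P t 1 x) :=
    mul_le_mul (min_le_left _ _) h5 h4 hη0.le
  have h11 : |l| * |P (t + s) 1 x - k * P t 1 x| ≤ |l| * (η * P t 1 x) :=
    mul_le_mul_of_nonneg_left (h2.trans (mul_le_mul_of_nonneg_right (min_le_left _ _) h3))
      (abs_nonneg _)
  have h12 : η * (1 + |k| + 1 + |l|) = ε := by rw [hη]; field_simp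
  rw [← h12]
  have h13 : 0 ≤ η * P t 1 x := mul_nonneg hη0.le h3
  linarith

lemma compare_one (h : PFSystem μ P a b τ c C) {u : X → ℝ} (hu : BddNN u) {k s : ℝ}
    (hs : 0 ≤ s) (hk : 0 ≤ k) :
    ((∀ x, P s u x ≤ k * P s 1 x) → ∀ t ≥ s, ∀ x, P t u x ≤ k * P t 1 x) ∧
    ((∀ x, k * P s 1 x ≤ P s u x) → ∀ t ≥ s, ∀ x, k * P t 1 x ≤ P t u x) := by
  have h1 := h.bddNN s u hs hu
  have h2 := h.bddNN s 1 hs BddNN.one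
  have h3 : ∀ t ≥ s, ∀ v : X → ℝ, BddNN v → P t v = P (t - s) (P s v) := fun t ht v hv => by
    rw [← h.semi _ _ _ (sub_nonneg.2 ht) hs hv, sub_add_cancel]
  constructor <;> intro hle t ht x <;> rw [h3 t ht u hu, h3 t ht 1 BddNN.one]
  · have h4 := h.mono (sub_nonneg.2 ht) h1 (h2.smul hk) (fun x => by simpa using hle x) x
    rwa [h.smul _ _ _ (sub_nonneg.2 ht) hk h2] at h4
  · have h4 := h.mono (sub_nonneg.2 ht) (h2.smul hk) h1 (fun x => by simpa using hle x) x
    rwa [h.smul _ _ _ (sub_nonneg.2 ht) hk h2] at h4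

variable {ℓ : (X → ℝ) → ℝ}

/-- The limiting functional is comparable with integration against `b`. -/
lemma dominatedFunctional [IsFiniteMeasure μ] (h : PFSystem μ P a b τ c C)
    (hℓ : ∀ f, BddNN f → RatioLim P f (ℓ f)) :
    DominatedFunctional μ b (c / C / ∫ x, (1 : X → ℝ) x * b x ∂μ)
      (C / c / ∫ x, (1 : X → ℝ) x * b x ∂μ) ℓ := by
  have hm := h.integral_one_pos
  have hC := h.upper_pos
  have hc := h.lower_pos
  refine ⟨fun f g hf hg => h.ratioLim_unique (hℓ _ (hf.add hg))
    (h.ratioLim_add hf hg (hℓ f hf) (hℓ g hg)), fun k f hk hf => h.ratioLim_unique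
    (hℓ _ (hf.smul hk)) (h.ratioLim_smul hf hk (hℓ f hf)), fun f hf => ?_, fun f hf => ?_⟩
  · have hf0 := h.integral_nonneg hf
    refine h.ge_of_ratioLim (hℓ f hf)
      ((h.compare_one hf h.time_pos.le (by positivity)).2 fun x => ?_)
    refine le_trans ?_ (h.lower f hf x)
    refine (mul_le_mul_of_nonneg_left (h.upper 1 BddNN.one x) (by positivity)).trans (le_of_eq ?_)
    field_simp
  · have hf0 := h.integral_nonneg hf
    refine h.le_of_ratioLim (hℓ f hf)
      ((h.compare_one hf h.time_pos.le (by positivity)).1 fun x => ?_)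
    refine (h.upper f hf x).trans ?_
    refine le_trans (le_of_eq ?_)
      (mul_le_mul_of_nonneg_left (h.lower 1 BddNN.one x) (by positivity))
    field_simp

lemma exists_growth_rate [IsFiniteMeasure μ] (h : PFSystem μ P a b τ c C)
    (hℓ : ∀ f, BddNN f → RatioLim P f (ℓ f)) :
    ∃ lam : ℝ, ∀ s, 0 ≤ s → ℓ (P s 1) = Real.exp (lam * s) := by
  have hd := h.dominatedFunctional hℓ
  have hm := h.integral_one_pos
  have hC := h.upper_pos
  have hc := h.lower_pos
  obtain ⟨M, hM⟩ := h.locbdd τ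
  refine exists_eq_exp_of_mul (ρ := fun s => ℓ (P s 1))
    (K := C / c / (∫ x, (1 : X → ℝ) x * b x ∂μ) * (max M 0 * ∫ x, (1 : X → ℝ) x * b x ∂μ))
    h.time_pos (fun s hs => ?_) (fun s t hs ht => ?_) ?_ fun s hs => ?_
  · exact hd.nonneg (by positivity) h.right_bdd (h.bddNN s 1 hs BddNN.one)
  · rw [h.semi s t 1 hs ht BddNN.one, mul_comm]
    exact h.ratioLim_unique (hℓ _ (h.bddNN s _ hs (h.bddNN t 1 ht BddNN.one)))
      (h.ratioLim_apply (h.bddNN t 1 ht BddNN.one) hs (hℓ _ (h.bddNN t 1 ht BddNN.one))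
        (hℓ _ (h.bddNN s 1 hs BddNN.one)))
  · refine lt_of_lt_of_le ?_ (hd.lower _ (h.bddNN τ 1 h.time_pos.le BddNN.one))
    exact mul_pos (by positivity) (h.integral_step_pos BddNN.one h.integral_one_pos)
  · refine (hd.upper _ (h.bddNN s 1 hs.1 BddNN.one)).trans
      (mul_le_mul_of_nonneg_left ?_ (by positivity))
    have hM0 : ∀ x, P s 1 x ≤ (max M 0 • (1 : X → ℝ)) x := fun x => by
      simpa using Or.inl (hM s hs x)
    have h1 := h.integral_mono (h.bddNN s 1 hs.1 BddNN.one) (BddNN.one.smul (le_max_right M 0)) hM0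
    rwa [integral_smul] at h1

lemma exists_one_bounds [IsFiniteMeasure μ] (h : PFSystem μ P a b τ c C)
    (hℓ : ∀ f, BddNN f → RatioLim P f (ℓ f)) {lam : ℝ}
    (hlam : ∀ s, 0 ≤ s → ℓ (P s 1) = Real.exp (lam * s)) :
    ∃ c₁ C₁ : ℝ, 0 < c₁ ∧ 0 < C₁ ∧ (∀ t ≥ τ, ∀ x, c₁ * a x ≤ Real.exp (-(lam * t)) * P t 1 x) ∧
      ∀ t, 0 ≤ t → ∀ x, Real.exp (-(lam * t)) * P t 1 x ≤ C₁ := by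
  have hd := h.dominatedFunctional hℓ
  set m := ∫ x, (1 : X → ℝ) x * b x ∂μ with hmdef
  have hm : 0 < m := h.integral_one_pos
  have hC := h.upper_pos
  have hc := h.lower_pos
  obtain ⟨Ma, hMa0, hMa⟩ := h.left_bdd.exists_pos_bound
  obtain ⟨M, hM⟩ := h.locbdd τ
  have hsplit : ∀ t ≥ τ, P t 1 = P τ (P (t - τ) 1) := fun t ht => by
    rw [← h.semi _ _ _ h.time_pos.le (sub_nonneg.2 ht) BddNN.one, add_sub_cancel]
  have hexp : ∀ t, Real.exp (lam * (t - τ)) = Real.exp (lam * t) * Real.exp (-(lam * τ)) :=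
    fun t => by rw [← Real.exp_add]; ring_nf
  have hcancel : ∀ t, Real.exp (-(lam * t)) * Real.exp (lam * t) = 1 := fun t => by
    rw [← Real.exp_add, neg_add_cancel, Real.exp_zero]
  have hlow : ∀ t ≥ τ, c / C * m * Real.exp (lam * (t - τ)) ≤ ∫ x, P (t - τ) 1 x * b x ∂μ := by
    intro t ht
    have h1 := hd.upper _ (h.bddNN (t - τ) 1 (sub_nonneg.2 ht) BddNN.one)
    rw [hlam _ (sub_nonneg.2 ht)] at h1
    refine (mul_le_mul_of_nonneg_left h1 (by positivity)).trans (le_of_eq ?_)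
    field_simp
  have hup : ∀ t ≥ τ, ∫ x, P (t - τ) 1 x * b x ∂μ ≤ C / c * m * Real.exp (lam * (t - τ)) := by
    intro t ht
    have h1 := hd.lower _ (h.bddNN (t - τ) 1 (sub_nonneg.2 ht) BddNN.one)
    rw [hlam _ (sub_nonneg.2 ht)] at h1
    refine le_trans (le_of_eq ?_) (mul_le_mul_of_nonneg_left h1 (by positivity))
    field_simp
  refine ⟨c * (c / C) * m * Real.exp (-(lam * τ)), max (C * Ma * (C / c) * m * Real.exp (-(lam * τ)))
    (Real.exp (|lam| * τ) * max M 1), by positivity, by positivity, fun t ht x => ?_,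
    fun t ht x => ?_⟩
  · have h1 := (h.lower _ (h.bddNN (t - τ) 1 (sub_nonneg.2 ht) BddNN.one) x)
    rw [← hsplit t ht] at h1
    have h2 := mul_le_mul_of_nonneg_left (hlow t ht)
      (mul_nonneg hc.le (h.left_pos x).le)
    refine le_trans (le_of_eq ?_) (mul_le_mul_of_nonneg_left (h2.trans h1) (Real.exp_pos _).le)
    rw [hexp]
    calc _ = (Real.exp (-(lam * t)) * Real.exp (lam * t)) *
        (c * (c / C) * m * Real.exp (-(lam * τ)) * a x) := by rw [hcancel, one_mul]
      _ = _ := by ring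
  · rcases le_total τ t with htτ | htτ
    · refine le_trans ?_ (le_max_left _ _)
      have h1 := (h.upper _ (h.bddNN (t - τ) 1 (sub_nonneg.2 htτ) BddNN.one) x)
      rw [← hsplit t htτ] at h1
      have h2 := mul_le_mul (mul_le_mul_of_nonneg_left (hMa x) hC.le) (hup t htτ)
        (h.integral_nonneg (h.bddNN (t - τ) 1 (sub_nonneg.2 htτ) BddNN.one)) (by positivity)
      refine (mul_le_mul_of_nonneg_left (h1.trans h2) (Real.exp_pos _).le).trans (le_of_eq ?_)
      rw [hexp]
      calc _ = (Real.exp (-(lam * t)) * Real.exp (lam * t)) *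
          (C * Ma * (C / c) * m * Real.exp (-(lam * τ))) := by ring
        _ = _ := by rw [hcancel, one_mul]
    · refine le_trans ?_ (le_max_right _ _)
      refine mul_le_mul (Real.exp_le_exp.2 ?_) ((hM t ⟨ht, htτ⟩ x).trans (le_max_left _ _))
        (h.one_nonneg ht x) (Real.exp_pos _).le
      rw [← neg_mul]
      exact mul_le_mul (neg_le_abs lam) htτ ht (abs_nonneg _)

end PFSystem

namespace PFSystem

variable {X : Type*} [MeasurableSpace X] {μ : Measure X} {P : ℝ → (X → ℝ) → X → ℝ}
  {a b : X → ℝ} {τ c C : ℝ} {f g : X → ℝ} {ℓ : (X → ℝ) → ℝ} {lam : ℝ}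

/-- The rescaled mass `e^{-λt} P t 1` is Cauchy at a geometric rate. -/
lemma rescaled_cauchy [IsFiniteMeasure μ] (h : PFSystem μ P a b τ c C)
    (hℓ : ∀ f, BddNN f → RatioLim P f (ℓ f))
    (hlam : ∀ s, 0 ≤ s → ℓ (P s 1) = Real.exp (lam * s)) {C₁ : ℝ} (hC₁ : 0 < C₁)
    (hu : ∀ t, 0 ≤ t → ∀ x, Real.exp (-(lam * t)) * P t 1 x ≤ C₁) (n : ℕ) {t s : ℝ}
    (ht : n * τ ≤ t) (hs : 0 ≤ s) (x : X) :
    |Real.exp (-(lam * (t + s))) * P (t + s) 1 x - Real.exp (-(lam * t)) * P t 1 x| ≤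
      C₁ * (1 - c / C) ^ n * (Real.exp (-(lam * t)) * P t 1 x) := by
  have ht0 : 0 ≤ t := (h.iterate_nonneg n).trans ht
  have hM : ∀ x, P s 1 x ≤ C₁ * Real.exp (lam * s) := fun x => by
    have h1 := mul_le_mul_of_nonneg_left (hu s hs x) (Real.exp_pos (lam * s)).le
    rw [← mul_assoc, ← Real.exp_add, add_neg_cancel, Real.exp_zero, one_mul] at h1
    linarith
  have h1 := h.geometric_of_ratioLim (h.bddNN s 1 hs BddNN.one) (hℓ _ (h.bddNN s 1 hs BddNN.one))
    (by positivity) hM n ht x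
  rw [hlam s hs, ← h.semi t s 1 ht0 hs BddNN.one] at h1
  have h2 := mul_le_mul_of_nonneg_left h1 (Real.exp_pos (-(lam * (t + s)))).le
  have h3 : Real.exp (-(lam * (t + s))) * Real.exp (lam * s) = Real.exp (-(lam * t)) := by
    rw [← Real.exp_add]; ring_nf
  rw [← abs_of_pos (Real.exp_pos (-(lam * (t + s)))), ← abs_mul,
    abs_of_pos (Real.exp_pos (-(lam * (t + s)))), mul_sub, ← mul_assoc, h3] at h2
  refine h2.trans (le_of_eq ?_)
  rw [← h3]
  ring

lemma exists_eigenfunction [IsFiniteMeasure μ] (h : PFSystem μ P a b τ c C)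
    (hℓ : ∀ f, BddNN f → RatioLim P f (ℓ f))
    (hlam : ∀ s, 0 ≤ s → ℓ (P s 1) = Real.exp (lam * s)) :
    ∃ φ : X → ℝ, BddNN φ ∧ (∃ c₁, 0 < c₁ ∧ ∀ x, c₁ * a x ≤ φ x) ∧
      (∀ s, 0 ≤ s → ∀ x, P s φ x = Real.exp (lam * s) * φ x) ∧
      ∃ C₁, 0 < C₁ ∧ ∀ (n : ℕ) t, n * τ ≤ t → ∀ x,
        |φ x - Real.exp (-(lam * t)) * P t 1 x| ≤
          C₁ * (1 - c / C) ^ n * (Real.exp (-(lam * t)) * P t 1 x) := by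
  obtain ⟨c₁, C₁, hc₁, hC₁, hlow, hup⟩ := h.exists_one_bounds hℓ hlam
  set γ := 1 - c / C with hγ
  have hγ0 : 0 ≤ γ := by linarith [h.ratio_mem.1]
  set u : ℝ → X → ℝ := fun t x => Real.exp (-(lam * t)) * P t 1 x with hudef
  have hu0 : ∀ t, 0 ≤ t → ∀ x, 0 ≤ u t x := fun t ht x =>
    mul_nonneg (Real.exp_pos _).le (h.one_nonneg ht x)
  have hcau : ∀ (n : ℕ) t s, n * τ ≤ t → 0 ≤ s → ∀ x, |u (t + s) x - u t x| ≤ C₁ * γ ^ n * u t x :=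
    fun n t s ht hs x => h.rescaled_cauchy hℓ hlam hC₁ hup n ht hs x
  have hex : ∀ x, ∃ l, Filter.Tendsto (fun k : ℕ => u (k * τ) x) Filter.atTop (nhds l) := by
    intro x
    refine cauchySeq_tendsto_of_complete (cauchySeq_of_le_geometric γ (C₁ * C₁) h.ratio_mem.2
      fun n => ?_)
    have h1 := hcau n (n * τ) τ le_rfl h.time_pos.le x
    have h2 : (n : ℝ) * τ + τ = ((n + 1 : ℕ) : ℝ) * τ := by push_cast; ring
    rw [dist_comm, Real.dist_eq, ← h2]
    refine h1.trans ?_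
    have h3 := hup _ (h.iterate_nonneg n) x
    calc C₁ * γ ^ n * u (n * τ) x ≤ C₁ * γ ^ n * C₁ :=
          mul_le_mul_of_nonneg_left h3 (by positivity)
      _ = C₁ * C₁ * γ ^ n := by ring
  choose φ hφ using hex
  have hrate : ∀ (n : ℕ) t, n * τ ≤ t → ∀ x, |φ x - u t x| ≤ C₁ * γ ^ n * u t x := by
    intro n t ht x
    refine le_of_tendsto ((hφ x).sub_const (u t x)).abs ?_
    obtain ⟨k₀, hk₀⟩ := exists_nat_ge (t / τ)
    rw [div_le_iff₀ h.time_pos] at hk₀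
    filter_upwards [Filter.eventually_ge_atTop k₀] with k hk
    have h1 : t ≤ k * τ := hk₀.trans
      (mul_le_mul_of_nonneg_right (by exact_mod_cast hk) h.time_pos.le)
    have h2 := hcau n t (k * τ - t) ht (sub_nonneg.2 h1) x
    rwa [add_sub_cancel] at h2
  have hφ0 : ∀ x, c₁ * a x ≤ φ x := fun x => by
    refine ge_of_tendsto (hφ x) ?_
    filter_upwards [Filter.eventually_ge_atTop 1] with k hk
    refine hlow _ ?_ x
    have : (1:ℝ) ≤ k := by exact_mod_cast hk
    nlinarith [h.time_pos]
  have hφC : ∀ x, φ x ≤ C₁ := fun x =>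
    le_of_tendsto' (hφ x) fun k => hup _ (h.iterate_nonneg k) x
  have humeas : ∀ t, 0 ≤ t → BddNN (u t) := fun t ht =>
    (h.bddNN t 1 ht BddNN.one).smul (Real.exp_pos (-(lam * t))).le
  have hφb : BddNN φ := ⟨measurable_of_tendsto_metrizable
    (fun k : ℕ => (humeas _ (h.iterate_nonneg k)).meas) (tendsto_pi_nhds.2 hφ),
    fun x => (mul_nonneg hc₁.le (h.left_pos x).le).trans (hφ0 x), C₁, hφC⟩
  have hPu : ∀ s, 0 ≤ s → ∀ t, 0 ≤ t → ∀ x, P s (u t) x = Real.exp (lam * s) * u (s + t) x := by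
    intro s hs t ht x
    have h1 : u t = Real.exp (-(lam * t)) • P t 1 := rfl
    rw [h1, h.smul s _ _ hs (Real.exp_pos _).le (h.bddNN t 1 ht BddNN.one),
      ← h.semi s t 1 hs ht BddNN.one, Pi.smul_apply, smul_eq_mul]
    simp only [hudef]
    rw [← mul_assoc, ← Real.exp_add]
    ring_nf
  refine ⟨φ, hφb, ⟨c₁, hc₁, hφ0⟩, fun s hs x => ?_, C₁, hC₁, hrate⟩
  have hη : Filter.Tendsto (fun n : ℕ => C₁ * γ ^ n) Filter.atTop (nhds 0) := by
    simpa using h.tendsto_ratio_pow.const_mul C₁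
  have hlim : Filter.Tendsto (fun n : ℕ => Real.exp (lam * s) * u (s + n * τ) x) Filter.atTop
      (nhds (Real.exp (lam * s) * φ x)) := by
    refine Filter.Tendsto.const_mul _ ?_
    rw [tendsto_iff_dist_tendsto_zero]
    refine squeeze_zero (fun _ => dist_nonneg) (fun n => ?_)
      (by simpa using hη.mul_const C₁ : Filter.Tendsto (fun n : ℕ => C₁ * γ ^ n * C₁) _ (nhds 0))
    rw [dist_comm, Real.dist_eq]
    refine (hrate n _ (by linarith) x).trans ?_
    exact mul_le_mul_of_nonneg_left (hup _ (add_nonneg hs (h.iterate_nonneg n)) x) (by positivity)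
  refine le_antisymm ?_ ?_
  · have hlim' : Filter.Tendsto (fun n : ℕ => (1 + C₁ * γ ^ n) *
        (Real.exp (lam * s) * u (s + n * τ) x)) Filter.atTop (nhds (Real.exp (lam * s) * φ x)) := by
      simpa using (hη.const_add 1).mul hlim
    refine ge_of_tendsto' hlim' fun n => ?_
    have hk : 0 ≤ 1 + C₁ * γ ^ n := by positivity
    have hun := humeas _ (h.iterate_nonneg n)
    have h1 := h.mono hs hφb (hun.smul hk) (fun y => by
      have := (abs_le.1 (hrate n _ le_rfl y)).2
      simp only [Pi.smul_apply, smul_eq_mul]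
      linarith) x
    rwa [h.smul s _ _ hs hk hun, Pi.smul_apply, smul_eq_mul, hPu s hs _ (h.iterate_nonneg n)] at h1
  · have hlim' : Filter.Tendsto (fun n : ℕ => P s φ x + C₁ * γ ^ n *
        (Real.exp (lam * s) * u (s + n * τ) x)) Filter.atTop (nhds (P s φ x)) := by
      simpa using (hη.mul hlim).const_add (P s φ x)
    refine le_of_tendsto_of_tendsto' hlim hlim' fun n => ?_
    have hk : 0 ≤ C₁ * γ ^ n := by positivity
    have hun := humeas _ (h.iterate_nonneg n)
    have h1 := h.mono hs hun (hφb.add (hun.smul hk)) (fun y => by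
      have := (abs_le.1 (hrate n _ le_rfl y)).1
      simp only [Pi.add_apply, Pi.smul_apply, smul_eq_mul]
      linarith) x
    rwa [h.add s _ _ hs hφb (hun.smul hk), h.smul s _ _ hs hk hun, Pi.add_apply, Pi.smul_apply,
      smul_eq_mul, hPu s hs _ (h.iterate_nonneg n)] at h1

/-- Perron-Frobenius asymptotics of a positive semigroup with a two-sided rank-one bound. -/
theorem perronFrobenius [IsFiniteMeasure μ] (h : PFSystem μ P a b τ c C) :
    ∃ (lam : ℝ) (φ d : X → ℝ), BddNN φ ∧ BddNN d ∧ (∃ k, 0 < k ∧ ∀ x, k * a x ≤ φ x) ∧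
      (∃ k, 0 < k ∧ ∀ᵐ x ∂μ, k * b x ≤ d x) ∧
      (∀ t, 0 ≤ t → ∀ x, P t φ x = Real.exp (lam * t) * φ x) ∧
      (∀ g, BddNN g → ∀ t, 0 ≤ t →
        ∫ x, d x * P t g x ∂μ = Real.exp (lam * t) * ∫ x, d x * g x ∂μ) ∧
      ∃ ε, 0 < ε ∧ ∃ K, 0 < K ∧ ∃ T, 0 < T ∧ ∀ t, T ≤ t → ∀ g, BddNN g → (∀ x, g x ≤ 1) → ∀ x,
        |Real.exp (-(lam * t)) * P t g x / φ x - ∫ y, d y * g y ∂μ| ≤ K * Real.exp (-(ε * t)) := by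
  choose! ℓ hℓ using fun f (hf : BddNN f) => h.exists_ratioLim hf
  have hm := h.integral_one_pos
  have hC := h.upper_pos
  have hc := h.lower_pos
  obtain ⟨lam, hlam⟩ := h.exists_growth_rate hℓ
  obtain ⟨φ, hφ, ⟨c₁, hc₁, hφa⟩, heig, C₁, hC₁, hrate⟩ := h.exists_eigenfunction hℓ hlam
  obtain ⟨d, hd, hdb, hdℓ⟩ := (h.dominatedFunctional hℓ).exists_density (by positivity)
    (by positivity) h.right_bdd
  have hφpos : ∀ x, 0 < φ x := fun x => (mul_pos hc₁ (h.left_pos x)).trans_le (hφa x)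
  set γ := 1 - c / C with hγ
  have hγ0 : 0 < γ := by linarith [h.ratio_mem.1]
  have hγ1 : γ < 1 := h.ratio_mem.2
  refine ⟨lam, φ, d, hφ, hd, ⟨c₁, hc₁, hφa⟩, ⟨_, by positivity, hdb⟩, heig, fun g hg t ht => ?_, ?_⟩
  · rw [hdℓ _ (h.bddNN t g ht hg), hdℓ _ hg, ← hlam t ht, mul_comm]
    exact h.ratioLim_unique (hℓ _ (h.bddNN t g ht hg))
      (h.ratioLim_apply hg ht (hℓ g hg) (hℓ _ (h.bddNN t 1 ht BddNN.one)))
  · have hη : Filter.Tendsto (fun n : ℕ => C₁ * γ ^ n) Filter.atTop (nhds 0) := by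
      simpa using h.tendsto_ratio_pow.const_mul C₁
    obtain ⟨n₀, hn₀⟩ := (hη.eventually_le_const (half_pos one_pos)).exists
    have hε : 0 < -Real.log γ / τ :=
      div_pos (neg_pos.2 (Real.log_neg hγ0 hγ1)) h.time_pos
    refine ⟨-Real.log γ / τ, hε, 2 * (1 + C₁) * γ⁻¹, by positivity, n₀ * τ + τ,
      add_pos_of_nonneg_of_pos (h.iterate_nonneg n₀) h.time_pos, fun t ht g hg hg1 x => ?_⟩
    rw [hdℓ g hg]
    have ht0 : 0 ≤ t := by linarith [h.iterate_nonneg n₀, h.time_pos]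
    have hτ := h.time_pos
    set n := ⌊t / τ⌋₊ with hn
    have hfl : (n : ℝ) * τ ≤ t := by
      rw [← le_div_iff₀ hτ]; exact Nat.floor_le (by positivity)
    have hfl2 : t / τ < (n : ℝ) + 1 := Nat.lt_floor_add_one _
    have hpow : γ ^ n ≤ γ⁻¹ * Real.exp (-(-Real.log γ / τ * t)) := by
      have h1 : γ ^ n = γ⁻¹ * Real.exp (Real.log γ * (n + 1)) := by
        rw [mul_add, mul_one, Real.exp_add, Real.exp_log hγ0, mul_comm (Real.log γ),
          Real.exp_nat_mul, Real.exp_log hγ0]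
        field_simp
      rw [h1]
      refine mul_le_mul_of_nonneg_left (Real.exp_le_exp.2 ?_) (by positivity)
      have h2 : -(-Real.log γ / τ * t) = Real.log γ * (t / τ) := by ring
      rw [h2]
      exact mul_le_mul_of_nonpos_left hfl2.le (Real.log_neg hγ0 hγ1).le
    set u := Real.exp (-(lam * t)) * P t 1 x with hu
    have hu0 : 0 ≤ u := mul_nonneg (Real.exp_pos _).le (h.one_nonneg ht0 x)
    have hℓ0 : 0 ≤ ℓ g := (h.dominatedFunctional hℓ).nonneg (by positivity) h.right_bdd hg
    have hℓ1 : ℓ g ≤ 1 := h.le_of_ratioLim (s := 0) (hℓ g hg) fun t ht x => by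
      rw [one_mul]
      exact h.mono ht hg BddNN.one hg1 x
    have h1 : |Real.exp (-(lam * t)) * P t g x - ℓ g * u| ≤ γ ^ n * u := by
      have h2 := mul_le_mul_of_nonneg_left
        (h.geometric_of_ratioLim hg (hℓ g hg) zero_le_one hg1 n hfl x)
        (Real.exp_pos (-(lam * t))).le
      have h3 : Real.exp (-(lam * t)) * P t g x - ℓ g * u =
          Real.exp (-(lam * t)) * (P t g x - ℓ g * P t 1 x) := by rw [hu]; ring
      rw [h3, abs_mul, abs_of_pos (Real.exp_pos _)]
      refine h2.trans (le_of_eq ?_)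
      rw [hu]; ring
    have h2 : |φ x - u| ≤ C₁ * γ ^ n * u := hrate n t hfl x
    have h3 : |φ x - u| ≤ C₁ * γ ^ n₀ * u := hrate n₀ t (by linarith) x
    have h4 : u ≤ 2 * φ x := by
      have := (abs_le.1 h3).1
      have h5 := mul_le_mul_of_nonneg_right hn₀ hu0
      linarith
    have h5 : |Real.exp (-(lam * t)) * P t g x - ℓ g * φ x| ≤ (1 + C₁) * γ ^ n * u := by
      have h6 : Real.exp (-(lam * t)) * P t g x - ℓ g * φ x =
        (Real.exp (-(lam * t)) * P t g x - ℓ g * u) - ℓ g * (φ x - u) := by ring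
      rw [h6]
      refine (abs_sub _ _).trans ?_
      rw [abs_mul, abs_of_nonneg hℓ0]
      have h7 := mul_le_mul hℓ1 h2 (abs_nonneg _) zero_le_one
      linarith
    have h6 : Real.exp (-(lam * t)) * P t g x / φ x - ℓ g =
        (Real.exp (-(lam * t)) * P t g x - ℓ g * φ x) / φ x := by
      field_simp [(hφpos x).ne']
    rw [h6, abs_div, abs_of_pos (hφpos x), div_le_iff₀ (hφpos x)]
    refine h5.trans ?_
    calc (1 + C₁) * γ ^ n * u ≤ (1 + C₁) * (γ⁻¹ * Real.exp (-(-Real.log γ / τ * t))) * (2 * φ x) :=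
          mul_le_mul (mul_le_mul_of_nonneg_left hpow (by positivity)) h4 hu0 (by positivity)
      _ = _ := by ring

end PFSystem

/-- Flight times are bounded away from zero on compact subsets of phase space. -/
lemma exists_le_flightTime {D : Set Pt} (hD : IsOpen D) {vmin vmax : ℝ} (hv : 0 < vmax)
    {K : Set (Pt × Pt)} (hK : IsCompact K) (hKE : K ⊆ D ×ˢ Vel vmin vmax) :
    ∃ k : ℝ, 0 < k ∧ ∀ q ∈ K, ENNReal.ofReal k ≤ fwdTime D q.1 q.2 ∧
      ENNReal.ofReal k ≤ bwdTime D q.1 q.2 := by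
  obtain ⟨δ, hδ, hsub⟩ := (hK.image continuous_fst).exists_thickening_subset_open hD
    (by rintro _ ⟨q, hq, rfl⟩; exact (hKE hq).1)
  refine ⟨δ / vmax, by positivity, fun q hq => ?_⟩
  have hmem : ∀ s ∈ Ioo 0 (δ / vmax), ∀ w : Pt, ‖w‖ = ‖s • q.2‖ → q.1 + w ∈ D := by
    intro s hs w hw
    refine hsub (Metric.mem_thickening_iff.2 ⟨q.1, ⟨q, hq, rfl⟩, ?_⟩)
    rw [dist_eq_norm, add_sub_cancel_left, hw, norm_smul, Real.norm_eq_abs, abs_of_pos hs.1]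
    refine (mul_le_mul_of_nonneg_left (hKE hq).2.2 hs.1.le).trans_lt ?_
    exact (lt_div_iff₀ hv).1 hs.2
  have key : ∀ w : ℝ → Pt, (∀ s, ‖w s‖ = ‖s • q.2‖) →
      ENNReal.ofReal (δ / vmax) ≤ ∫⁻ s in Ioi (0 : ℝ), D.indicator 1 (q.1 + w s) := by
    intro w hw
    calc ENNReal.ofReal (δ / vmax) = ∫⁻ _ in Ioo 0 (δ / vmax), 1 := by simp
      _ ≤ ∫⁻ s in Ioo 0 (δ / vmax), D.indicator 1 (q.1 + w s) :=
          setLIntegral_mono' measurableSet_Ioo fun s hs => by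
            rw [indicator_of_mem (hmem s hs _ (hw s))]; rfl
      _ ≤ _ := lintegral_mono_set Ioo_subset_Ioi_self
  refine ⟨key (fun s => s • q.2) fun _ => rfl, ?_⟩
  have := key (fun s => -(s • q.2)) fun s => norm_neg _
  simpa only [bwdTime, ← sub_eq_add_neg] using this

/-- Flight times are uniformly bounded on phase space. -/
lemma exists_flightTime_le {D : Set Pt} (hD : Bornology.IsBounded D) {vmin vmax : ℝ}
    (hv : 0 < vmin) :
    ∃ T : ℝ, 0 < T ∧ ∀ q ∈ D ×ˢ Vel vmin vmax, fwdTime D q.1 q.2 ≤ ENNReal.ofReal T ∧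
      bwdTime D q.1 q.2 ≤ ENNReal.ofReal T := by
  obtain ⟨T, hT0, hT⟩ := bounded_flight (vmax := vmax) hD hv
  refine ⟨T, hT0, fun q hq => ?_⟩
  have key : ∀ υ ∈ Vel vmin vmax, fwdTime D q.1 υ ≤ ENNReal.ofReal T := by
    intro υ hυ
    calc fwdTime D q.1 υ ≤ ∫⁻ s in Ioi (0 : ℝ), (Ioo 0 T).indicator 1 s := by
          refine setLIntegral_mono' measurableSet_Ioi fun s hs => ?_
          by_cases hsT : s < T
          · rw [indicator_of_mem (show s ∈ Ioo 0 T from ⟨hs, hsT⟩)]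
            exact indicator_le_self' (fun _ _ => zero_le) _
          · rw [indicator_of_notMem (hT q.1 hq.1 υ hυ s (not_lt.1 hsT))]
            exact zero_le
      _ ≤ ∫⁻ s, (Ioo 0 T).indicator 1 s := setLIntegral_le_lintegral _ _
      _ = ENNReal.ofReal T := by
          rw [lintegral_indicator_one measurableSet_Ioo]; simp
  refine ⟨key q.2 hq.2, ?_⟩
  have hneg : -q.2 ∈ Vel vmin vmax := by
    have := hq.2
    simpa [Vel] using this
  have := key _ hneg
  simpa only [fwdTime, bwdTime, smul_neg, ← sub_eq_add_neg] using this

/-- Extension by zero of a function on phase space. -/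
def phaseExt {E : Set (Pt × Pt)} (f : E → ℝ) (r υ : Pt) : ℝ :=
  Function.extend Subtype.val f 0 (r, υ)

section PhaseExt

variable {E : Set (Pt × Pt)} {f : E → ℝ}

lemma phaseExt_of_mem {r υ : Pt} (h : (r, υ) ∈ E) : phaseExt f r υ = f ⟨(r, υ), h⟩ :=
  Subtype.val_injective.extend_apply f 0 ⟨(r, υ), h⟩

lemma phaseExt_coe (x : E) : phaseExt f x.1.1 x.1.2 = f x :=
  Subtype.val_injective.extend_apply f 0 x

lemma phaseExt_of_notMem {r υ : Pt} (h : (r, υ) ∉ E) : phaseExt f r υ = 0 :=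
  Function.extend_apply' _ _ _ (by rintro ⟨x, hx⟩; exact h (hx ▸ x.2))

lemma BddNN.bddMeasNN_phaseExt (hE : MeasurableSet E) (hf : BddNN f) :
    BddMeasNN (phaseExt f) := by
  obtain ⟨M, hM0, hM⟩ := hf.exists_pos_bound
  refine ⟨(MeasurableEmbedding.subtype_coe hE).measurable_extend hf.meas measurable_const,
    fun r υ => ?_, M, fun r υ => ?_⟩
  · by_cases h : (r, υ) ∈ E
    · rw [phaseExt_of_mem h]; exact hf.nonneg _
    · rw [phaseExt_of_notMem h]
  · by_cases h : (r, υ) ∈ E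
    · rw [phaseExt_of_mem h]; exact hM _
    · rw [phaseExt_of_notMem h]; exact hM0.le

lemma BddMeasNN.restrict {g : Pt → Pt → ℝ} (hg : BddMeasNN g) :
    BddNN fun x : E => g x.1.1 x.1.2 :=
  ⟨hg.1.comp measurable_subtype_coe, fun _ => hg.2.1 _ _, hg.2.2.imp fun _ hM _ => hM _ _⟩

end PhaseExt

lemma integral_comap_phase {E : Set (Pt × Pt)} (hE : MeasurableSet E) (F : Pt × Pt → ℝ) :
    ∫ x : E, F x ∂(volume.comap Subtype.val) = ∫ q in E, F q :=
  integral_subtype_comap hE F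

lemma isFiniteMeasure_comap_phase {D : Set Pt} (hD : Bornology.IsBounded D)
    (hDm : MeasurableSet D) (vmin vmax : ℝ) :
    IsFiniteMeasure (volume.comap (Subtype.val : ↥(D ×ˢ Vel vmin vmax) → Pt × Pt)) := by
  refine ⟨?_⟩
  rw [comap_subtype_coe_apply (hDm.prod (measurableSet_Vel _ _)), image_univ, Subtype.range_coe,
    Measure.volume_eq_prod, Measure.prod_prod]
  exact ENNReal.mul_lt_top hD.measure_lt_top (volume_Vel_lt_top _ _)

lemma flightMass_phaseExt {D : Set Pt} (hD : Bornology.IsBounded D) (hDm : MeasurableSet D)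
    {vmin vmax : ℝ} (hv : 0 < vmin) {f : ↥(D ×ˢ Vel vmin vmax) → ℝ} (hf : BddNN f)
    (hb : BddNN fun x : ↥(D ×ˢ Vel vmin vmax) => (bwdTime D x.1.1 x.1.2).toReal) :
    flightMass D (Vel vmin vmax) (fun r υ => (D ×ˢ Vel vmin vmax).indicator
      (fun q => ENNReal.ofReal (phaseExt f q.1 q.2)) (r, υ)) =
    ENNReal.ofReal (∫ x, f x * (bwdTime D x.1.1 x.1.2).toReal
      ∂(volume.comap (Subtype.val : ↥(D ×ˢ Vel vmin vmax) → Pt × Pt))) := by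
  have hfin := isFiniteMeasure_comap_phase hD hDm vmin vmax
  have hE : MeasurableSet (D ×ˢ Vel vmin vmax) := hDm.prod (measurableSet_Vel _ _)
  obtain ⟨T, hT0, hT⟩ := exists_flightTime_le (vmax := vmax) hD hv
  have hgm : Measurable fun q : Pt × Pt => (D ×ˢ Vel vmin vmax).indicator
      (fun q => ENNReal.ofReal (phaseExt f q.1 q.2)) q :=
    (ENNReal.measurable_ofReal.comp (hf.bddMeasNN_phaseExt hE).1).indicator hE
  rw [ofReal_integral_eq_lintegral_ofReal ((hf.mul hb).integrable _)
    (ae_of_all _ (hf.mul hb).nonneg), flightMass,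
    ← lintegral_prod (μ := volume) (ν := volume.restrict (Vel vmin vmax))
      (fun q : Pt × Pt => (D ×ˢ Vel vmin vmax).indicator
      (fun q => ENNReal.ofReal (phaseExt f q.1 q.2)) q * bwdTime D q.1 q.2)
      (hgm.mul (measurable_bwdTime hDm)).aemeasurable]
  have h1 : (volume : Measure Pt).prod (volume.restrict (Vel vmin vmax)) =
      (volume : Measure (Pt × Pt)).restrict (univ ×ˢ Vel vmin vmax) := by
    rw [Measure.volume_eq_prod, ← Measure.prod_restrict, Measure.restrict_univ]
  rw [h1]
  have h2 : ∫⁻ x : ↥(D ×ˢ Vel vmin vmax), ENNReal.ofReal (f x * (bwdTime D x.1.1 x.1.2).toReal)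
      ∂(volume.comap Subtype.val) = ∫⁻ x : ↥(D ×ˢ Vel vmin vmax),
      (fun q : Pt × Pt => ENNReal.ofReal (phaseExt f q.1 q.2) * bwdTime D q.1 q.2) x
      ∂(volume.comap Subtype.val) := by
    refine lintegral_congr fun x => ?_
    rw [ENNReal.ofReal_mul (hf.nonneg x), ENNReal.ofReal_toReal
      (ne_top_of_le_ne_top ENNReal.ofReal_ne_top (hT x.1 x.2).2)]
    simp only [phaseExt_coe]
  rw [h2, lintegral_subtype_comap hE
    (fun q : Pt × Pt => ENNReal.ofReal (phaseExt f q.1 q.2) * bwdTime D q.1 q.2), ← lintegral_indicator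
    (MeasurableSet.univ.prod (measurableSet_Vel _ _)), ← lintegral_indicator hE]
  refine lintegral_congr fun q => ?_
  by_cases hq : q ∈ D ×ˢ Vel vmin vmax
  · rw [indicator_of_mem (show q ∈ univ ×ˢ Vel vmin vmax from ⟨mem_univ _, hq.2⟩),
      indicator_of_mem hq, indicator_of_mem hq]
  · rw [indicator_of_notMem hq]
    by_cases hq' : q ∈ univ ×ˢ Vel vmin vmax
    · rw [indicator_of_mem hq', indicator_of_notMem hq, zero_mul]
    · rw [indicator_of_notMem hq']

lemma volume_phase_pos {D : Set Pt} (hD : IsOpen D) (hne : D.Nonempty) {vmin vmax : ℝ}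
    (hv : 0 < vmin) (hvv : vmin < vmax) :
    0 < (volume : Measure (Pt × Pt)) (D ×ˢ Vel vmin vmax) := by
  have hO : IsOpen {υ : Pt | vmin < ‖υ‖ ∧ ‖υ‖ < vmax} :=
    (isOpen_lt continuous_const continuous_norm).inter (isOpen_lt continuous_norm continuous_const)
  obtain ⟨υ, hυ⟩ := exists_norm_eq Pt (show 0 ≤ (vmin + vmax) / 2 by linarith)
  have h2 := hO.measure_pos volume ⟨υ, show vmin < ‖υ‖ ∧ ‖υ‖ < vmax by
    rw [hυ]; constructor <;> linarith⟩
  rw [Measure.volume_eq_prod, Measure.prod_prod]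
  have hsub : {υ : Pt | vmin < ‖υ‖ ∧ ‖υ‖ < vmax} ⊆ Vel vmin vmax :=
    fun υ hυ => ⟨hυ.1.le, hυ.2.le⟩
  have hV := (h2.trans_le (measure_mono hsub)).ne'
  exact ENNReal.mul_pos (hD.measure_pos volume hne).ne' hV

/-- The transport semigroup acting on functions on phase space. -/
def phaseSemigroup {E : Set (Pt × Pt)} (Ψ : (Pt → Pt → ℝ) → ℝ → Pt → Pt → ℝ) (t : ℝ)
    (f : E → ℝ) (x : E) : ℝ :=
  Ψ (phaseExt f) t x.1.1 x.1.2

section Semigroup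

variable {D : Set Pt} {vmin vmax : ℝ} {σs σf : Pt → Pt → ℝ} {πs πf : Pt → Pt → Pt → ℝ}
  {Ψ : (Pt → Pt → ℝ) → ℝ → Pt → Pt → ℝ}

lemma NTEContext.charSol_phaseExt (ctx : NTEContext D vmin vmax σs σf πs πf)
    (hΨ : ∀ h : Pt → Pt → ℝ, BddMeasNN h →
      IsMildSolution D (Vel vmin vmax) σs σf πs πf h (Ψ h) ∧ TimeLocBounded (Ψ h))
    {f : ↥(D ×ˢ Vel vmin vmax) → ℝ} (hf : BddNN f) :
    CharSol D (Vel vmin vmax) σs σf πs πf (phaseExt f) (posTime (Ψ (phaseExt f))) :=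
  have h := hΨ _ (hf.bddMeasNN_phaseExt ctx.measurableSet_phase)
  ctx.charSol h.1 h.2

lemma posTime_of_nonneg {ψ : ℝ → Pt → Pt → ℝ} {t : ℝ} (ht : 0 ≤ t) : posTime ψ t = ψ t := by
  ext r υ
  rw [posTime, if_pos ht]

/-- Solutions depend only on the restriction of the initial datum to phase space. -/
lemma NTEContext.eq_phaseSemigroup (ctx : NTEContext D vmin vmax σs σf πs πf)
    (hΨ : ∀ h : Pt → Pt → ℝ, BddMeasNN h →
      IsMildSolution D (Vel vmin vmax) σs σf πs πf h (Ψ h) ∧ TimeLocBounded (Ψ h))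
    {g : Pt → Pt → ℝ} (hg : BddMeasNN g) {t : ℝ} (ht : 0 ≤ t) (x : ↥(D ×ˢ Vel vmin vmax)) :
    Ψ g t x.1.1 x.1.2 = phaseSemigroup Ψ t (fun y : ↥(D ×ˢ Vel vmin vmax) => g y.1.1 y.1.2) x := by
  have h1 := ctx.charSol (hΨ g hg).1 (hΨ g hg).2
  have h2 := ctx.charSol_phaseExt hΨ (f := fun y => g y.1.1 y.1.2) hg.restrict
  have h3 := h1.unique ctx h2 fun r υ hE => by rw [phaseExt_of_mem hE]
  have h4 := congrFun (congrFun (congrFun h3 t) x.1.1) x.1.2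
  rwa [posTime_of_nonneg ht, posTime_of_nonneg ht] at h4

lemma NTEContext.exists_pfSystem (ctx : NTEContext D vmin vmax σs σf πs πf)
    (hH2 : ∃ c : ℝ, 0 < c ∧ ∀ r ∈ D, ∀ υ ∈ Vel vmin vmax, ∀ υ' ∈ Vel vmin vmax,
      c ≤ σs r υ * πs r υ υ' + σf r υ * πf r υ υ')
    (hΨ : ∀ h : Pt → Pt → ℝ, BddMeasNN h →
      IsMildSolution D (Vel vmin vmax) σs σf πs πf h (Ψ h) ∧ TimeLocBounded (Ψ h)) :
    ∃ τ c C : ℝ, PFSystem (volume.comap (Subtype.val : ↥(D ×ˢ Vel vmin vmax) → Pt × Pt))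
      (phaseSemigroup Ψ) (fun x => (fwdTime D x.1.1 x.1.2).toReal)
      (fun x => (bwdTime D x.1.1 x.1.2).toReal) τ c C := by
  obtain ⟨c₀, hc₀, hcK⟩ := hH2
  obtain ⟨β, K, hβ, hK, hσ, -, hKb⟩ := ctx.exists_bounds
  have hvmax : 0 < vmax := ctx.vmin_pos.trans ctx.vmin_lt_vmax
  have hDm := ctx.D_open.measurableSet
  have hE := ctx.measurableSet_phase
  have hfin := isFiniteMeasure_comap_phase ctx.D_bounded hDm vmin vmax
  obtain ⟨T, hT0, hT⟩ := exists_flightTime_le (vmax := vmax) ctx.D_bounded ctx.vmin_pos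
  have hfwd : ∀ x : ↥(D ×ˢ Vel vmin vmax), fwdTime D x.1.1 x.1.2 ≠ ⊤ := fun x =>
    ne_top_of_le_ne_top ENNReal.ofReal_ne_top (hT x.1 x.2).1
  have ha : BddNN fun x : ↥(D ×ˢ Vel vmin vmax) => (fwdTime D x.1.1 x.1.2).toReal :=
    ⟨((measurable_fwdTime hDm).comp measurable_subtype_coe).ennreal_toReal,
      fun _ => ENNReal.toReal_nonneg, T, fun x =>
      ENNReal.toReal_le_of_le_ofReal hT0.le (hT x.1 x.2).1⟩
  have hb : BddNN fun x : ↥(D ×ˢ Vel vmin vmax) => (bwdTime D x.1.1 x.1.2).toReal :=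
    ⟨((measurable_bwdTime hDm).comp measurable_subtype_coe).ennreal_toReal,
      fun _ => ENNReal.toReal_nonneg, T, fun x =>
      ENNReal.toReal_le_of_le_ofReal hT0.le (hT x.1 x.2).2⟩
  have hpos : ∀ x : ↥(D ×ˢ Vel vmin vmax), 0 < (fwdTime D x.1.1 x.1.2).toReal ∧
      0 < (bwdTime D x.1.1 x.1.2).toReal := fun x => by
    obtain ⟨k, hk, hkK⟩ := exists_le_flightTime ctx.D_open hvmax
      (isCompact_singleton (x := x.1)) (singleton_subset_iff.2 x.2)
    have h1 := hkK x.1 rfl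
    have h2 := hT x.1 x.2
    exact ⟨hk.trans_le ((ENNReal.ofReal_le_iff_le_toReal
      (ne_top_of_le_ne_top ENNReal.ofReal_ne_top h2.1)).1 h1.1),
      hk.trans_le ((ENNReal.ofReal_le_iff_le_toReal
      (ne_top_of_le_ne_top ENNReal.ofReal_ne_top h2.2)).1 h1.2)⟩
  have hsol := fun f (hf : BddNN f) => ctx.charSol_phaseExt hΨ (f := f) hf
  have hΨnn : ∀ f : ↥(D ×ˢ Vel vmin vmax) → ℝ, BddNN f → ∀ t r υ,
      0 ≤ Ψ (phaseExt f) t r υ := fun f hf => (hΨ _ (hf.bddMeasNN_phaseExt hE)).1.2.1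
  have hval : ∀ (f : ↥(D ×ˢ Vel vmin vmax) → ℝ) t, 0 ≤ t → ∀ x,
      posTime (Ψ (phaseExt f)) t x.1.1 x.1.2 = phaseSemigroup Ψ t f x := fun f t ht x => by
    rw [posTime_of_nonneg ht]; rfl
  have hbdd : ∀ t (f : ↥(D ×ˢ Vel vmin vmax) → ℝ), BddNN f → BddNN (phaseSemigroup Ψ t f) := by
    intro t f hf
    obtain ⟨h1, h2, h3, -, -⟩ := (hΨ _ (hf.bddMeasNN_phaseExt hE)).1
    exact BddMeasNN.restrict ⟨h1 t, h2 t, h3 t⟩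
  obtain ⟨τ, hτ, κ, L, hκ, hL, htwo⟩ := KinBounds.exists_two_sided_bound (K := ENNReal.ofReal K)
    (c := ENNReal.ofReal c₀) ctx.D_open ctx.D_nonempty ctx.D_bounded ctx.vmin_pos
    ctx.vmin_lt_vmax ENNReal.ofReal_ne_top (by simpa using hc₀) hβ.le
  have htwo' : ∀ (f : ↥(D ×ˢ Vel vmin vmax) → ℝ), BddNN f → ∀ x,
      κ * ENNReal.ofReal (∫ x, f x * (bwdTime D x.1.1 x.1.2).toReal ∂(volume.comap Subtype.val)) *
        fwdTime D x.1.1 x.1.2 ≤ ENNReal.ofReal (phaseSemigroup Ψ τ f x) ∧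
      ENNReal.ofReal (phaseSemigroup Ψ τ f x) ≤
      L * ENNReal.ofReal (∫ x, f x * (bwdTime D x.1.1 x.1.2).toReal ∂(volume.comap Subtype.val)) *
        fwdTime D x.1.1 x.1.2 := by
    intro f hf x
    have h1 := htwo _ _ ((hsol f hf).kinBounds ctx (fun t r υ => by
      rw [posTime]; split_ifs
      exacts [hΨnn f hf t r υ, le_rfl]) (hf.bddMeasNN_phaseExt hE) hσ hKb hcK) x.1.1 x.1.2 x.2
    rwa [flightMass_phaseExt ctx.D_bounded hDm ctx.vmin_pos hf hb, hval f τ hτ.le x] at h1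
  have hκ1 : min κ 1 ≠ ⊤ := ne_top_of_le_ne_top ENNReal.one_ne_top (min_le_right _ _)
  have hc : 0 < (min κ 1).toReal := ENNReal.toReal_pos (by simp [hκ]) hκ1
  refine ⟨τ, (min κ 1).toReal, L.toReal + 2 * (min κ 1).toReal, fun t f _ hf => hbdd t f hf,
    fun t f g ht hf hg => ?_, fun t k f ht hk hf => ?_, fun s t f hs ht hf => ?_, fun S => ?_,
    ha, fun x => (hpos x).1, hb, ?_, hτ, hc, by linarith [ENNReal.toReal_nonneg (a := L)],
    fun f hf x => ?_, fun f hf x => ?_⟩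
  · have h1 := (hsol _ (hf.add hg)).unique ctx ((hsol f hf).add_mul ctx (hsol g hg) 1)
      fun r υ hr => by simp only [phaseExt_of_mem hr, Pi.add_apply, one_mul]
    ext x
    have h2 := congrFun (congrFun (congrFun h1 t) x.1.1) x.1.2
    simp only [hval _ t ht, one_mul] at h2
    exact h2
  · have h1 := (hsol _ (hf.smul hk)).unique ctx ((hsol f hf).add_mul ctx (hsol f hf) (k - 1))
      fun r υ hr => by
        simp only [phaseExt_of_mem hr, Pi.smul_apply, smul_eq_mul]; ring
    ext x
    have h2 := congrFun (congrFun (congrFun h1 t) x.1.1) x.1.2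
    simp only [hval _ t ht] at h2
    rw [h2, Pi.smul_apply, smul_eq_mul]
    ring
  · have h1 := ((hsol f hf).shift ctx ht).unique ctx (hsol _ (hbdd t f hf)) fun r υ hr => by
      rw [phaseExt_of_mem hr]
      exact hval f t ht ⟨(r, υ), hr⟩
    ext x
    have h2 := congrFun (congrFun (congrFun h1 s) x.1.1) x.1.2
    rw [hval _ s hs, posTime_of_nonneg hs, hval _ _ (add_nonneg hs ht)] at h2
    exact h2
  · obtain ⟨M, hM⟩ := (hΨ _ ((BddNN.one (X := ↥(D ×ˢ Vel vmin vmax))).bddMeasNN_phaseExt hE)).2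
      (max S 1) (by positivity)
    exact ⟨M, fun t ht x => hM t ⟨ht.1, ht.2.trans (le_max_left _ _)⟩ _ _⟩
  · rw [integral_pos_iff_support_of_nonneg (ha.mul hb).nonneg ((ha.mul hb).integrable _)]
    have hsupp : Function.support (fun x : ↥(D ×ˢ Vel vmin vmax) =>
        (fwdTime D x.1.1 x.1.2).toReal * (bwdTime D x.1.1 x.1.2).toReal) = univ :=
      eq_univ_of_forall fun x => (mul_pos (hpos x).1 (hpos x).2).ne'
    rw [hsupp, comap_subtype_coe_apply hE, image_univ, Subtype.range_coe]
    exact volume_phase_pos ctx.D_open ctx.D_nonempty ctx.vmin_pos ctx.vmin_lt_vmax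
  · have hm : 0 ≤ ∫ x, f x * (bwdTime D x.1.1 x.1.2).toReal ∂(volume.comap Subtype.val) :=
      integral_nonneg (hf.mul hb).nonneg
    rw [← ENNReal.ofReal_le_ofReal_iff ((hbdd τ f hf).nonneg x)]
    refine le_trans ?_ (htwo' f hf x).1
    rw [ENNReal.ofReal_mul (mul_nonneg hc.le (ha.nonneg x)), ENNReal.ofReal_mul hc.le,
      ENNReal.ofReal_toReal hκ1, ENNReal.ofReal_toReal (hfwd x), mul_right_comm]
    gcongr
    exact min_le_left _ _
  · have hm : 0 ≤ ∫ x, f x * (bwdTime D x.1.1 x.1.2).toReal ∂(volume.comap Subtype.val) :=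
      integral_nonneg (hf.mul hb).nonneg
    have hL0 := ENNReal.toReal_nonneg (a := L)
    have h1 : 0 ≤ L.toReal + 2 * (min κ 1).toReal := by linarith
    rw [← ENNReal.ofReal_le_ofReal_iff (mul_nonneg (mul_nonneg h1 (ha.nonneg x)) hm)]
    refine (htwo' f hf x).2.trans ?_
    rw [ENNReal.ofReal_mul (mul_nonneg h1 (ha.nonneg x)), ENNReal.ofReal_mul h1,
      ENNReal.ofReal_toReal (hfwd x), mul_right_comm]
    gcongr
    rw [ENNReal.le_ofReal_iff_toReal_le hL h1]
    linarith

end Semigroup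

/-- Theorem 3.1 of the paper, Perron–Frobenius asymptotics.
Under (H1) and (H2)* there exist a leading eigenvalue `λ*`, a positive bounded measurable
right eigenfunction `φ` and a bounded measurable left eigendensity `φ̃` with positive total
mass, satisfying the eigen-relations, the compact lower bounds, and the uniform exponential
convergence of `e^{-λ* t} ψ_t[g]/φ` to `⟨φ̃, g⟩` over `0 ≤ g ≤ 1`. -/
theorem NTE_PerronFrobenius
    (D : Set Pt) (vmin vmax : ℝ) (σs σf : Pt → Pt → ℝ) (πs πf : Pt → Pt → Pt → ℝ)
    (ctx : NTEContext D vmin vmax σs σf πs πf)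
    (hH2 : ∃ c : ℝ, 0 < c ∧ ∀ r ∈ D, ∀ υ ∈ Vel vmin vmax, ∀ υ' ∈ Vel vmin vmax,
      c ≤ σs r υ * πs r υ υ' + σf r υ * πf r υ υ')
    (Ψ : (Pt → Pt → ℝ) → ℝ → Pt → Pt → ℝ)
    (hΨ : ∀ h : Pt → Pt → ℝ, BddMeasNN h →
      IsMildSolution D (Vel vmin vmax) σs σf πs πf h (Ψ h) ∧ TimeLocBounded (Ψ h)) :
    ∃ lam : ℝ, ∃ φ φt : Pt → Pt → ℝ,
      BddMeasNN φ ∧ BddMeasNN φt ∧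
      (∀ r υ : Pt, (r, υ) ∈ D ×ˢ Vel vmin vmax → 0 < φ r υ) ∧
      (∀ r υ : Pt, (r, υ) ∉ D ×ˢ Vel vmin vmax → φ r υ = 0) ∧
      (0 < ∫ p in D ×ˢ Vel vmin vmax, φt p.1 p.2) ∧
      -- (i) right eigenfunction: `ψ_t[φ] = e^{λ* t} φ` on `D × V`
      (∀ t : ℝ, 0 ≤ t → ∀ r υ : Pt, (r, υ) ∈ D ×ˢ Vel vmin vmax →
        Ψ φ t r υ = Real.exp (lam * t) * φ r υ) ∧
      -- (ii) left eigenmeasure: `⟨φ̃, ψ_t[g]⟩ = e^{λ* t} ⟨φ̃, g⟩`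
      (∀ g : Pt → Pt → ℝ, BddMeasNN g → ∀ t : ℝ, 0 ≤ t →
        (∫ p in D ×ˢ Vel vmin vmax, φt p.1 p.2 * Ψ g t p.1 p.2) =
          Real.exp (lam * t) * ∫ p in D ×ˢ Vel vmin vmax, φt p.1 p.2 * g p.1 p.2) ∧
      -- (iii) `φ` (resp. `φ̃`) is (resp. a.e.) bounded away from zero on compact subsets
      (∀ K : Set (Pt × Pt), IsCompact K → K ⊆ D ×ˢ Vel vmin vmax →
        ∃ c : ℝ, 0 < c ∧ ∀ p ∈ K, c ≤ φ p.1 p.2) ∧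
      (∀ K : Set (Pt × Pt), IsCompact K → K ⊆ D ×ˢ Vel vmin vmax →
        ∃ c : ℝ, 0 < c ∧ ∀ᵐ p : Pt × Pt ∂volume, p ∈ K → c ≤ φt p.1 p.2) ∧
      -- (iv) uniform exponential convergence
      (∃ ε : ℝ, 0 < ε ∧ ∃ C : ℝ, 0 < C ∧ ∃ T : ℝ, 0 < T ∧
        ∀ t : ℝ, T ≤ t → ∀ g : Pt → Pt → ℝ, Measurable (Function.uncurry g) →
          (∀ r υ, 0 ≤ g r υ) → (∀ r υ, g r υ ≤ 1) →
          ∀ r υ : Pt, (r, υ) ∈ D ×ˢ Vel vmin vmax →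
            |Real.exp (-(lam * t)) * Ψ g t r υ / φ r υ -
              ∫ p in D ×ˢ Vel vmin vmax, φt p.1 p.2 * g p.1 p.2| ≤
              C * Real.exp (-(ε * t))) := by
  have hE := ctx.measurableSet_phase
  have hvmax : 0 < vmax := ctx.vmin_pos.trans ctx.vmin_lt_vmax
  have hfin := isFiniteMeasure_comap_phase ctx.D_bounded ctx.D_open.measurableSet vmin vmax
  obtain ⟨τ, c, C, hPF⟩ := ctx.exists_pfSystem hH2 hΨ
  obtain ⟨T, hT0, hT⟩ := exists_flightTime_le (vmax := vmax) ctx.D_bounded ctx.vmin_pos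
  obtain ⟨lam, φ, d, hφ, hd, ⟨k, hk, hkφ⟩, ⟨l, hl, hld⟩, heig, hleft, ε, hε, K, hK, S, hS, hconv⟩ :=
    hPF.perronFrobenius
  have hintegral : ∀ g : Pt → Pt → ℝ, ∫ p in D ×ˢ Vel vmin vmax, phaseExt d p.1 p.2 * g p.1 p.2 =
      ∫ x, d x * g x.1.1 x.1.2 ∂(volume.comap (Subtype.val : ↥(D ×ˢ Vel vmin vmax) → Pt × Pt)) := by
    intro g
    rw [← integral_comap_phase hE fun p => phaseExt d p.1 p.2 * g p.1 p.2]
    simp only [phaseExt_coe]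
  refine ⟨lam, phaseExt φ, phaseExt d, hφ.bddMeasNN_phaseExt hE, hd.bddMeasNN_phaseExt hE,
    fun r υ h => ?_, fun r υ h => phaseExt_of_notMem h, ?_, fun t ht r υ h => ?_,
    fun g hg t ht => ?_, fun A hA hAE => ?_, fun A hA hAE => ?_, ε, hε, K, hK, S, hS,
    fun t ht g hgm hg0 hg1 r υ h => ?_⟩
  · rw [phaseExt_of_mem h]
    exact (mul_pos hk (hPF.left_pos _)).trans_le (hkφ _)
  · rw [← integral_comap_phase hE fun p => phaseExt d p.1 p.2]
    simp only [phaseExt_coe]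
    obtain ⟨M, hM0, hM⟩ := hPF.left_bdd.exists_pos_bound
    have h1 := integral_mono_ae ((hPF.left_bdd.mul hPF.right_bdd).integrable _)
      ((hd.integrable _).const_mul (M / l)) (by
        filter_upwards [hld] with x hx
        refine (mul_le_mul_of_nonneg_right (hM x) (hPF.right_bdd.nonneg x)).trans ?_
        refine le_trans (le_of_eq ?_) (mul_le_mul_of_nonneg_left hx (by positivity))
        field_simp)
    rw [integral_const_mul] at h1
    exact pos_of_mul_pos_right (hPF.pairing_pos.trans_le h1) (by positivity)
  · rw [phaseExt_of_mem h]
    exact heig t ht ⟨(r, υ), h⟩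
  · rw [hintegral, hintegral, ← hleft _ hg.restrict t ht]
    exact integral_congr_ae (ae_of_all _ fun x => by
      simp only [ctx.eq_phaseSemigroup hΨ hg ht x])
  · obtain ⟨s, hs, hsA⟩ := exists_le_flightTime ctx.D_open hvmax hA hAE
    refine ⟨k * s, mul_pos hk hs, fun p hp => ?_⟩
    rw [phaseExt_of_mem (hAE hp)]
    refine (mul_le_mul_of_nonneg_left ?_ hk.le).trans (hkφ _)
    exact (ENNReal.ofReal_le_iff_le_toReal
      (ne_top_of_le_ne_top ENNReal.ofReal_ne_top (hT p (hAE hp)).1)).1 (hsA p hp).1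
  · obtain ⟨s, hs, hsA⟩ := exists_le_flightTime ctx.D_open hvmax hA hAE
    refine ⟨l * s, mul_pos hl hs, ?_⟩
    have h1 : ∀ᵐ p : Pt × Pt ∂(volume.restrict (D ×ˢ Vel vmin vmax)),
        l * (bwdTime D p.1 p.2).toReal ≤ phaseExt d p.1 p.2 := by
      rw [ae_restrict_iff_subtype hE]
      filter_upwards [hld] with x hx
      rwa [phaseExt_coe]
    rw [ae_restrict_iff' hE] at h1
    filter_upwards [h1] with p hp hpA
    refine (mul_le_mul_of_nonneg_left ?_ hl.le).trans (hp (hAE hpA))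
    exact (ENNReal.ofReal_le_iff_le_toReal
      (ne_top_of_le_ne_top ENNReal.ofReal_ne_top (hT p (hAE hpA)).2)).1 (hsA p hpA).2
  · have hg : BddMeasNN g := ⟨hgm, hg0, 1, hg1⟩
    rw [hintegral, phaseExt_of_mem h, ctx.eq_phaseSemigroup hΨ hg (hS.le.trans ht) ⟨(r, υ), h⟩]
    exact hconv t ht _ hg.restrict (fun x => hg1 _ _) ⟨(r, υ), h⟩
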